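/- arXiv:1105.1052 — 4 statements merged into one kernel-verified Lean document; each statement's English description precedes it below -/
import Mathlib

section
/- For every c > 0, L > 0, N ≥ 1 and every strictly increasing tuple of integers ℓ_1 < … < ℓ_N, the system of continuous logarithmic Bethe equations L·μ_r + Σ_{p=1}^{N} θ(μ_r − μ_p) = 2π(ℓ_r − (N+1)/2), r = 1,…,N, admits exactly one solution (μ_1,…,μ_N) ∈ ℝ^N; moreover this solution satisfies the repulsion principle in the strong form μ_1 < μ_2 < … < μ_N (in particular its entries are pairwise distinct). -/
open scoped BigOperators

/-- The function θ(λ) = 2·arctan(λ/c), the branch of i·log((ic+λ)/(ic−λ)) vanishing at 0. -/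
noncomputable def thetaFn (c lam : ℝ) : ℝ := 2 * Real.arctan (lam / c)

theorem bethe_arctan_lip {u v : ℝ} (h : u ≤ v) : Real.arctan v - Real.arctan u ≤ v - u := by
  have := image_sub_le_mul_sub_of_deriv_le (f := Real.arctan) (C := 1)
    Real.differentiable_arctan (fun x => by
      rw [Real.deriv_arctan]
      rw [div_le_one (by positivity)]
      nlinarith [sq_nonneg x]) h
  linarith

theorem bethe_theta_mono {c : ℝ} (hc : 0 < c) {a b : ℝ} (h : a ≤ b) :
    thetaFn c a ≤ thetaFn c b := by
  unfold thetaFn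
  have : Real.arctan (a / c) ≤ Real.arctan (b / c) :=
    Real.arctan_strictMono.monotone (by gcongr)
  linarith

theorem bethe_theta_lower {c : ℝ} (hc : 0 < c) {a b s : ℝ} (hs : s ≤ 0) (h : s ≤ a - b) :
    2 / c * s ≤ thetaFn c a - thetaFn c b := by
  have h1 : thetaFn c (b + s) ≤ thetaFn c a := bethe_theta_mono hc (by linarith)
  have h2 := bethe_arctan_lip (u := (b + s) / c) (v := b / c) (by gcongr; linarith)
  have h3 : b / c - (b + s) / c = -(s / c) := by ring
  have h4 : 2 / c * s = 2 * (s / c) := by ring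
  rw [h4]
  unfold thetaFn at *
  linarith

/-- One-sided contraction estimate. -/
theorem bethe_step {c L : ℝ} (hc : 0 < c) (N : ℕ) (ε : ℝ) (hε : 0 < ε)
    (hε1 : ε * (L + N * (2 / c)) ≤ 1) (x y : Fin N → ℝ) (M : ℝ)
    (hM : ∀ r, x r - y r ≤ M) (hM' : ∀ r, -M ≤ x r - y r) (r : Fin N) :
    (x r - ε * (L * x r + ∑ p : Fin N, thetaFn c (x r - x p)))
      - (y r - ε * (L * y r + ∑ p : Fin N, thetaFn c (y r - y p))) ≤ (1 - ε * L) * M := by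
  have hsum : ∑ _p : Fin N, 2 / c * (x r - y r - M) ≤
      ∑ p : Fin N, (thetaFn c (x r - x p) - thetaFn c (y r - y p)) := by
    refine Finset.sum_le_sum fun p _ => bethe_theta_lower hc ?_ ?_
    · linarith [hM r]
    · linarith [hM p]
  rw [Finset.sum_sub_distrib, Finset.sum_const, Finset.card_univ, Fintype.card_fin,
    nsmul_eq_mul] at hsum
  have h1 := mul_le_mul_of_nonneg_left hsum hε.le
  have h2 := mul_nonneg (sub_nonneg.2 hε1) (sub_nonneg.2 (hM r))
  linarith

theorem bethe_exists {c L : ℝ} (hc : 0 < c) (hL : 0 < L) (N : ℕ) (b : Fin N → ℝ) :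
    ∃ μ : Fin N → ℝ, ∀ r, L * μ r + ∑ p : Fin N, thetaFn c (μ r - μ p) = b r := by
  have hpos : 0 < L + N * (2 / c) := by positivity
  obtain ⟨ε, hε, hε1⟩ : ∃ ε : ℝ, 0 < ε ∧ ε * (L + N * (2 / c)) ≤ 1 :=
    ⟨(L + N * (2 / c))⁻¹, by positivity, by rw [inv_mul_cancel₀ hpos.ne']⟩
  have hεL : 0 ≤ 1 - ε * L := by
    have : 0 ≤ ε * (N * (2 / c)) := by positivity
    linarith
  let G : (Fin N → ℝ) → (Fin N → ℝ) := fun x r =>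
    (x r - ε * (L * x r + ∑ p : Fin N, thetaFn c (x r - x p))) + ε * b r
  obtain ⟨k, hk⟩ : ∃ k : NNReal, (k : ℝ) = 1 - ε * L :=
    ⟨Real.toNNReal (1 - ε * L), Real.coe_toNNReal _ hεL⟩
  have hG : ContractingWith k G := by
    refine ⟨?_, LipschitzWith.of_dist_le_mul fun x y => ?_⟩
    · rw [← NNReal.coe_lt_coe]
      have := mul_pos hε hL
      rw [hk, NNReal.coe_one]
      linarith
    · rw [hk]
      rw [dist_pi_le_iff (by positivity)]
      intro r
      have hb : ∀ r, |x r - y r| ≤ dist x y := fun r => dist_le_pi_dist x y r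
      have h1 := bethe_step hc N ε hε hε1 x y (dist x y)
        (fun r => (abs_le.1 (hb r)).2) (fun r => (abs_le.1 (hb r)).1) r
      have h2 := bethe_step hc N ε hε hε1 y x (dist x y)
        (fun r => by linarith [(abs_le.1 (hb r)).1])
        (fun r => by linarith [(abs_le.1 (hb r)).2]) r
      rw [Real.dist_eq, abs_le]
      constructor <;> simp only [G] <;> linarith
  refine ⟨hG.fixedPoint G, fun r => ?_⟩
  have h := congrFun (hG.fixedPoint_isFixedPt) r
  simp only [G] at h
  apply mul_left_cancel₀ hε.ne'
  linarith

theorem bethe_le {c L : ℝ} (hc : 0 < c) (hL : 0 < L) (N : ℕ) (b x y : Fin N → ℝ)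
    (hx : ∀ r, L * x r + ∑ p : Fin N, thetaFn c (x r - x p) = b r)
    (hy : ∀ r, L * y r + ∑ p : Fin N, thetaFn c (y r - y p) = b r) (i : Fin N) :
    x i ≤ y i := by
  haveI : Nonempty (Fin N) := ⟨i⟩
  obtain ⟨r, hr⟩ := Finite.exists_max (fun r => x r - y r)
  have hs : ∑ p : Fin N, thetaFn c (y r - y p) ≤ ∑ p : Fin N, thetaFn c (x r - x p) :=
    Finset.sum_le_sum fun p _ => bethe_theta_mono hc (by linarith [hr p])
  have h1 : L * x r ≤ L * y r := by linarith [hx r, hy r]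
  have h2 := le_of_mul_le_mul_left h1 hL
  linarith [hr i]

/-- For every c > 0, L > 0, N ≥ 1 and every strictly increasing tuple of
integers ℓ_1 < … < ℓ_N, the system of continuous logarithmic Bethe equations
L·μ_r + Σ_{p=1}^{N} θ(μ_r − μ_p) = 2π(ℓ_r − (N+1)/2), r = 1,…,N, admits exactly one
solution (μ_1,…,μ_N) ∈ ℝ^N; moreover this solution is strictly increasing. -/
theorem continuous_bethe_unique_solution
    (c L : ℝ) (hc : 0 < c) (hL : 0 < L) (N : ℕ) (hN : 1 ≤ N)
    (ℓ : Fin N → ℤ) (hℓ : StrictMono ℓ) :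
    ∃ μ : Fin N → ℝ,
      ((∀ r : Fin N,
          L * μ r + ∑ p : Fin N, thetaFn c (μ r - μ p)
            = 2 * Real.pi * ((ℓ r : ℝ) - (N + 1) / 2))
        ∧ StrictMono μ)
      ∧ ∀ μ' : Fin N → ℝ,
          (∀ r : Fin N,
            L * μ' r + ∑ p : Fin N, thetaFn c (μ' r - μ' p)
              = 2 * Real.pi * ((ℓ r : ℝ) - (N + 1) / 2)) → μ' = μ := by
  obtain ⟨μ, hμ⟩ := bethe_exists hc hL N
    (fun r => 2 * Real.pi * ((ℓ r : ℝ) - (N + 1) / 2))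
  refine ⟨μ, ⟨hμ, fun r s hrs => ?_⟩, fun μ' h' => funext fun i =>
    le_antisymm (bethe_le hc hL N _ _ _ h' hμ i) (bethe_le hc hL N _ _ _ hμ h' i)⟩
  by_contra! hle
  have hs : ∑ p : Fin N, thetaFn c (μ s - μ p) ≤ ∑ p : Fin N, thetaFn c (μ r - μ p) :=
    Finset.sum_le_sum fun p _ => bethe_theta_mono hc (by linarith)
  have h1 := mul_le_mul_of_nonneg_left hle hL.le
  have h2 : (ℓ r : ℝ) < ℓ s := by exact_mod_cast hℓ hrs
  have h3 := mul_lt_mul_of_pos_left h2 Real.two_pi_pos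
  have h4 := hμ r
  have h5 := hμ s
  linarith
end

section
/- Let c > 0, L > 0, N ≥ 1 and fix integers ℓ_1 < … < ℓ_N. For an even integer M set Δ := L/M and define p_Δ(λ) := M·[arctan(2λΔ/(4 + cΔ)) + arctan(2λΔ/(4 − cΔ))]. Then there exists Δ̃ ∈ (0, 4/c) such that for every even integer M with Δ = L/M < Δ̃, the lattice logarithmic Bethe equations p_Δ(μ_r) + Σ_{p=1}^{N} θ(μ_r − μ_p) = 2π(ℓ_r − (N+1)/2), r = 1,…,N, have exactly one solution (μ_1,…,μ_N) ∈ ℝ^N, and this solution satisfies μ_1 < μ_2 < … < μ_N. -/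
open scoped BigOperators

/-- The lattice momentum p_Δ(λ) = M·[arctan(2λΔ/(4+cΔ)) + arctan(2λΔ/(4−cΔ))], the real
form of −i·log(d(λ)/a(λ)) for the Izergin–Korepin discretization with M sites and
lattice spacing Δ. -/
noncomputable def pLat (c Δ : ℝ) (M : ℕ) (lam : ℝ) : ℝ :=
  M * (Real.arctan (2 * lam * Δ / (4 + c * Δ)) + Real.arctan (2 * lam * Δ / (4 - c * Δ)))


/-- Existence for an abstract system of Bethe type (maximal subsolution argument). -/
theorem bethe_abs_exists {N : ℕ} (p θ : ℝ → ℝ) (hp : StrictMono p) (hpc : Continuous p)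
    (hθ : Monotone θ) (hθc : Continuous θ) (h0 : θ 0 = 0) (y : Fin N → ℝ) (R : ℝ) (hR : 0 ≤ R)
    (h1 : ∀ r, y r < p R) (h2 : ∀ r, p (-R) < y r) :
    ∃ μ : Fin N → ℝ, ∀ r, p (μ r) + ∑ q, θ (μ r - μ q) = y r := by
  let K : Set (Fin N → ℝ) := Set.Icc (fun _ => -R) (fun _ => R) ∩
    {μ | ∀ r, p (μ r) + ∑ q, θ (μ r - μ q) ≤ y r}
  have hK : IsCompact K := by
    apply isCompact_Icc.inter_right
    simp only [Set.ofPred_forall]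
    refine isClosed_iInter fun r => isClosed_le ?_ continuous_const
    fun_prop
  have hne : K.Nonempty := by
    refine ⟨fun _ => -R, ⟨le_refl _, fun _ => by linarith⟩, fun r => ?_⟩
    simp only [sub_self, h0, Finset.sum_const_zero, add_zero]
    exact (h2 r).le
  obtain ⟨u, ⟨⟨hu1, hu2⟩, hu3⟩, hmax⟩ := hK.exists_isMaxOn hne
    (f := fun μ => ∑ q, μ q) (by fun_prop)
  refine ⟨u, fun r => le_antisymm (hu3 r) ?_⟩
  by_contra! hlt
  have hur : u r < R := by
    refine lt_of_le_of_ne (hu2 r) fun h => ?_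
    have : 0 ≤ ∑ q, θ (u r - u q) := by
      refine Finset.sum_nonneg fun q _ => ?_
      rw [← h0]
      apply hθ
      have := hu2 q
      simp only at this
      linarith
    have h3 := h1 r
    rw [← h] at h3
    linarith
  have hcont : Continuous fun t => p ((Function.update u r t) r) +
      ∑ q, θ ((Function.update u r t) r - (Function.update u r t) q) := by
    have : ∀ q, Continuous fun t => (Function.update u r t) q := fun q =>
      (continuous_apply q).comp ((continuous_const (y := u)).update r continuous_id)
    have := this r
    fun_prop
  have hev : ∀ᶠ t in nhds (u r), p ((Function.update u r t) r) +
      ∑ q, θ ((Function.update u r t) r - (Function.update u r t) q) < y r := by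
    apply (hcont.tendsto (u r)).eventually_lt_const
    simpa using hlt
  have hev2 := (hev.filter_mono (nhdsWithin_le_nhds (s := Set.Ioi (u r)))).and
    (Ioo_mem_nhdsGT hur)
  obtain ⟨t, ht, ht1, ht2⟩ := hev2.exists
  have hle : ∀ q, u q ≤ Function.update u r t q := by
    intro q
    by_cases hq : q = r
    · subst hq; simpa using ht1.le
    · simp [hq]
  have hmem : Function.update u r t ∈ K := by
    refine ⟨⟨fun q => (hu1 q).trans (hle q), fun q => ?_⟩, fun s => ?_⟩
    · by_cases hq : q = r
      · subst hq; simpa using ht2.le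
      · simpa [hq] using hu2 q
    · by_cases hs : s = r
      · subst hs; exact ht.le
      · refine le_trans ?_ (hu3 s)
        have hs' : Function.update u r t s = u s := by simp [hs]
        rw [hs']
        gcongr with q
        apply hθ
        linarith [hle q]
  have h4 : ∑ q, Function.update u r t q ≤ ∑ q, u q := hmax hmem
  have h5 : ∑ q, u q < ∑ q, Function.update u r t q :=
    Finset.sum_lt_sum (fun q _ => hle q) ⟨r, Finset.mem_univ _, by simpa using ht1⟩
  linarith

/-- Comparison of two solutions. -/
theorem bethe_abs_le {N : ℕ} (p θ : ℝ → ℝ) (hp : StrictMono p)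
    (hθ : Monotone θ) (y u v : Fin N → ℝ)
    (hu : ∀ r, p (u r) + ∑ q, θ (u r - u q) = y r)
    (hv : ∀ r, p (v r) + ∑ q, θ (v r - v q) = y r) : u ≤ v := by
  intro s
  by_contra! hs
  have : Nonempty (Fin N) := ⟨s⟩
  obtain ⟨r, hr⟩ := Finite.exists_max fun q => u q - v q
  have h1 : v r < u r := by linarith [hr s]
  have h2 : ∑ q, θ (v r - v q) ≤ ∑ q, θ (u r - u q) := by
    refine Finset.sum_le_sum fun q _ => hθ ?_
    linarith [hr q]
  linarith [hu r, hv r, hp h1]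

/-- Solutions are ordered like the right-hand sides. -/
theorem bethe_abs_mono {N : ℕ} (p θ : ℝ → ℝ) (hp : StrictMono p)
    (hθ : Monotone θ) (y u : Fin N → ℝ) (hy : StrictMono y)
    (hu : ∀ r, p (u r) + ∑ q, θ (u r - u q) = y r) : StrictMono u := by
  intro r s hrs
  by_contra! h
  have h2 : ∑ q, θ (u s - u q) ≤ ∑ q, θ (u r - u q) :=
    Finset.sum_le_sum fun q _ => hθ (by linarith)
  linarith [hu r, hu s, hp.monotone h, hy hrs]

theorem pLat_strictMono {c Δ : ℝ} {M : ℕ} (hM : 0 < M) (hΔ : 0 < Δ) (h1 : 0 < 4 + c * Δ)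
    (h2 : 0 < 4 - c * Δ) : StrictMono (pLat c Δ M) := by
  intro a b hab
  unfold pLat
  have : (0 : ℝ) < M := by exact_mod_cast hM
  gcongr

theorem pLat_continuous (c Δ : ℝ) (M : ℕ) : Continuous (pLat c Δ M) := by
  unfold pLat
  have := Real.continuous_arctan
  fun_prop

theorem pLat_neg (c Δ : ℝ) (M : ℕ) (x : ℝ) : pLat c Δ M (-x) = - pLat c Δ M x := by
  unfold pLat
  have e : ∀ d : ℝ, 2 * -x * Δ / d = -(2 * x * Δ / d) := fun d => by ring
  rw [e, e, Real.arctan_neg, Real.arctan_neg]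
  ring

theorem pLat_tendsto {c Δ : ℝ} (M : ℕ) (hΔ : 0 < Δ) (h1 : 0 < 4 + c * Δ)
    (h2 : 0 < 4 - c * Δ) :
    Filter.Tendsto (pLat c Δ M) Filter.atTop (nhds (M * Real.pi)) := by
  have key : ∀ d : ℝ, 0 < d → Filter.Tendsto (fun x : ℝ => Real.arctan (2 * x * Δ / d))
      Filter.atTop (nhds (Real.pi / 2)) := by
    intro d hd
    have h : Filter.Tendsto (fun x : ℝ => 2 * x * Δ / d) Filter.atTop Filter.atTop := by
      have e : (fun x : ℝ => 2 * x * Δ / d) = fun x => (2 * Δ / d) * x := by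
        funext x; ring
      rw [e]
      exact Filter.tendsto_id.const_mul_atTop (by positivity)
    exact (tendsto_nhds_of_tendsto_nhdsWithin Real.tendsto_arctan_atTop).comp h
  have := ((key _ h1).add (key _ h2)).const_mul (M : ℝ)
  rw [add_halves] at this
  exact this

theorem thetaFn_monotone {c : ℝ} (hc : 0 < c) : Monotone (thetaFn c) := by
  intro a b hab
  unfold thetaFn
  have := Real.arctan_strictMono.monotone (div_le_div_of_nonneg_right hab hc.le)
  linarith

theorem thetaFn_continuous (c : ℝ) : Continuous (thetaFn c) := by
  unfold thetaFn
  have := Real.continuous_arctan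
  fun_prop

/-- there exists Δ̃ ∈ (0, 4/c) such that for every even integer M with
Δ = L/M < Δ̃ the lattice logarithmic Bethe equations admit exactly one solution, and this
solution is strictly increasing. -/
theorem lattice_bethe_unique_solution
    (c L : ℝ) (hc : 0 < c) (hL : 0 < L) (N : ℕ) (hN : 1 ≤ N)
    (ℓ : Fin N → ℤ) (hℓ : StrictMono ℓ) :
    ∃ Δt : ℝ, 0 < Δt ∧ Δt < 4 / c ∧
      ∀ M : ℕ, Even M → 0 < M → L / M < Δt →
        ∃ μ : Fin N → ℝ,
          ((∀ r : Fin N,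
              pLat c (L / M) M (μ r) + ∑ p : Fin N, thetaFn c (μ r - μ p)
                = 2 * Real.pi * ((ℓ r : ℝ) - (N + 1) / 2))
            ∧ StrictMono μ)
          ∧ ∀ μ' : Fin N → ℝ,
              (∀ r : Fin N,
                pLat c (L / M) M (μ' r) + ∑ p : Fin N, thetaFn c (μ' r - μ' p)
                  = 2 * Real.pi * ((ℓ r : ℝ) - (N + 1) / 2)) → μ' = μ := by
  set y : Fin N → ℝ := fun r => 2 * Real.pi * ((ℓ r : ℝ) - (N + 1) / 2) with hydef
  have hy : StrictMono y := by
    intro r s hrs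
    have h : (ℓ r : ℝ) < ℓ s := by exact_mod_cast hℓ hrs
    have := Real.pi_pos
    simp only [hydef]
    gcongr
  set Y : ℝ := ∑ r, |y r| with hY
  have hY0 : 0 ≤ Y := Finset.sum_nonneg fun _ _ => abs_nonneg _
  have hYr : ∀ r, |y r| ≤ Y := fun r =>
    Finset.single_le_sum (f := fun r => |y r|) (fun _ _ => abs_nonneg _) (Finset.mem_univ r)
  refine ⟨min (2 / c) (L / (Y + 1)), by positivity, ?_, ?_⟩
  · refine (min_le_left _ _).trans_lt ?_
    gcongr
    norm_num
  intro M _ hM hlt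
  have hM' : (0 : ℝ) < M := by exact_mod_cast hM
  have hΔ : 0 < L / M := by positivity
  have ha : L / M < 2 / c := hlt.trans_le (min_le_left _ _)
  have hb : L / M < L / (Y + 1) := hlt.trans_le (min_le_right _ _)
  have hMY : Y + 1 < M := by
    rwa [div_lt_div_iff_of_pos_left hL hM' (by positivity)] at hb
  have hcd : c * (L / M) < 2 := by
    rw [lt_div_iff₀ hc] at ha
    linarith
  have h1 : 0 < 4 + c * (L / M) := by positivity
  have h2 : 0 < 4 - c * (L / M) := by linarith
  have hp := pLat_strictMono hM hΔ h1 h2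
  have hYpi : Y < M * Real.pi := by nlinarith [Real.pi_gt_three]
  obtain ⟨R, hRY, hR0⟩ := (((pLat_tendsto M hΔ h1 h2).eventually_const_lt hYpi).and
    (Filter.eventually_ge_atTop 0)).exists
  have hth := thetaFn_monotone hc
  obtain ⟨μ, hμ⟩ := bethe_abs_exists (pLat c (L / M) M) (thetaFn c) hp (pLat_continuous _ _ _)
    hth (thetaFn_continuous c) (by simp [thetaFn]) y R hR0
    (fun r => by linarith [hYr r, le_abs_self (y r)])
    (fun r => by rw [pLat_neg]; linarith [hYr r, neg_abs_le (y r)])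
  refine ⟨μ, ⟨hμ, bethe_abs_mono _ _ hp hth y μ hy hμ⟩, fun ν hν => ?_⟩
  exact le_antisymm (bethe_abs_le _ _ hp hth y ν μ hν hμ) (bethe_abs_le _ _ hp hth y μ ν hμ hν)
end

section
/- Let c > 0, L > 0, N ≥ 1 and fix integers ℓ_1 < … < ℓ_N. For even M large enough let (μ_1(Δ),…,μ_N(Δ)) ∈ ℝ^N, Δ = L/M, denote the unique solution of the lattice logarithmic Bethe equations p_Δ(μ_r) + Σ_{p=1}^{N} θ(μ_r − μ_p) = 2π(ℓ_r − (N+1)/2), r = 1,…,N, and let (μ^c_1,…,μ^c_N) ∈ ℝ^N be the unique solution of the continuous logarithmic Bethe equations L·μ_r + Σ_{p=1}^{N} θ(μ_r − μ_p) = 2π(ℓ_r − (N+1)/2). Then for each r = 1,…,N one has lim_{M→∞, M even} μ_r(L/M) = μ^c_r. -/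
open scoped BigOperators
open Filter

theorem aux_arctan_lim (x L s : ℝ) :
    Tendsto (fun M : ℕ => (M : ℝ) * Real.arctan (2 * x * (L / M) / (4 + s * (L / M)))) atTop
      (nhds (L * x / 2)) := by
  have hΔ : Tendsto (fun M : ℕ => L / (M : ℝ)) atTop (nhds 0) :=
    tendsto_const_div_atTop_nhds_zero_nat L
  have hden : Tendsto (fun M : ℕ => 4 + s * (L / (M : ℝ))) atTop (nhds 4) := by
    simpa using (hΔ.const_mul s).const_add 4
  have hu : Tendsto (fun M : ℕ => 2 * x * (L / M) / (4 + s * (L / M))) atTop (nhds 0) := by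
    have h := (hΔ.const_mul (2 * x)).div hden (by norm_num)
    rw [mul_zero, zero_div] at h
    exact h
  have hv : Tendsto (fun M : ℕ => 2 * x * L / (4 + s * (L / (M : ℝ)))) atTop
      (nhds (2 * x * L / 4)) := tendsto_const_nhds.div hden (by norm_num)
  have hg : Tendsto (dslope Real.arctan 0) (nhds 0) (nhds 1) := by
    have h := (continuousAt_dslope_same (f := Real.arctan) (a := 0)).2
      Real.differentiable_arctan.differentiableAt
    have h' := h.tendsto
    simpa [dslope_same] using h'
  have hm := hv.mul (hg.comp hu)
  have e : 2 * x * L / 4 * 1 = L * x / 2 := by ring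
  rw [e] at hm
  refine hm.congr' ?_
  filter_upwards [eventually_gt_atTop 0] with M hM
  have hM' : (M : ℝ) ≠ 0 := by positivity
  have h := sub_smul_dslope Real.arctan 0 (2 * x * (L / M) / (4 + s * (L / M)))
  simp only [sub_zero, Real.arctan_zero, smul_eq_mul] at h
  rw [← h, Function.comp_apply, ← mul_assoc]
  congr 1
  field_simp

theorem aux_pLat_lim (c L x : ℝ) :
    Tendsto (fun M : ℕ => pLat c (L / M) M x) atTop (nhds (L * x)) := by
  have h := (aux_arctan_lim x L c).add (aux_arctan_lim x L (-c))
  have e : L * x / 2 + L * x / 2 = L * x := by ring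
  rw [e] at h
  refine h.congr fun M => ?_
  unfold pLat
  rw [mul_add, show 4 + -c * (L / (M : ℝ)) = 4 - c * (L / M) by ring]

theorem aux_pLat_mono (c Δ : ℝ) (M : ℕ) (h0 : 0 ≤ Δ) (h1 : 0 < 4 + c * Δ)
    (h2 : 0 < 4 - c * Δ) : Monotone (pLat c Δ M) := by
  intro x y hxy
  unfold pLat
  have a : Real.arctan (2 * x * Δ / (4 + c * Δ)) ≤ Real.arctan (2 * y * Δ / (4 + c * Δ)) :=
    Real.arctan_strictMono.monotone (by gcongr)
  have b : Real.arctan (2 * x * Δ / (4 - c * Δ)) ≤ Real.arctan (2 * y * Δ / (4 - c * Δ)) :=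
    Real.arctan_strictMono.monotone (by gcongr)
  gcongr

theorem aux_theta_mono (c : ℝ) (hc : 0 < c) : Monotone (thetaFn c) := by
  intro x y hxy
  unfold thetaFn
  have : Real.arctan (x / c) ≤ Real.arctan (y / c) :=
    Real.arctan_strictMono.monotone (by gcongr)
  linarith

/-- the unique solutions μ(Δ) (Δ = L/M) of the lattice logarithmic Bethe
equations converge, entrywise as M → ∞ through even integers, to the unique solution μ^c
of the continuous logarithmic Bethe equations. -/
theorem lattice_bethe_roots_converge_to_continuous
    (c L : ℝ) (hc : 0 < c) (hL : 0 < L) (N : ℕ) (hN : 1 ≤ N)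
    (ℓ : Fin N → ℤ) (hℓ : StrictMono ℓ)
    (M0 : ℕ) (μsol : ℕ → Fin N → ℝ) (μc : Fin N → ℝ)
    -- for even M large enough, μsol M is the unique solution of the lattice equations
    (hlat : ∀ M : ℕ, Even M → M0 ≤ M →
      (∀ r : Fin N,
        pLat c (L / M) M (μsol M r) + ∑ p : Fin N, thetaFn c (μsol M r - μsol M p)
          = 2 * Real.pi * ((ℓ r : ℝ) - (N + 1) / 2)))
    (hlatuniq : ∀ M : ℕ, Even M → M0 ≤ M → ∀ μ' : Fin N → ℝ,
      (∀ r : Fin N,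
        pLat c (L / M) M (μ' r) + ∑ p : Fin N, thetaFn c (μ' r - μ' p)
          = 2 * Real.pi * ((ℓ r : ℝ) - (N + 1) / 2)) → μ' = μsol M)
    -- μc is the unique solution of the continuous equations
    (hcont : ∀ r : Fin N,
      L * μc r + ∑ p : Fin N, thetaFn c (μc r - μc p)
        = 2 * Real.pi * ((ℓ r : ℝ) - (N + 1) / 2))
    (hcontuniq : ∀ μ' : Fin N → ℝ,
      (∀ r : Fin N,
        L * μ' r + ∑ p : Fin N, thetaFn c (μ' r - μ' p)
          = 2 * Real.pi * ((ℓ r : ℝ) - (N + 1) / 2)) → μ' = μc) :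
    ∀ r : Fin N,
      Tendsto (fun M : ℕ => μsol M r) (atTop ⊓ 𝓟 {M : ℕ | Even M}) (nhds (μc r)) := by
  have hΔ : Tendsto (fun M : ℕ => L / (M : ℝ)) atTop (nhds 0) :=
    tendsto_const_div_atTop_nhds_zero_nat L
  have hp : ∀ᶠ M : ℕ in atTop, 0 < 4 - c * (L / (M : ℝ)) := by
    have h : Tendsto (fun M : ℕ => 4 - c * (L / (M : ℝ))) atTop (nhds 4) := by
      simpa using (hΔ.const_mul c).const_sub 4
    exact h.eventually (lt_mem_nhds (by norm_num))
  haveI : Nonempty (Fin N) := ⟨⟨0, hN⟩⟩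
  intro r
  rw [Metric.tendsto_nhds]
  intro ε hε
  rw [eventually_inf_principal]
  have hup : ∀ᶠ M : ℕ in atTop, ∀ q : Fin N, L * μc q < pLat c (L / M) M (μc q + ε) := by
    rw [eventually_all]
    intro q
    exact (aux_pLat_lim c L (μc q + ε)).eventually (lt_mem_nhds (by nlinarith))
  have hdn : ∀ᶠ M : ℕ in atTop, ∀ q : Fin N, pLat c (L / M) M (μc q - ε) < L * μc q := by
    rw [eventually_all]
    intro q
    exact (aux_pLat_lim c L (μc q - ε)).eventually (gt_mem_nhds (by nlinarith))
  filter_upwards [hp, hup, hdn, eventually_ge_atTop M0] with M hM hu hd hM0 hev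
  have hΔ0 : 0 ≤ L / (M : ℝ) := by positivity
  have hmono := aux_pLat_mono c (L / M) M hΔ0 (by positivity) hM
  have hθ := aux_theta_mono c hc
  have hl := hlat M hev hM0
  obtain ⟨a, ha⟩ := Finite.exists_max (fun q => μsol M q - μc q)
  obtain ⟨b, hb⟩ := Finite.exists_min (fun q => μsol M q - μc q)
  have h1 : ∑ p : Fin N, thetaFn c (μc a - μc p)
      ≤ ∑ p : Fin N, thetaFn c (μsol M a - μsol M p) :=
    Finset.sum_le_sum fun p _ => hθ (by have := ha p; linarith)
  have h2 : ∑ p : Fin N, thetaFn c (μsol M b - μsol M p)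
      ≤ ∑ p : Fin N, thetaFn c (μc b - μc p) :=
    Finset.sum_le_sum fun p _ => hθ (by have := hb p; linarith)
  have h3 : μsol M a < μc a + ε := by
    by_contra! h
    have := hmono h
    linarith [hl a, hcont a, hu a]
  have h4 : μc b - ε < μsol M b := by
    by_contra! h
    have := hmono h
    linarith [hl b, hcont b, hd b]
  have h5 := ha r
  have h6 := hb r
  rw [Real.dist_eq, abs_lt]
  constructor <;> linarith
end

section
/- Let c > 0, L > 0, N ≥ 1. Let (μ_1,…,μ_{N+1}) ∈ ℝ^{N+1} be a solution of the continuous logarithmic Bethe equations in the (N+1)-particle sector and (λ_1,…,λ_N) ∈ ℝ^N a solution of the continuous logarithmic Bethe equations in the N-particle sector, and assume μ_b ≠ λ_k for all b, k and Ŝ(λ_j) ≠ 1 for all j. Then (1/N!)·∫_{[0,L]^N} conj(φ(0, x_1,…,x_N | μ_1,…,μ_{N+1}))·φ(x_1,…,x_N | λ_1,…,λ_N) d^N x = i√c · ∏_{a=1}^{N+1} e^{iLμ_a/2} · ∏_{k=1}^{N} [ e^{−iLλ_k/2}·(1 − Ŝ(λ_k))·∏_{b=1}^{N+1} (μ_b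 − λ_k − ic)/(μ_b − λ_k) ] · det_{N}[δ_{jk} + U_{jk}], where U_{jk} := −i · ∏_{a=1}^{N+1} (λ_j − μ_a)/(λ_j − μ_a + ic) · [∏_{a=1}^{N} (λ_j − λ_a + ic)] / [∏_{a=1, a≠j}^{N} (λ_j − λ_a)] · K(λ_j − λ_k)/(Ŝ(λ_j) − 1); conj denotes complex conjugation. -/
open scoped BigOperators
open MeasureTheory

/-- The coordinate Bethe Ansatz wavefunction. -/
noncomputable def betheWave (c L : ℝ) (N : ℕ) (x : Fin N → ℝ) (lam : Fin N → ℂ) : ℂ :=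
  (-Complex.I * (Real.sqrt c : ℂ)) ^ N *
    ∑ σ : Equiv.Perm (Fin N),
      (∏ p ∈ Finset.univ.filter (fun p : Fin N × Fin N => p.1 < p.2),
        (lam (σ p.1) - lam (σ p.2)
            - Complex.I * (c : ℂ) * ((Real.sign (x p.1 - x p.2) : ℝ) : ℂ)) /
          (lam (σ p.1) - lam (σ p.2))) *
      ∏ a : Fin N,
        Complex.exp (Complex.I * lam (σ a) * (x a : ℂ)) *
          Complex.exp (-(Complex.I * lam (σ a) * ((L : ℂ) / 2)))

/-- The exponentiated discreet shift function
Ŝ(ω) = ∏_{a=1}^{N+1} (μ_a−ω+ic)/(μ_a−ω−ic) · ∏_{a=1}^{N} (λ_a−ω−ic)/(λ_a−ω+ic). -/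
noncomputable def shiftS (c : ℝ) (N : ℕ) (mu : Fin (N + 1) → ℂ) (lam : Fin N → ℂ)
    (ω : ℂ) : ℂ :=
  (∏ a : Fin (N + 1),
      (mu a - ω + Complex.I * (c : ℂ)) / (mu a - ω - Complex.I * (c : ℂ))) *
    ∏ a : Fin N,
      (lam a - ω - Complex.I * (c : ℂ)) / (lam a - ω + Complex.I * (c : ℂ))

section Part1
open scoped BigOperators
open Finset

namespace Bethe

section StarRing
variable {α : Type*} [DecidableEq α]

noncomputable def Wt (w : α → α → ℂ) (I J : Finset α) : ℂ := ∏ x ∈ I, ∏ y ∈ J, w x y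

noncomputable def star (w : α → α → ℂ) (f g : Finset α → ℂ) (S : Finset α) : ℂ :=
  ∑ I ∈ S.powerset, Wt w I (S \ I) * f I * g (S \ I)

def eps (S : Finset α) : ℂ := if S = ∅ then 1 else 0

lemma Wt_union_left (w : α → α → ℂ) {I J K : Finset α} (h : Disjoint I J) :
    Wt w (I ∪ J) K = Wt w I K * Wt w J K := by
  unfold Wt; rw [Finset.prod_union h]

lemma Wt_union_right (w : α → α → ℂ) {I J K : Finset α} (h : Disjoint J K) :
    Wt w I (J ∪ K) = Wt w I J * Wt w I K := by
  unfold Wt; rw [← Finset.prod_mul_distrib]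
  exact Finset.prod_congr rfl fun x _ => Finset.prod_union h

lemma star_assoc (w : α → α → ℂ) (f g k : Finset α → ℂ) :
    star w (star w f g) k = star w f (star w g k) := by
  funext S
  unfold star
  simp only [Finset.mul_sum, Finset.sum_mul]
  rw [Finset.sum_sigma', Finset.sum_sigma']
  refine Finset.sum_bij' (fun p _ => ⟨p.2, p.1 \ p.2⟩) (fun p _ => ⟨p.1 ∪ p.2, p.1⟩) ?_ ?_ ?_ ?_ ?_
  · rintro ⟨I, J⟩ h
    simp only [mem_sigma, mem_powerset] at h ⊢
    exact ⟨h.2.trans h.1, Finset.sdiff_subset_sdiff h.1 le_rfl⟩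
  · rintro ⟨J, K⟩ h
    simp only [mem_sigma, mem_powerset] at h ⊢
    exact ⟨Finset.union_subset h.1 (h.2.trans sdiff_subset), subset_union_left⟩
  · rintro ⟨I, J⟩ h
    simp only [mem_sigma, mem_powerset] at h
    simp [Finset.union_sdiff_of_subset h.2]
  · rintro ⟨J, K⟩ h
    simp only [mem_sigma, mem_powerset] at h
    have : Disjoint J K := (Finset.disjoint_sdiff (s := J) (t := S)).mono_right h.2
    simp [Finset.union_sdiff_cancel_left this]
  · rintro ⟨I, J⟩ h
    simp only [mem_sigma, mem_powerset] at h
    obtain ⟨h1, h2⟩ := h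
    have e1 : (S \ J) \ (I \ J) = S \ I := by
      ext x; simp only [mem_sdiff]; constructor
      · rintro ⟨⟨a, b⟩, c⟩; exact ⟨a, fun h => c ⟨h, b⟩⟩
      · rintro ⟨a, b⟩; exact ⟨⟨a, fun h => b (h2 h)⟩, fun h => b h.1⟩
    have e2 : S \ J = (I \ J) ∪ (S \ I) := by
      ext x; simp only [mem_sdiff, mem_union]; constructor
      · rintro ⟨a, b⟩; by_cases hx : x ∈ I
        · exact Or.inl ⟨hx, b⟩
        · exact Or.inr ⟨a, hx⟩
      · rintro (⟨a, b⟩ | ⟨a, b⟩)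
        · exact ⟨h1 a, b⟩
        · exact ⟨a, fun h => b (h2 h)⟩
    have d2 : Disjoint (I \ J) (S \ I) :=
      Finset.disjoint_left.2 fun x hx hy => (mem_sdiff.1 hy).2 (mem_sdiff.1 hx).1
    have e3 : Wt w I (S \ I) = Wt w J (S \ I) * Wt w (I \ J) (S \ I) := by
      rw [← Wt_union_left w Finset.disjoint_sdiff, Finset.union_sdiff_of_subset h2]
    have e4 : Wt w J (S \ J) = Wt w J (I \ J) * Wt w J (S \ I) := by
      rw [e2, Wt_union_right w d2]
    dsimp only
    rw [e1, e3, e4]; ring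

lemma star_add_left (w : α → α → ℂ) (f g k : Finset α → ℂ) :
    star w (f + g) k = star w f k + star w g k := by
  funext S; simp only [star, Pi.add_apply, ← Finset.sum_add_distrib]
  exact Finset.sum_congr rfl fun _ _ => by ring

lemma star_add_right (w : α → α → ℂ) (f g k : Finset α → ℂ) :
    star w k (f + g) = star w k f + star w k g := by
  funext S; simp only [star, Pi.add_apply, ← Finset.sum_add_distrib]
  exact Finset.sum_congr rfl fun _ _ => by ring

lemma star_zero_left (w : α → α → ℂ) (k : Finset α → ℂ) : star w 0 k = 0 := by
  funext S; simp [star]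

lemma star_zero_right (w : α → α → ℂ) (k : Finset α → ℂ) : star w k 0 = 0 := by
  funext S; simp [star]

lemma eps_star (w : α → α → ℂ) (k : Finset α → ℂ) : star w eps k = k := by
  funext S
  unfold star
  rw [Finset.sum_eq_single ∅]
  · simp [eps, Wt]
  · intro I _ h; simp [eps, h]
  · simp

lemma star_eps (w : α → α → ℂ) (k : Finset α → ℂ) : star w k eps = k := by
  funext S
  unfold star
  rw [Finset.sum_eq_single S]
  · simp [eps, Wt]
  · intro I hI h
    have : S \ I ≠ ∅ := fun h' => h ((mem_powerset.1 hI).antisymm (sdiff_eq_empty_iff_subset.1 h'))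
    simp [eps, this]
  · simp

lemma star_insert (w : α → α → ℂ) (f g : Finset α → ℂ) (b : α) (S : Finset α) (hb : b ∉ S) :
    star w f g (insert b S) = ∑ I ∈ S.powerset, Wt w I (S \ I) *
      ((∏ y ∈ S \ I, w b y) * f (insert b I) * g (S \ I) +
       (∏ y ∈ I, w y b) * f I * g (insert b (S \ I))) := by
  unfold star
  rw [Finset.sum_powerset_insert hb, ← Finset.sum_add_distrib]
  refine Finset.sum_congr rfl fun I hI => ?_
  have hI' := mem_powerset.1 hI
  have hbI : b ∉ I := fun h => hb (hI' h)
  have e1 : insert b S \ I = insert b (S \ I) := Finset.insert_sdiff_of_notMem _ hbI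
  have e2 : insert b S \ insert b I = S \ I := by
    ext x; simp only [mem_sdiff, mem_insert]; constructor
    · rintro ⟨a, c⟩; push Not at c; exact ⟨a.resolve_left c.1, c.2⟩
    · rintro ⟨a, c⟩; refine ⟨Or.inr a, ?_⟩; rintro (h | h)
      · exact hb (h ▸ a)
      · exact c h
  have hb2 : b ∉ S \ I := fun h => hb (mem_sdiff.1 h).1
  have e3 : Wt w (insert b I) (S \ I) = (∏ y ∈ S \ I, w b y) * Wt w I (S \ I) := by
    unfold Wt; rw [Finset.prod_insert hbI]
  have e4 : Wt w I (insert b (S \ I)) = (∏ y ∈ I, w y b) * Wt w I (S \ I) := by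
    unfold Wt; rw [← Finset.prod_mul_distrib]
    exact Finset.prod_congr rfl fun x _ => Finset.prod_insert hb2
  rw [e1, e2, e3, e4]; ring

/-- functions on finite subsets, as a ring under the twisted subset convolution -/
def Sh (_w : α → α → ℂ) : Type _ := Finset α → ℂ

instance (w : α → α → ℂ) : AddCommGroup (Sh w) := inferInstanceAs (AddCommGroup (Finset α → ℂ))

noncomputable instance (w : α → α → ℂ) : Ring (Sh w) :=
  { (inferInstance : AddCommGroup (Sh w)) with
    mul := fun f g => star w f g
    one := (eps : Finset α → ℂ)
    left_distrib := fun a b c => star_add_right w b c a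
    right_distrib := fun a b c => star_add_left w a b c
    zero_mul := fun a => star_zero_left w a
    mul_zero := fun a => star_zero_right w a
    mul_assoc := fun a b c => star_assoc w a b c
    one_mul := fun a => eps_star w a
    mul_one := fun a => star_eps w a }

lemma exists_inv [Fintype α] (w : α → α → ℂ) (f : Finset α → ℂ) (hf : f ∅ = 1) :
    ∃ g, star w f g = eps ∧ star w g f = eps := by
  let F : Sh w := f
  let n : Sh w := 1 - F
  have hn : ∀ k : ℕ, ∀ S : Finset α, S.card < k → (n ^ k : Sh w) S = 0 := by
    intro k
    induction k with
    | zero => intro S h; omega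
    | succ k ih =>
      intro S hS
      rw [pow_succ]
      change star w (n ^ k : Sh w) n S = 0
      unfold star
      refine Finset.sum_eq_zero fun I hI => ?_
      by_cases h : S \ I = ∅
      · have : (n : Finset α → ℂ) (S \ I) = 0 := by
          rw [h]; change eps ∅ - f ∅ = 0; simp [eps, hf]
        rw [this, mul_zero]
      · have hIS : I ⊂ S := by
          refine (mem_powerset.1 hI).ssubset_of_ne ?_
          rintro rfl; simp at h
        have := Finset.card_lt_card hIS
        rw [ih I (by omega)]; ring
  have hnil : IsNilpotent n := by
    refine ⟨Fintype.card α + 1, ?_⟩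
    funext S
    exact hn _ S (Nat.lt_succ_of_le (Finset.card_le_univ S))
  have hu : IsUnit F := by
    have := hnil.isUnit_one_sub
    simpa [n] using this
  obtain ⟨u, hu⟩ := hu
  refine ⟨(↑u⁻¹ : Sh w), ?_, ?_⟩
  · have : F * (↑u⁻¹ : Sh w) = 1 := by rw [← hu]; simp
    exact this
  · have : (↑u⁻¹ : Sh w) * F = 1 := by rw [← hu]; simp
    exact this

end StarRing
end Bethe
end Part1

section Part2
open scoped BigOperators
open Finset

set_option linter.unusedSectionVars false

namespace Bethe

section PF

lemma pf_one {κ : Type*} [DecidableEq κ] (η : ℂ) (m : κ → ℂ) (R : Finset κ)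
    (hm : ∀ a ∈ R, ∀ b ∈ R, a ≠ b → m a ≠ m b) (x : ℂ) (hx : ∀ a ∈ R, x ≠ m a) :
    ∏ a ∈ R, (1 - η / (x - m a)) =
      1 - η * ∑ a ∈ R, (∏ b ∈ R.erase a, (1 - η / (m a - m b))) / (x - m a) := by
  induction R using Finset.induction_on generalizing x with
  | empty => simp
  | insert a₀ R ha ih =>
    have hm' : ∀ a ∈ R, ∀ b ∈ R, a ≠ b → m a ≠ m b := fun a ha b hb =>
      hm a (mem_insert_of_mem ha) b (mem_insert_of_mem hb)
    have h0 : ∀ a ∈ R, m a₀ ≠ m a := fun a h =>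
      hm a₀ (mem_insert_self _ _) a (mem_insert_of_mem h) (by rintro rfl; exact ha h)
    have hx' : ∀ a ∈ R, x ≠ m a := fun a h => hx a (mem_insert_of_mem h)
    have hx0 : x - m a₀ ≠ 0 := sub_ne_zero.2 (hx a₀ (mem_insert_self _ _))
    have i1 := ih hm' x hx'
    have i2 := ih hm' (m a₀) h0
    rw [Finset.prod_insert ha, Finset.sum_insert ha, Finset.erase_insert ha]
    have e : ∀ a ∈ R, (∏ b ∈ (insert a₀ R).erase a, (1 - η / (m a - m b))) / (x - m a)
        = (∏ b ∈ R.erase a, (1 - η / (m a - m b))) / (x - m a)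
          + (η / (x - m a₀)) * ((∏ b ∈ R.erase a, (1 - η / (m a - m b))) / (m a₀ - m a))
          - (η / (x - m a₀)) * ((∏ b ∈ R.erase a, (1 - η / (m a - m b))) / (x - m a)) := by
      intro a h
      have hne : a₀ ≠ a := by rintro rfl; exact ha h
      rw [Finset.erase_insert_of_ne hne, Finset.prod_insert (fun h' => ha (mem_erase.1 h').2)]
      have h1 : m a₀ - m a ≠ 0 := sub_ne_zero.2 (h0 a h)
      have h1' : m a - m a₀ ≠ 0 := sub_ne_zero.2 (h0 a h).symm
      have h2 : x - m a ≠ 0 := sub_ne_zero.2 (hx' a h)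
      generalize (∏ b ∈ R.erase a, (1 - η / (m a - m b))) = p
      rw [show m a₀ - m a = -(m a - m a₀) by ring]
      field_simp
      ring
    rw [Finset.sum_congr rfl e, Finset.sum_sub_distrib, Finset.sum_add_distrib,
      ← Finset.mul_sum, ← Finset.mul_sum, i1, i2]
    generalize (∑ a ∈ R, (∏ b ∈ R.erase a, (1 - η / (m a - m b))) / (x - m a)) = s
    generalize (∑ a ∈ R, (∏ b ∈ R.erase a, (1 - η / (m a - m b))) / (m a₀ - m a)) = t
    field_simp
    ring

lemma pf_two {κ : Type*} [DecidableEq κ] (η : ℂ) (m : κ → ℂ) (R : Finset κ)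
    (hm : ∀ a ∈ R, ∀ b ∈ R, a ≠ b → m a ≠ m b) (x l : ℂ) (hx : ∀ a ∈ R, x ≠ m a)
    (hl : ∀ a ∈ R, l ≠ m a) (hxl : x ≠ l) :
    (∏ a ∈ R, (1 - η / (x - m a))) * (1 / (x - l)) =
      (∏ a ∈ R, (1 - η / (l - m a))) * (1 / (x - l))
        - η * ∑ a ∈ R, (∏ b ∈ R.erase a, (1 - η / (m a - m b))) * (1 / (m a - l)) / (x - m a) := by
  rw [pf_one η m R hm x hx, pf_one η m R hm l hl]
  have e : ∀ a ∈ R, (∏ b ∈ R.erase a, (1 - η / (m a - m b))) * (1 / (m a - l)) / (x - m a)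
      = ((∏ b ∈ R.erase a, (1 - η / (m a - m b))) / (x - m a)
        - (∏ b ∈ R.erase a, (1 - η / (m a - m b))) / (l - m a)) * (1 / (x - l)) := by
    intro a h
    have h1 : l - m a ≠ 0 := sub_ne_zero.2 (hl a h)
    have h2 : x - m a ≠ 0 := sub_ne_zero.2 (hx a h)
    have h3 : x - l ≠ 0 := sub_ne_zero.2 hxl
    generalize (∏ b ∈ R.erase a, (1 - η / (m a - m b))) = p
    rw [show m a - l = -(l - m a) by ring]
    field_simp
    ring
  rw [Finset.sum_congr rfl e, ← Finset.sum_mul, Finset.sum_sub_distrib]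
  ring

lemma pf_full {ι κ : Type*} [Fintype ι] [DecidableEq κ] (η : ℂ) (lam : ι → ℂ) (m : κ → ℂ)
    (R : Finset κ)
    (hm : ∀ a ∈ R, ∀ b ∈ R, a ≠ b → m a ≠ m b) (x C : ℂ) (d : ι → ℂ) (hx : ∀ a ∈ R, x ≠ m a)
    (hl : ∀ j, ∀ a ∈ R, lam j ≠ m a) (hxl : ∀ j, x ≠ lam j) :
    (∏ a ∈ R, (1 - η / (x - m a))) * (C + ∑ j, d j / (x - lam j)) =
      C + ∑ j, (∏ a ∈ R, (1 - η / (lam j - m a))) * d j / (x - lam j)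
        - η * ∑ a ∈ R, (∏ b ∈ R.erase a, (1 - η / (m a - m b))) *
            (C + ∑ j, d j / (m a - lam j)) / (x - m a) := by
  have h1 := pf_one η m R hm x hx
  have h2 : ∀ j, (∏ a ∈ R, (1 - η / (x - m a))) * (d j / (x - lam j)) =
      (∏ a ∈ R, (1 - η / (lam j - m a))) * d j / (x - lam j)
        - η * ∑ a ∈ R, (∏ b ∈ R.erase a, (1 - η / (m a - m b))) * (d j / (m a - lam j))
            / (x - m a) := by
    intro j
    have := congrArg (fun z => z * d j) (pf_two η m R hm x (lam j) hx (hl j) (hxl j))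
    beta_reduce at this
    rw [show ∀ p : ℂ, p * (d j / (x - lam j)) = p * (1 / (x - lam j)) * d j by intro p; ring, this,
      sub_mul, mul_assoc η, Finset.sum_mul]
    congr 1
    · ring
    · congr 1; exact Finset.sum_congr rfl fun a _ => by ring
  rw [mul_add, Finset.mul_sum, Finset.sum_congr rfl fun j _ => h2 j, Finset.sum_sub_distrib,
    ← Finset.mul_sum, Finset.sum_comm, h1]
  have e : ∀ a ∈ R, (∏ b ∈ R.erase a, (1 - η / (m a - m b))) *
            (C + ∑ j, d j / (m a - lam j)) / (x - m a)
      = C * ((∏ b ∈ R.erase a, (1 - η / (m a - m b))) / (x - m a))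
        + ∑ j, (∏ b ∈ R.erase a, (1 - η / (m a - m b))) * (d j / (m a - lam j)) / (x - m a) := by
    intro a _
    rw [← Finset.sum_div, ← Finset.mul_sum]; ring
  rw [Finset.sum_congr rfl e, Finset.sum_add_distrib, ← Finset.mul_sum]
  ring

end PF

section Model
variable {ι κ : Type*} [DecidableEq ι] [DecidableEq κ]

noncomputable def ww (η : ℂ) (lam : ι → ℂ) (mu : κ → ℂ) : ι ⊕ κ → ι ⊕ κ → ℂ
  | Sum.inl j, Sum.inl k => 1 + η / (lam j - lam k)
  | Sum.inr a, Sum.inr b => 1 - η / (mu a - mu b)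
  | _, _ => 1

lemma prod_inr_left (η : ℂ) (lam : ι → ℂ) (mu : κ → ℂ) (b : κ) (T : Finset (ι ⊕ κ)) :
    ∏ y ∈ T, ww η lam mu (Sum.inr b) y = ∏ a ∈ T.toRight, (1 - η / (mu b - mu a)) := by
  conv_lhs => rw [← Finset.toLeft_disjSum_toRight (u := T)]
  rw [Finset.prod_disjSum]; simp [ww]

lemma prod_inr_right (η : ℂ) (lam : ι → ℂ) (mu : κ → ℂ) (b : κ) (T : Finset (ι ⊕ κ)) :
    ∏ y ∈ T, ww η lam mu y (Sum.inr b) = ∏ a ∈ T.toRight, (1 - (-η) / (mu b - mu a)) := by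
  conv_lhs => rw [← Finset.toLeft_disjSum_toRight (u := T)]
  rw [Finset.prod_disjSum]; simp only [ww, prod_const_one, one_mul]
  refine Finset.prod_congr rfl fun a _ => ?_
  rw [← neg_sub (mu b), div_neg, neg_div]

lemma prod_inl_left (η : ℂ) (lam : ι → ℂ) (mu : κ → ℂ) (j : ι) (T : Finset (ι ⊕ κ)) :
    ∏ y ∈ T, ww η lam mu (Sum.inl j) y = ∏ k ∈ T.toLeft, (1 + η / (lam j - lam k)) := by
  conv_lhs => rw [← Finset.toLeft_disjSum_toRight (u := T)]
  rw [Finset.prod_disjSum]; simp [ww]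

lemma prod_inl_right (η : ℂ) (lam : ι → ℂ) (mu : κ → ℂ) (j : ι) (T : Finset (ι ⊕ κ)) :
    ∏ y ∈ T, ww η lam mu y (Sum.inl j) = ∏ k ∈ T.toLeft, (1 - η / (lam j - lam k)) := by
  conv_lhs => rw [← Finset.toLeft_disjSum_toRight (u := T)]
  rw [Finset.prod_disjSum]; simp only [ww, prod_const_one, mul_one]
  refine Finset.prod_congr rfl fun a _ => ?_
  rw [← neg_sub (lam j), div_neg]; ring

/-- cancellation of the poles at coinciding mu -/
lemma pole_cancel (η : ℂ) (lam : ι → ℂ) (mu : κ → ℂ) (f g : Finset (ι ⊕ κ) → ℂ)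
    (S : Finset (ι ⊕ κ)) (q : κ → ℂ) :
    ∑ I ∈ S.powerset, Wt (ww η lam mu) I (S \ I) *
      (∑ a ∈ (S \ I).toRight, (∏ b ∈ (S \ I).toRight.erase a, (1 - η / (mu a - mu b))) *
        f (insert (Sum.inr a) I) * g (S \ I) * q a)
    = ∑ I ∈ S.powerset, Wt (ww η lam mu) I (S \ I) *
      (∑ a ∈ I.toRight, (∏ b ∈ I.toRight.erase a, (1 - (-η) / (mu a - mu b))) *
        f I * g (insert (Sum.inr a) (S \ I)) * q a) := by
  simp only [Finset.mul_sum]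
  rw [Finset.sum_comm' (t' := S.toRight)
      (s' := fun a => (S.erase (Sum.inr a)).powerset)]
  swap
  · intro I a
    simp only [mem_powerset, mem_toRight, mem_sdiff, subset_erase]; tauto
  rw [Finset.sum_comm' (s := S.powerset) (t' := S.toRight)
      (s' := fun a => S.powerset.filter (fun I => Sum.inr a ∈ I))]
  swap
  · intro I a
    simp only [mem_powerset, mem_toRight, mem_filter]
    constructor
    · rintro ⟨h, h'⟩; exact ⟨⟨h, h'⟩, h h'⟩
    · rintro ⟨h, -⟩; exact h
  refine Finset.sum_congr rfl fun a ha => ?_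
  rw [mem_toRight] at ha
  refine Finset.sum_bij' (fun I _ => insert (Sum.inr a) I) (fun I _ => I.erase (Sum.inr a))
    ?_ ?_ ?_ ?_ ?_
  · intro I hI
    simp only [mem_powerset, subset_erase] at hI
    simp [insert_subset_iff, ha, hI.1]
  · intro I hI
    simp only [mem_filter, mem_powerset] at hI
    simp only [mem_powerset]
    exact Finset.erase_subset_erase _ hI.1
  · intro I hI
    simp only [mem_powerset, subset_erase] at hI
    exact Finset.erase_insert hI.2
  · intro I hI
    simp only [mem_filter, mem_powerset] at hI
    exact Finset.insert_erase hI.2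
  · intro I hI
    simp only [mem_powerset, subset_erase] at hI
    obtain ⟨hIS, haI⟩ := hI
    set K := S \ insert (Sum.inr a) I with hK
    have haK : Sum.inr a ∉ K := by simp [hK]
    have e1 : S \ I = insert (Sum.inr a) K := by
      ext x; simp only [hK, mem_sdiff, mem_insert]
      constructor
      · rintro ⟨h1, h2⟩; by_cases hx : x = Sum.inr a
        · exact Or.inl hx
        · exact Or.inr ⟨h1, by tauto⟩
      · rintro (rfl | ⟨h1, h2⟩)
        · exact ⟨ha, haI⟩
        · exact ⟨h1, by tauto⟩
    have e2 : (insert (Sum.inr a) K).toRight.erase a = K.toRight := by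
      rw [Finset.toRight_insert_inr, Finset.erase_insert (by simpa using haK)]
    have e3 : (insert (Sum.inr a) I).toRight.erase a = I.toRight := by
      rw [Finset.toRight_insert_inr, Finset.erase_insert (by simpa using haI)]
    rw [e1, e2, e3, ← prod_inr_left η lam mu a K, ← prod_inr_right η lam mu a I]
    have e4 : Wt (ww η lam mu) I (insert (Sum.inr a) K)
        = (∏ y ∈ I, ww η lam mu y (Sum.inr a)) * Wt (ww η lam mu) I K := by
      unfold Wt; rw [← Finset.prod_mul_distrib]
      exact Finset.prod_congr rfl fun x _ => Finset.prod_insert haK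
    have e5 : Wt (ww η lam mu) (insert (Sum.inr a) I) K
        = (∏ y ∈ K, ww η lam mu (Sum.inr a) y) * Wt (ww η lam mu) I K := by
      unfold Wt; rw [Finset.prod_insert haI]
    rw [e4, e5]; ring

lemma star_PF [Fintype ι] (η : ℂ) (lam : ι → ℂ) (mu : κ → ℂ)
    (hmu : Function.Injective mu) (hne : ∀ j b, mu b ≠ lam j)
    (f g cf cg : Finset (ι ⊕ κ) → ℂ) (φ γ : ι → Finset (ι ⊕ κ) → ℂ)
    (hf : ∀ S b, Sum.inr b ∉ S → f (insert (Sum.inr b) S) = cf S + ∑ j, φ j S / (mu b - lam j))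
    (hg : ∀ S b, Sum.inr b ∉ S → g (insert (Sum.inr b) S) = cg S + ∑ j, γ j S / (mu b - lam j))
    (S : Finset (ι ⊕ κ)) (b : κ) (hb : Sum.inr b ∉ S) :
    star (ww η lam mu) f g (insert (Sum.inr b) S) =
      star (ww η lam mu) cf g S + star (ww η lam mu) f cg S +
      ∑ j, (∑ I ∈ S.powerset, Wt (ww η lam mu) I (S \ I) *
        ((∏ a ∈ (S \ I).toRight, (1 - η / (lam j - mu a))) * φ j I * g (S \ I) +
         (∏ a ∈ I.toRight, (1 - (-η) / (lam j - mu a))) * f I * γ j (S \ I))) /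
           (mu b - lam j) := by
  rw [star_insert _ _ _ _ _ hb]
  have key : ∀ I ∈ S.powerset, Wt (ww η lam mu) I (S \ I) *
      ((∏ y ∈ S \ I, ww η lam mu (Sum.inr b) y) * f (insert (Sum.inr b) I) * g (S \ I) +
       (∏ y ∈ I, ww η lam mu y (Sum.inr b)) * f I * g (insert (Sum.inr b) (S \ I)))
     = Wt (ww η lam mu) I (S \ I) * cf I * g (S \ I) + Wt (ww η lam mu) I (S \ I) * f I * cg (S \ I)
       + ∑ j, (Wt (ww η lam mu) I (S \ I) *
        ((∏ a ∈ (S \ I).toRight, (1 - η / (lam j - mu a))) * φ j I * g (S \ I) +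
         (∏ a ∈ I.toRight, (1 - (-η) / (lam j - mu a))) * f I * γ j (S \ I))) /
           (mu b - lam j)
       - η * (Wt (ww η lam mu) I (S \ I) *
      (∑ a ∈ (S \ I).toRight, (∏ b ∈ (S \ I).toRight.erase a, (1 - η / (mu a - mu b))) *
        f (insert (Sum.inr a) I) * g (S \ I) * (1 / (mu b - mu a))))
       + η * (Wt (ww η lam mu) I (S \ I) *
      (∑ a ∈ I.toRight, (∏ b ∈ I.toRight.erase a, (1 - (-η) / (mu a - mu b))) *
        f I * g (insert (Sum.inr a) (S \ I)) * (1 / (mu b - mu a)))) := by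
    intro I hI
    have hIS := mem_powerset.1 hI
    have hbI : Sum.inr b ∉ I := fun h => hb (hIS h)
    have hbI' : Sum.inr b ∉ S \ I := fun h => hb (mem_sdiff.1 h).1
    have p1 := pf_full η lam mu (S \ I).toRight (fun a _ b _ h => hmu.ne h) (mu b) (cf I)
      (fun j => φ j I)
      (fun a ha => hmu.ne (by rintro rfl; exact hbI' (mem_toRight.1 ha)))
      (fun j a _ => (hne j a).symm) (fun j => hne j b)
    have p2 := pf_full (-η) lam mu I.toRight (fun a _ b _ h => hmu.ne h) (mu b) (cg (S \ I))
      (fun j => γ j (S \ I))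
      (fun a ha => hmu.ne (by rintro rfl; exact hbI (mem_toRight.1 ha)))
      (fun j a _ => (hne j a).symm) (fun j => hne j b)
    rw [← hf I b hbI] at p1
    rw [← hg (S \ I) b hbI'] at p2
    rw [prod_inr_left, prod_inr_right, p1, mul_right_comm, p2]
    have q1 : ∀ a ∈ (S \ I).toRight, (∏ b ∈ (S \ I).toRight.erase a, (1 - η / (mu a - mu b))) *
            (cf I + ∑ j, φ j I / (mu a - lam j)) / (mu b - mu a)
        = (∏ b ∈ (S \ I).toRight.erase a, (1 - η / (mu a - mu b))) *
            f (insert (Sum.inr a) I) * (1 / (mu b - mu a)) := by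
      intro a ha
      rw [hf I a (mem_sdiff.1 (mem_toRight.1 ha)).2]; ring
    have q2 : ∀ a ∈ I.toRight, (∏ b ∈ I.toRight.erase a, (1 - (-η) / (mu a - mu b))) *
            (cg (S \ I) + ∑ j, γ j (S \ I) / (mu a - lam j)) / (mu b - mu a)
        = (∏ b ∈ I.toRight.erase a, (1 - (-η) / (mu a - mu b))) *
            g (insert (Sum.inr a) (S \ I)) * (1 / (mu b - mu a)) := by
      intro a ha
      rw [hg (S \ I) a (fun h => (mem_sdiff.1 h).2 (mem_toRight.1 ha))]; ring
    rw [Finset.sum_congr rfl q1, Finset.sum_congr rfl q2]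
    have r1 : ∑ a ∈ (S \ I).toRight, (∏ b ∈ (S \ I).toRight.erase a, (1 - η / (mu a - mu b))) *
        f (insert (Sum.inr a) I) * g (S \ I) * (1 / (mu b - mu a))
       = (∑ a ∈ (S \ I).toRight, (∏ b ∈ (S \ I).toRight.erase a, (1 - η / (mu a - mu b))) *
        f (insert (Sum.inr a) I) * (1 / (mu b - mu a))) * g (S \ I) := by
      rw [Finset.sum_mul]; exact Finset.sum_congr rfl fun a _ => by ring
    have r2 : ∑ a ∈ I.toRight, (∏ b ∈ I.toRight.erase a, (1 - (-η) / (mu a - mu b))) *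
        f I * g (insert (Sum.inr a) (S \ I)) * (1 / (mu b - mu a))
       = (∑ a ∈ I.toRight, (∏ b ∈ I.toRight.erase a, (1 - (-η) / (mu a - mu b))) *
        g (insert (Sum.inr a) (S \ I)) * (1 / (mu b - mu a))) * f I := by
      rw [Finset.sum_mul]; exact Finset.sum_congr rfl fun a _ => by ring
    have r3 : ∑ j, (Wt (ww η lam mu) I (S \ I) *
        ((∏ a ∈ (S \ I).toRight, (1 - η / (lam j - mu a))) * φ j I * g (S \ I) +
         (∏ a ∈ I.toRight, (1 - (-η) / (lam j - mu a))) * f I * γ j (S \ I))) /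
           (mu b - lam j)
       = Wt (ww η lam mu) I (S \ I) *
        ((∑ j, (∏ a ∈ (S \ I).toRight, (1 - η / (lam j - mu a))) * φ j I / (mu b - lam j)) * g (S \ I) +
         (∑ j, (∏ a ∈ I.toRight, (1 - (-η) / (lam j - mu a))) * γ j (S \ I) / (mu b - lam j)) * f I) := by
      rw [Finset.sum_mul, Finset.sum_mul, ← Finset.sum_add_distrib, Finset.mul_sum]
      exact Finset.sum_congr rfl fun j _ => by ring
    rw [r1, r2, r3]
    ring
  rw [Finset.sum_congr rfl key]
  simp only [Finset.sum_add_distrib, Finset.sum_sub_distrib, ← Finset.mul_sum]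
  rw [pole_cancel, Finset.sum_comm]
  simp only [← Finset.sum_div]
  unfold star
  ring

end Model
end Bethe
end Part2

section Part3
open scoped BigOperators
open Finset

set_option linter.unusedSectionVars false

namespace Bethe

section Rec
variable {ι κ : Type*} [DecidableEq ι] [DecidableEq κ]

lemma sum_symm {ι : Type*} (s : Finset ι) (f g : ι → ι → ℂ)
    (h : ∀ j ∈ s, ∀ k ∈ s, f j k + f k j = g j k + g k j) :
    ∑ j ∈ s, ∑ k ∈ s, f j k = ∑ j ∈ s, ∑ k ∈ s, g j k := by
  have h1 : ∑ j ∈ s, ∑ k ∈ s, (f j k + f k j) = ∑ j ∈ s, ∑ k ∈ s, (g j k + g k j) :=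
    Finset.sum_congr rfl fun j hj => Finset.sum_congr rfl fun k hk => h j hj k hk
  simp only [Finset.sum_add_distrib] at h1
  rw [Finset.sum_comm (f := fun j k => f k j), Finset.sum_comm (f := fun j k => g k j)] at h1
  have h2 : (2:ℂ) * ∑ j ∈ s, ∑ k ∈ s, f j k = 2 * ∑ j ∈ s, ∑ k ∈ s, g j k := by
    rw [two_mul, two_mul]; exact h1
  exact mul_left_cancel₀ two_ne_zero h2

noncomputable def kap (η θ : ℂ) (lam : ι → ℂ) (j : ι) (A : Finset ι) (l : List ℂ) : ℂ :=
  η * (∏ k ∈ A, (1 + η / (lam j - lam k))) * (l.map fun m => 1 - η / (lam j - m)).prod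
  - θ * (η * (∏ k ∈ A, (1 - η / (lam j - lam k))) * (l.map fun m => 1 + η / (lam j - m)).prod)

noncomputable def Fl (η θ u v : ℂ) (lam : ι → ℂ) : List ℂ → Finset ι → ℂ
  | [], A => if A = ∅ then u else 0
  | b :: l, A => (if l = [] ∧ A = ∅ then v else 0) +
      ∑ j ∈ A, kap η θ lam j (A.erase j) l / (b - lam j) * Fl η θ u v lam l (A.erase j)

lemma kap_perm (η θ : ℂ) (lam : ι → ℂ) (j : ι) (A : Finset ι) {l l' : List ℂ} (h : l.Perm l') :
    kap η θ lam j A l = kap η θ lam j A l' := by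
  unfold kap
  rw [(h.map _).prod_eq, (h.map (fun m => 1 + η / (lam j - m))).prod_eq]

lemma Fl_swap (η θ u v : ℂ) (hv : v * (1 - θ) = 0) (lam : ι → ℂ) (hlam : Function.Injective lam)
    (b b' : ℂ) (l : List ℂ) (hb : ∀ j, b ≠ lam j) (hb' : ∀ j, b' ≠ lam j) (A : Finset ι) :
    Fl η θ u v lam (b :: b' :: l) A = Fl η θ u v lam (b' :: b :: l) A := by
  simp only [Fl, mul_add, Finset.sum_add_distrib]
  congr 1
  congr 1
  · refine Finset.sum_congr rfl fun j hj => ?_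
    by_cases h : l = [] ∧ A.erase j = ∅
    · rw [if_pos h, h.1, h.2]
      simp only [kap, Finset.prod_empty, List.map_cons, List.map_nil, List.prod_cons, List.prod_nil]
      have h1 : b - lam j ≠ 0 := sub_ne_zero.2 (hb j)
      have h2 : b' - lam j ≠ 0 := sub_ne_zero.2 (hb' j)
      rw [show lam j - b = -(b - lam j) by ring, show lam j - b' = -(b' - lam j) by ring]
      have e : v * θ = v := by linear_combination -hv
      have e2 : ∀ x y : ℂ, (x - θ * y) * v = (x - y) * v := by
        intro x y; linear_combination (-y) * e
      rw [div_mul_eq_mul_div, div_mul_eq_mul_div, e2, e2]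
      field_simp
      ring
    · rw [if_neg h]; simp
  · have key : ∀ b b' : ℂ, ∑ j ∈ A, kap η θ lam j (A.erase j) (b' :: l) / (b - lam j) *
        ∑ k ∈ A.erase j, kap η θ lam k ((A.erase j).erase k) l / (b' - lam k) *
          Fl η θ u v lam l ((A.erase j).erase k)
        = ∑ j ∈ A, ∑ k ∈ A, if k = j then 0 else
          kap η θ lam j (A.erase j) (b' :: l) / (b - lam j) *
           (kap η θ lam k ((A.erase j).erase k) l / (b' - lam k) *
          Fl η θ u v lam l ((A.erase j).erase k)) := by
      intro b b'
      refine Finset.sum_congr rfl fun j hj => ?_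
      rw [Finset.mul_sum, ← Finset.add_sum_erase A _ hj, if_pos rfl, zero_add]
      exact Finset.sum_congr rfl fun k hk => by rw [if_neg (ne_of_mem_erase hk)]
    rw [key, key]
    apply sum_symm
    intro j hj k hk
    by_cases hjk : k = j
    · simp [hjk]
    rw [if_neg hjk, if_neg (Ne.symm hjk), if_neg hjk, if_neg (Ne.symm hjk)]
    rw [Finset.erase_right_comm (a := k) (b := j)]
    have e1 : A.erase j = insert k ((A.erase j).erase k) :=
      (Finset.insert_erase (mem_erase.2 ⟨hjk, hk⟩)).symm
    have e2 : A.erase k = insert j ((A.erase j).erase k) := by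
      rw [Finset.erase_right_comm]
      exact (Finset.insert_erase (mem_erase.2 ⟨Ne.symm hjk, hj⟩)).symm
    have n1 : k ∉ (A.erase j).erase k := by simp
    have n2 : j ∉ (A.erase j).erase k := by simp
    generalize (A.erase j).erase k = C at *
    rw [e1, e2]
    simp only [kap, Finset.prod_insert n1, Finset.prod_insert n2, List.map_cons, List.prod_cons]
    have d : lam j - lam k ≠ 0 := sub_ne_zero.2 (hlam.ne (Ne.symm hjk))
    have h1 : b - lam j ≠ 0 := sub_ne_zero.2 (hb j)
    have h2 : b' - lam j ≠ 0 := sub_ne_zero.2 (hb' j)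
    have h3 : b - lam k ≠ 0 := sub_ne_zero.2 (hb k)
    have h4 : b' - lam k ≠ 0 := sub_ne_zero.2 (hb' k)
    rw [show lam j - b = -(b - lam j) by ring, show lam j - b' = -(b' - lam j) by ring,
      show lam k - b = -(b - lam k) by ring, show lam k - b' = -(b' - lam k) by ring,
      show lam k - lam j = -(lam j - lam k) by ring]
    generalize Fl η θ u v lam l C = Q
    generalize (∏ k ∈ C, (1 + η / (lam j - lam k))) = X1
    generalize (∏ k ∈ C, (1 - η / (lam j - lam k))) = X2
    generalize (∏ x ∈ C, (1 + η / (lam k - lam x))) = X3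
    generalize (∏ x ∈ C, (1 - η / (lam k - lam x))) = X4
    generalize (l.map fun m => 1 - η / (lam j - m)).prod = Y1
    generalize (l.map fun m => 1 + η / (lam j - m)).prod = Y2
    generalize (l.map fun m => 1 - η / (lam k - m)).prod = Y3
    generalize (l.map fun m => 1 + η / (lam k - m)).prod = Y4
    field_simp
    ring

lemma Fl_perm (η θ u v : ℂ) (hv : v * (1 - θ) = 0) (lam : ι → ℂ) (hlam : Function.Injective lam)
    {l l' : List ℂ} (h : l.Perm l') (hl : ∀ m ∈ l, ∀ j, m ≠ lam j) (A : Finset ι) :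
    Fl η θ u v lam l A = Fl η θ u v lam l' A := by
  induction h generalizing A with
  | nil => rfl
  | @cons x l₁ l₂ h ih =>
    simp only [Fl]
    have e : (l₁ = []) = (l₂ = []) := propext ⟨fun e => by subst e; exact h.nil_eq.symm,
      fun e => by subst e; exact h.eq_nil⟩
    simp only [e]
    congr 1
    refine Finset.sum_congr rfl fun j _ => ?_
    rw [kap_perm η θ lam j _ h, ih fun m hm => hl m (List.mem_cons_of_mem _ hm)]
  | swap x y l =>
    exact Fl_swap η θ u v hv lam hlam _ _ _ (hl _ (by simp)) (hl _ (by simp)) A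
  | trans h1 h2 ih1 ih2 =>
    rw [ih1 hl, ih2 fun m hm => hl m (h1.mem_iff.2 hm)]

noncomputable def FF (η θ u v : ℂ) (lam : ι → ℂ) (mu : κ → ℂ) (S : Finset (ι ⊕ κ)) : ℂ :=
  Fl η θ u v lam (S.toRight.toList.map mu) S.toLeft

noncomputable def pp (η : ℂ) (lam : ι → ℂ) (mu : κ → ℂ) (j : ι) : ι ⊕ κ → ℂ
  | Sum.inl k => 1 + η / (lam j - lam k)
  | Sum.inr a => 1 - η / (lam j - mu a)

noncomputable def rho (η : ℂ) (lam : ι → ℂ) (mu : κ → ℂ) (j : ι) (T : Finset (ι ⊕ κ)) : ℂ :=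
  ∏ y ∈ T, pp η lam mu j y

lemma rho_eq (η : ℂ) (lam : ι → ℂ) (mu : κ → ℂ) (j : ι) (T : Finset (ι ⊕ κ)) :
    rho η lam mu j T = (∏ k ∈ T.toLeft, (1 + η / (lam j - lam k))) *
      ∏ a ∈ T.toRight, (1 - η / (lam j - mu a)) := by
  unfold rho
  conv_lhs => rw [← Finset.toLeft_disjSum_toRight (u := T)]
  rw [Finset.prod_disjSum]; simp [pp]

lemma rho_neg_eq (η : ℂ) (lam : ι → ℂ) (mu : κ → ℂ) (j : ι) (T : Finset (ι ⊕ κ)) :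
    rho (-η) lam mu j T = (∏ k ∈ T.toLeft, (1 - η / (lam j - lam k))) *
      ∏ a ∈ T.toRight, (1 + η / (lam j - mu a)) := by
  rw [rho_eq]; simp only [neg_div, sub_neg_eq_add, ← sub_eq_add_neg]

/-- recursion in the right elements -/
def IsRec [Fintype ι] (lam : ι → ℂ) (mu : κ → ℂ) (f cf : Finset (ι ⊕ κ) → ℂ)
    (K : ι → Finset (ι ⊕ κ) → ℂ) : Prop :=
  ∀ S b, Sum.inr b ∉ S → f (insert (Sum.inr b) S) = cf S + ∑ j,
    (if Sum.inl j ∈ S then K j (S.erase (Sum.inl j)) * f (S.erase (Sum.inl j)) else 0) / (mu b - lam j)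

lemma FF_rec [Fintype ι] (η θ u v : ℂ) (hv : v * (1 - θ) = 0) (lam : ι → ℂ)
    (hlam : Function.Injective lam) (mu : κ → ℂ) (hne : ∀ j b, mu b ≠ lam j) :
    IsRec lam mu (FF η θ u v lam mu) (fun S => if S = ∅ then v else 0)
      (fun j T => η * rho η lam mu j T - θ * (η * rho (-η) lam mu j T)) := by
  intro S b hb
  have hb' : b ∉ S.toRight := by simpa using hb
  have hp : ((insert (Sum.inr b) S).toRight.toList.map mu).Perm (mu b :: S.toRight.toList.map mu) := by
    rw [Finset.toRight_insert_inr, ← List.map_cons]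
    exact (Finset.toList_insert hb').map _
  unfold FF
  rw [Fl_perm η θ u v hv lam hlam hp (by
    intro m hm j
    simp only [List.mem_map] at hm
    obtain ⟨a, _, rfl⟩ := hm
    exact hne j a)]
  rw [Finset.toLeft_insert_inr]
  simp only [Fl]
  congr 1
  · have : (S.toRight.toList.map mu = [] ∧ S.toLeft = ∅) ↔ S = ∅ := by
      rw [List.map_eq_nil_iff, Finset.toList_eq_nil]
      constructor
      · rintro ⟨h1, h2⟩
        rw [← Finset.toLeft_disjSum_toRight (u := S), h1, h2]; rfl
      · rintro rfl; exact ⟨rfl, rfl⟩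
    simp only [this]
  · have : S.toLeft = Finset.univ.filter (fun j => Sum.inl j ∈ S) := by ext; simp
    conv_lhs => rw [this]
    rw [Finset.sum_filter]
    refine Finset.sum_congr rfl fun j _ => ?_
    by_cases hj : Sum.inl j ∈ S
    · rw [if_pos hj, if_pos hj]
      have e1 : (S.erase (Sum.inl j)).toLeft = S.toLeft.erase j := by ext; simp
      have e2 : (S.erase (Sum.inl j)).toRight = S.toRight := by ext; simp
      rw [rho_eq, rho_neg_eq, e1, e2, ← this]
      simp only [kap, List.map_map, Function.comp_def]
      rw [Finset.prod_map_toList, Finset.prod_map_toList]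
      ring
    · rw [if_neg hj, if_neg hj, zero_div]

lemma FF_noright (η θ u v : ℂ) (lam : ι → ℂ) (mu : κ → ℂ) (S : Finset (ι ⊕ κ))
    (h : S.toRight = ∅) : FF η θ u v lam mu S = if S.toLeft = ∅ then u else 0 := by
  unfold FF; rw [h]; simp [Fl]

lemma rec_unique [Fintype ι] (lam : ι → ℂ) (mu : κ → ℂ) (f g c : Finset (ι ⊕ κ) → ℂ)
    (K : ι → Finset (ι ⊕ κ) → ℂ) (hf : IsRec lam mu f c K) (hg : IsRec lam mu g c K)
    (h0 : ∀ S, S.toRight = ∅ → f S = g S) : f = g := by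
  funext S
  induction h : S.card using Nat.strong_induction_on generalizing S with
  | _ n ih =>
  subst h
  by_cases hS : S.toRight = ∅
  · exact h0 S hS
  obtain ⟨b, hb⟩ := Finset.nonempty_iff_ne_empty.2 hS
  rw [mem_toRight] at hb
  have e := Finset.insert_erase hb
  have hc := Finset.card_erase_of_mem hb
  have hpos : 0 < S.card := Finset.card_pos.2 ⟨_, hb⟩
  rw [← e, hf _ b (by simp), hg _ b (by simp)]
  congr 1
  refine Finset.sum_congr rfl fun j _ => ?_
  by_cases hj : Sum.inl j ∈ S.erase (Sum.inr b)
  · rw [if_pos hj, if_pos hj, ih _ ?_ _ rfl]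
    have := Finset.card_erase_lt_of_mem hj
    omega
  · rw [if_neg hj, if_neg hj]

lemma star_rec [Fintype ι] (η : ℂ) (lam : ι → ℂ) (mu : κ → ℂ)
    (hmu : Function.Injective mu) (hne : ∀ j b, mu b ≠ lam j)
    (f g cf cg : Finset (ι ⊕ κ) → ℂ) (Kf Kg K : ι → Finset (ι ⊕ κ) → ℂ)
    (hf : IsRec lam mu f cf Kf) (hg : IsRec lam mu g cg Kg)
    (hK : ∀ j S I, I ⊆ S → rho η lam mu j (S \ I) * Kf j I + rho (-η) lam mu j I * Kg j (S \ I)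
      = K j S) :
    IsRec lam mu (star (ww η lam mu) f g)
      (star (ww η lam mu) cf g + star (ww η lam mu) f cg) K := by
  intro S b hb
  rw [star_PF η lam mu hmu hne f g cf cg _ _ hf hg S b hb]
  congr 1
  refine Finset.sum_congr rfl fun j _ => ?_
  congr 1
  by_cases hj : Sum.inl j ∈ S
  swap
  · rw [if_neg hj]
    refine Finset.sum_eq_zero fun I hI => ?_
    have h1 : Sum.inl j ∉ I := fun h => hj (mem_powerset.1 hI h)
    have h2 : Sum.inl j ∉ S \ I := fun h => hj (mem_sdiff.1 h).1
    rw [if_neg h1, if_neg h2]; ring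
  rw [if_pos hj]
  obtain ⟨T, hT, rfl⟩ : ∃ T, Sum.inl j ∉ T ∧ S = insert (Sum.inl j) T :=
    ⟨S.erase (Sum.inl j), by simp, (Finset.insert_erase hj).symm⟩
  rw [Finset.erase_insert hT, Finset.sum_powerset_insert hT, ← Finset.sum_add_distrib]
  unfold star
  rw [Finset.mul_sum]
  refine Finset.sum_congr rfl fun I hI => ?_
  have hIT := mem_powerset.1 hI
  have hjI : Sum.inl j ∉ I := fun h => hT (hIT h)
  have hjI2 : Sum.inl j ∉ T \ I := fun h => hT (mem_sdiff.1 h).1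
  have e1 : insert (Sum.inl j) T \ I = insert (Sum.inl j) (T \ I) :=
    Finset.insert_sdiff_of_notMem _ hjI
  have e2 : insert (Sum.inl j) T \ insert (Sum.inl j) I = T \ I := by
    rw [Finset.insert_sdiff_insert, Finset.sdiff_insert_of_notMem hT]
  rw [e1, e2, if_neg hjI, if_pos (mem_insert_self _ _), if_pos (mem_insert_self _ _), if_neg hjI2,
    Finset.erase_insert hjI, Finset.erase_insert hjI2]
  have e3 : Wt (ww η lam mu) (insert (Sum.inl j) I) (T \ I)
      = (∏ y ∈ T \ I, ww η lam mu (Sum.inl j) y) * Wt (ww η lam mu) I (T \ I) := by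
    unfold Wt; rw [Finset.prod_insert hjI]
  have e4 : Wt (ww η lam mu) I (insert (Sum.inl j) (T \ I))
      = (∏ y ∈ I, ww η lam mu y (Sum.inl j)) * Wt (ww η lam mu) I (T \ I) := by
    unfold Wt; rw [← Finset.prod_mul_distrib]
    exact Finset.prod_congr rfl fun x _ => Finset.prod_insert hjI2
  have e5 : ∏ a ∈ I.toRight, (1 - (-η) / (lam j - mu a)) = ∏ a ∈ I.toRight, (1 + η / (lam j - mu a)) :=
    Finset.prod_congr rfl fun a _ => by ring
  have e6 := hK j T I hIT
  rw [rho_eq, rho_neg_eq] at e6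
  rw [e3, e4, prod_inl_left, prod_inl_right, e5, ← e6]
  ring

end Rec
end Bethe
end Part3

section Part4
open scoped BigOperators
open Finset

set_option linter.unusedSectionVars false

namespace Bethe

section Alg
variable {ι κ : Type*} [DecidableEq ι] [DecidableEq κ]

/-- indicator of subsets with m left and n right elements -/
def ind (m n : ℕ) (S : Finset (ι ⊕ κ)) : ℂ :=
  if S.toLeft.card = m ∧ S.toRight.card = n then 1 else 0

lemma empty_iff (S : Finset (ι ⊕ κ)) : S = ∅ ↔ S.toLeft = ∅ ∧ S.toRight = ∅ := by
  constructor
  · rintro rfl; exact ⟨rfl, rfl⟩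
  · rintro ⟨h1, h2⟩
    rw [← Finset.toLeft_disjSum_toRight (u := S), h1, h2]; rfl

lemma ind_zero_zero : (ind 0 0 : Finset (ι ⊕ κ) → ℂ) = eps := by
  funext S
  simp only [ind, eps, Finset.card_eq_zero, empty_iff]

lemma ind_insert_succ (m n : ℕ) (S : Finset (ι ⊕ κ)) (b : κ) (hb : Sum.inr b ∉ S) :
    ind m (n + 1) (insert (Sum.inr b) S) = ind m n S := by
  unfold ind
  rw [Finset.toLeft_insert_inr, Finset.toRight_insert_inr,
    Finset.card_insert_of_notMem (by simpa using hb)]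
  simp

lemma ind_insert_zero (m : ℕ) (S : Finset (ι ⊕ κ)) (b : κ) (hb : Sum.inr b ∉ S) :
    ind m 0 (insert (Sum.inr b) S) = 0 := by
  unfold ind
  rw [Finset.toRight_insert_inr, Finset.card_insert_of_notMem (by simpa using hb)]
  simp

variable [Fintype ι]

lemma ind_rec_succ (lam : ι → ℂ) (mu : κ → ℂ) (m n : ℕ) :
    IsRec lam mu (ind m (n + 1)) (ind m n) 0 := by
  intro S b hb
  rw [ind_insert_succ _ _ _ _ hb]; simp

lemma ind_rec_zero (lam : ι → ℂ) (mu : κ → ℂ) (m : ℕ) :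
    IsRec lam mu (ind m 0) 0 0 := by
  intro S b hb
  rw [ind_insert_zero _ _ _ hb]; simp

noncomputable def ZZ (η : ℂ) (lam : ι → ℂ) (mu : κ → ℂ) : Finset (ι ⊕ κ) → ℂ := FF η 0 1 0 lam mu
noncomputable def DD (η : ℂ) (lam : ι → ℂ) (mu : κ → ℂ) : Finset (ι ⊕ κ) → ℂ := FF η 1 0 1 lam mu

lemma ZZ_rec (η : ℂ) (lam : ι → ℂ)
    (hlam : Function.Injective lam) (mu : κ → ℂ) (hne : ∀ j b, mu b ≠ lam j) :
    IsRec lam mu (ZZ η lam mu) 0 (fun j T => η * rho η lam mu j T) := by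
  have := FF_rec η 0 1 0 (by simp) lam hlam mu hne
  intro S b hb
  have h := this S b hb
  simp only [zero_mul, sub_zero, ite_self] at h
  exact h

lemma DD_rec (η : ℂ) (lam : ι → ℂ)
    (hlam : Function.Injective lam) (mu : κ → ℂ) (hne : ∀ j b, mu b ≠ lam j) :
    IsRec lam mu (DD η lam mu) eps (fun j T => η * rho η lam mu j T - η * rho (-η) lam mu j T) := by
  have := FF_rec η 1 0 1 (by simp) lam hlam mu hne
  intro S b hb
  have h := this S b hb
  simp only [one_mul] at h
  exact h

lemma ZZ_noright (η : ℂ) (lam : ι → ℂ) (mu : κ → ℂ) (S : Finset (ι ⊕ κ))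
    (h : S.toRight = ∅) : ZZ η lam mu S = eps S := by
  unfold ZZ; rw [FF_noright _ _ _ _ _ _ _ h]
  simp only [eps, empty_iff, h, and_true]

lemma DD_noright (η : ℂ) (lam : ι → ℂ) (mu : κ → ℂ) (S : Finset (ι ⊕ κ))
    (h : S.toRight = ∅) : DD η lam mu S = 0 := by
  unfold DD; rw [FF_noright _ _ _ _ _ _ _ h]; simp

lemma sub_noright {S I : Finset (ι ⊕ κ)} (h : S.toRight = ∅) (hI : I ⊆ S) : I.toRight = ∅ := by
  rw [Finset.eq_empty_iff_forall_notMem] at h ⊢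
  intro a ha; exact h a (mem_toRight.2 (hI (mem_toRight.1 ha)))

lemma star_ZZ_noright (η : ℂ) (w) (lam : ι → ℂ) (mu : κ → ℂ) (g : Finset (ι ⊕ κ) → ℂ)
    (S : Finset (ι ⊕ κ)) (h : S.toRight = ∅) : star w (ZZ η lam mu) g S = g S := by
  conv_rhs => rw [← eps_star w g]
  unfold star
  refine Finset.sum_congr rfl fun I hI => ?_
  rw [ZZ_noright _ _ _ _ (sub_noright h (mem_powerset.1 hI))]

lemma star_DD_noright (η : ℂ) (w) (lam : ι → ℂ) (mu : κ → ℂ) (g : Finset (ι ⊕ κ) → ℂ)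
    (S : Finset (ι ⊕ κ)) (h : S.toRight = ∅) : star w (DD η lam mu) g S = 0 := by
  unfold star
  refine Finset.sum_eq_zero fun I hI => ?_
  rw [DD_noright _ _ _ _ (sub_noright h (mem_powerset.1 hI))]; ring

lemma rho_sdiff (η : ℂ) (lam : ι → ℂ) (mu : κ → ℂ) (j : ι) {S I : Finset (ι ⊕ κ)} (h : I ⊆ S) :
    rho η lam mu j (S \ I) * rho η lam mu j I = rho η lam mu j S :=
  Finset.prod_sdiff h

section
variable (η : ℂ) (lam : ι → ℂ) (hlam : Function.Injective lam) (mu : κ → ℂ)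
    (hmu : Function.Injective mu) (hne : ∀ j b, mu b ≠ lam j)
include hlam hmu hne

lemma star_ZZ_rec (g cg : Finset (ι ⊕ κ) → ℂ) (hg : IsRec lam mu g cg 0) :
    IsRec lam mu (star (ww η lam mu) (ZZ η lam mu) g) (star (ww η lam mu) (ZZ η lam mu) cg)
      (fun j T => η * rho η lam mu j T) := by
  have := star_rec η lam mu hmu hne _ _ _ _ _ _ (fun j T => η * rho η lam mu j T)
    (ZZ_rec η lam hlam mu hne) hg (by
      intro j S I h
      rw [← rho_sdiff η lam mu j h]; simp; ring)
  rw [star_zero_left, zero_add] at this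
  exact this

theorem DD_ZZ : star (ww η lam mu) (DD η lam mu) (ZZ η lam mu)
    = star (ww η lam mu) (ZZ η lam mu) (ind 0 1) := by
  refine rec_unique lam mu _ _ (ZZ η lam mu) (fun j T => η * rho η lam mu j T) ?_ ?_ ?_
  · have := star_rec η lam mu hmu hne _ _ _ _ _ _ (fun j T => η * rho η lam mu j T)
      (DD_rec η lam hlam mu hne) (ZZ_rec η lam hlam mu hne) (by
        intro j S I h
        have h1 := rho_sdiff η lam mu j h
        rw [← h1]; ring)
    rw [star_zero_right, add_zero, eps_star] at this
    exact this
  · have := star_ZZ_rec η lam hlam mu hmu hne (ind 0 1) (ind 0 0) (ind_rec_succ lam mu 0 0)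
    rw [ind_zero_zero, star_eps] at this
    exact this
  · intro S h
    rw [star_DD_noright _ _ _ _ _ _ h, star_ZZ_noright _ _ _ _ _ _ h]
    simp [ind, h]

theorem lemB (S : Finset (ι ⊕ κ)) :
    star (ww η lam mu) (ZZ η lam mu) (fun S => η * ind 1 0 S) S
      = ∑ j, if Sum.inl j ∈ S then η * rho η lam mu j (S.erase (Sum.inl j)) *
          ZZ η lam mu (S.erase (Sum.inl j)) else 0 := by
  refine congrFun (a := S) (rec_unique lam mu _ (fun S => ∑ j, if Sum.inl j ∈ S then
    η * rho η lam mu j (S.erase (Sum.inl j)) *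
          ZZ η lam mu (S.erase (Sum.inl j)) else 0) 0 (fun j T => η * rho η lam mu j T) ?_ ?_ ?_)
  · have := star_ZZ_rec η lam hlam mu hmu hne (fun S => η * ind 1 0 S) 0 (by
      intro S b hb
      beta_reduce
      rw [ind_insert_zero _ _ _ hb]; simp)
    rw [star_zero_right] at this
    exact this
  · intro S b hb
    beta_reduce
    rw [Pi.zero_apply, zero_add]
    have hL : ∀ j, (if Sum.inl j ∈ insert (Sum.inr b) S then
        η * rho η lam mu j ((insert (Sum.inr b) S).erase (Sum.inl j)) *
          ZZ η lam mu ((insert (Sum.inr b) S).erase (Sum.inl j)) else 0)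
        = ∑ k, if Sum.inl j ∈ S ∧ Sum.inl k ∈ S ∧ j ≠ k then
            η * rho η lam mu j (S.erase (Sum.inl j)) * (1 - η / (lam j - mu b)) *
             (η * rho η lam mu k ((S.erase (Sum.inl j)).erase (Sum.inl k)) *
              ZZ η lam mu ((S.erase (Sum.inl j)).erase (Sum.inl k)) / (mu b - lam k)) else 0 := by
      intro j
      by_cases hj : Sum.inl j ∈ S
      swap
      · simp [hj]
      rw [if_pos (mem_insert_of_mem hj), Finset.erase_insert_of_ne (by simp),
        ZZ_rec η lam hlam mu hne _ _ (by simp [hb]), Pi.zero_apply, zero_add, Finset.mul_sum]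
      refine Finset.sum_congr rfl fun k _ => ?_
      by_cases hk : Sum.inl k ∈ S.erase (Sum.inl j)
      · have hk' := mem_erase.1 hk
        rw [if_pos hk, if_pos ⟨hj, hk'.2, fun h => hk'.1 (by rw [h])⟩]
        unfold rho
        rw [Finset.prod_insert (by simp [hb])]
        simp only [pp]
        ring
      · rw [if_neg hk, if_neg]
        · ring
        · rintro ⟨_, h2, h3⟩
          exact hk (mem_erase.2 ⟨by simpa using Ne.symm h3, h2⟩)
    have hR : ∀ k, (if Sum.inl k ∈ S then
        η * rho η lam mu k (S.erase (Sum.inl k)) *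
          (∑ j, if Sum.inl j ∈ S.erase (Sum.inl k) then
            η * rho η lam mu j ((S.erase (Sum.inl k)).erase (Sum.inl j)) *
              ZZ η lam mu ((S.erase (Sum.inl k)).erase (Sum.inl j)) else 0) else 0) / (mu b - lam k)
        = ∑ j, if Sum.inl j ∈ S ∧ Sum.inl k ∈ S ∧ j ≠ k then
            η * rho η lam mu k (S.erase (Sum.inl k)) *
             (η * rho η lam mu j ((S.erase (Sum.inl k)).erase (Sum.inl j)) *
              ZZ η lam mu ((S.erase (Sum.inl k)).erase (Sum.inl j)) / (mu b - lam k)) else 0 := by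
      intro k
      by_cases hk : Sum.inl k ∈ S
      swap
      · simp [hk]
      rw [if_pos hk, Finset.mul_sum, Finset.sum_div]
      refine Finset.sum_congr rfl fun j _ => ?_
      by_cases hj : Sum.inl j ∈ S.erase (Sum.inl k)
      · have hj' := mem_erase.1 hj
        rw [if_pos hj, if_pos ⟨hj'.2, hk, fun h => hj'.1 (by rw [h])⟩]
        ring
      · rw [if_neg hj, if_neg]
        · ring
        · rintro ⟨h1, _, h3⟩
          exact hj (mem_erase.2 ⟨by simpa using h3, h1⟩)
    rw [Finset.sum_congr rfl fun j _ => hL j, Finset.sum_congr rfl fun k _ => hR k,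
      Finset.sum_comm (f := fun k j => if Sum.inl j ∈ S ∧ Sum.inl k ∈ S ∧ j ≠ k then _ else _)]
    apply sum_symm
    intro j _ k _
    by_cases h : Sum.inl j ∈ S ∧ Sum.inl k ∈ S ∧ j ≠ k
    swap
    · have h' : ¬ (Sum.inl k ∈ S ∧ Sum.inl j ∈ S ∧ k ≠ j) := fun h' => h ⟨h'.2.1, h'.1, h'.2.2.symm⟩
      rw [if_neg h, if_neg h', if_neg h, if_neg h']
    have h' : (Sum.inl k ∈ S ∧ Sum.inl j ∈ S ∧ k ≠ j) := ⟨h.2.1, h.1, h.2.2.symm⟩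
    rw [if_pos h, if_pos h', if_pos h, if_pos h', Finset.erase_right_comm (a := Sum.inl k)]
    obtain ⟨hj, hk, hjk⟩ := h
    have e1 : S.erase (Sum.inl j) = insert (Sum.inl k) ((S.erase (Sum.inl j)).erase (Sum.inl k)) :=
      (Finset.insert_erase (mem_erase.2 ⟨by simpa using Ne.symm hjk, hk⟩)).symm
    have e2 : S.erase (Sum.inl k) = insert (Sum.inl j) ((S.erase (Sum.inl j)).erase (Sum.inl k)) := by
      rw [Finset.erase_right_comm]
      exact (Finset.insert_erase (mem_erase.2 ⟨by simpa using hjk, hj⟩)).symm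
    have n1 : Sum.inl k ∉ (S.erase (Sum.inl j)).erase (Sum.inl k) := by simp
    have n2 : Sum.inl j ∉ (S.erase (Sum.inl j)).erase (Sum.inl k) := by simp
    generalize (S.erase (Sum.inl j)).erase (Sum.inl k) = C at *
    have r1 : rho η lam mu j (insert (Sum.inl k) C) = (1 + η / (lam j - lam k)) * rho η lam mu j C :=
      Finset.prod_insert n1
    have r2 : rho η lam mu k (insert (Sum.inl j) C) = (1 + η / (lam k - lam j)) * rho η lam mu k C :=
      Finset.prod_insert n2
    rw [e1, e2, r1, r2]
    have d : lam j - lam k ≠ 0 := sub_ne_zero.2 (hlam.ne hjk)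
    have h1 : mu b - lam j ≠ 0 := sub_ne_zero.2 (hne j b)
    have h2 : mu b - lam k ≠ 0 := sub_ne_zero.2 (hne k b)
    rw [show lam j - mu b = -(mu b - lam j) by ring, show lam k - mu b = -(mu b - lam k) by ring,
      show lam k - lam j = -(lam j - lam k) by ring]
    field_simp
    ring
  · intro S h
    rw [star_ZZ_noright _ _ _ _ _ _ h]
    have hz : ∀ j, ZZ η lam mu (S.erase (Sum.inl j)) = eps (S.erase (Sum.inl j)) := fun j =>
      ZZ_noright _ _ _ _ (sub_noright h (Finset.erase_subset _ _))
    simp only [hz]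
    by_cases h1 : S.toLeft.card = 1
    · obtain ⟨i, hi⟩ := Finset.card_eq_one.1 h1
      have hS : S = {Sum.inl i} := by
        rw [← Finset.toLeft_disjSum_toRight (u := S), h, hi]; rfl
      rw [Finset.sum_eq_single i]
      · have hi2 : ind 1 0 S = 1 := by simp [ind, h, h1]
        rw [hi2]; simp [hS, eps, rho]
      · intro j _ hj; rw [if_neg]; simpa [hS] using hj
      · simp
    · rw [Finset.sum_eq_zero]
      · simp [ind, h1]
      · intro j _
        split_ifs with hj
        · have : S.erase (Sum.inl j) ≠ ∅ := by
            intro he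
            have : S = {Sum.inl j} := by
              rw [← Finset.insert_erase hj, he]; rfl
            apply h1; rw [this]; rfl
          simp [eps, this]
        · rfl

/-- total momentum -/
noncomputable def mom (lam : ι → ℂ) (mu : κ → ℂ) (S : Finset (ι ⊕ κ)) : ℂ :=
  ∑ x ∈ S, Sum.elim (fun j => Complex.I * lam j) (fun b => -(Complex.I * mu b)) x

theorem mom_ZZ :
    star (ww η lam mu) (ZZ η lam mu) (fun S => (-Complex.I * η) * ind 1 1 S)
      = fun S => mom lam mu S * ZZ η lam mu S := by
  refine rec_unique lam mu _ _ (star (ww η lam mu) (ZZ η lam mu)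
    (fun S => (-Complex.I * η) * ind 1 0 S)) (fun j T => η * rho η lam mu j T) ?_ ?_ ?_
  · exact star_ZZ_rec η lam hlam mu hmu hne _ _ (by
      intro S b hb
      beta_reduce
      rw [ind_insert_succ _ _ _ _ hb]; simp)
  · intro S b hb
    have hB := lemB η lam hlam mu hmu hne S
    have e : star (ww η lam mu) (ZZ η lam mu) (fun S => -Complex.I * η * ind 1 0 S) S
        = -Complex.I * star (ww η lam mu) (ZZ η lam mu) (fun S => η * ind 1 0 S) S := by
      unfold star; rw [Finset.mul_sum]; exact Finset.sum_congr rfl fun _ _ => by ring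
    beta_reduce
    rw [e, hB, ZZ_rec η lam hlam mu hne _ _ hb, Pi.zero_apply, zero_add, Finset.mul_sum,
      Finset.mul_sum, ← Finset.sum_add_distrib]
    refine Finset.sum_congr rfl fun j _ => ?_
    split_ifs with hj
    · have m1 : mom lam mu (insert (Sum.inr b) S) = -(Complex.I * mu b) + mom lam mu S := by
        unfold mom; rw [Finset.sum_insert hb]; rfl
      have m2 : mom lam mu S = Complex.I * lam j + mom lam mu (S.erase (Sum.inl j)) := by
        unfold mom; rw [← Finset.add_sum_erase _ _ hj]; rfl
      rw [m1, m2]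
      have h1 : mu b - lam j ≠ 0 := sub_ne_zero.2 (hne j b)
      field_simp
      ring
    · simp
  · intro S h
    rw [star_ZZ_noright _ _ _ _ _ _ h, ZZ_noright _ _ _ _ h]
    by_cases hS : S = ∅
    · subst hS; have hi2 : ind 1 1 (∅ : Finset (ι ⊕ κ)) = 0 := by simp [ind, h]
      rw [hi2]; simp [mom]
    · simp [ind, eps, hS, h]

end
end Alg
end Bethe
end Part4

section Part5
open scoped BigOperators
open Finset

set_option linter.unusedSectionVars false

namespace Bethe

section Evo
variable {ι κ : Type*} [DecidableEq ι] [DecidableEq κ] [Fintype ι] [Fintype κ]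

/-- dressing by plane waves -/
noncomputable def gg (lam : ι → ℂ) (mu : κ → ℂ) (T : ℝ) (f : Finset (ι ⊕ κ) → ℂ)
    (S : Finset (ι ⊕ κ)) : ℂ := Complex.exp (T * mom lam mu S) * f S

lemma mom_sdiff (lam : ι → ℂ) (mu : κ → ℂ) {S I : Finset (ι ⊕ κ)} (h : I ⊆ S) :
    mom lam mu S = mom lam mu I + mom lam mu (S \ I) := by
  unfold mom; rw [add_comm]; exact (Finset.sum_sdiff h).symm

lemma gg_star (w) (lam : ι → ℂ) (mu : κ → ℂ) (T : ℝ) (f g : Finset (ι ⊕ κ) → ℂ) :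
    gg lam mu T (star w f g) = star w (gg lam mu T f) (gg lam mu T g) := by
  funext S
  unfold gg star
  rw [Finset.mul_sum]
  refine Finset.sum_congr rfl fun I hI => ?_
  rw [mom_sdiff lam mu (mem_powerset.1 hI), mul_add, Complex.exp_add]; ring

lemma ZZ_empty (η : ℂ) (lam : ι → ℂ) (mu : κ → ℂ) : ZZ η lam mu ∅ = 1 := by
  rw [ZZ_noright _ _ _ _ rfl]; simp [eps]

noncomputable def Zinv (η : ℂ) (lam : ι → ℂ) (mu : κ → ℂ) : Finset (ι ⊕ κ) → ℂ :=
  Classical.choose (exists_inv (ww η lam mu) (ZZ η lam mu) (ZZ_empty η lam mu))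

lemma ZZ_Zinv (η : ℂ) (lam : ι → ℂ) (mu : κ → ℂ) :
    star (ww η lam mu) (ZZ η lam mu) (Zinv η lam mu) = eps :=
  (Classical.choose_spec (exists_inv (ww η lam mu) (ZZ η lam mu) (ZZ_empty η lam mu))).1

lemma Zinv_ZZ (η : ℂ) (lam : ι → ℂ) (mu : κ → ℂ) :
    star (ww η lam mu) (Zinv η lam mu) (ZZ η lam mu) = eps :=
  (Classical.choose_spec (exists_inv (ww η lam mu) (ZZ η lam mu) (ZZ_empty η lam mu))).2

noncomputable def VV (η : ℂ) (lam : ι → ℂ) (mu : κ → ℂ) : Finset (ι ⊕ κ) → ℂ :=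
  star (ww η lam mu) (ind 0 1) (Zinv η lam mu)

noncomputable def RR (η : ℂ) (lam : ι → ℂ) (mu : κ → ℂ) (T : ℝ) : Finset (ι ⊕ κ) → ℂ :=
  star (ww η lam mu) (VV η lam mu) (gg lam mu T (ZZ η lam mu))

lemma RR_zero (η : ℂ) (lam : ι → ℂ) (mu : κ → ℂ) : RR η lam mu 0 = ind 0 1 := by
  have : gg lam mu 0 (ZZ η lam mu) = ZZ η lam mu := by funext S; simp [gg]
  unfold RR VV
  rw [this, star_assoc, Zinv_ZZ, star_eps]

section
variable (η : ℂ) (lam : ι → ℂ) (hlam : Function.Injective lam) (mu : κ → ℂ)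
    (hmu : Function.Injective mu) (hne : ∀ j b, mu b ≠ lam j)
include hlam hmu hne

lemma RR_deriv (T : ℝ) (S : Finset (ι ⊕ κ)) :
    HasDerivAt (fun T : ℝ => RR η lam mu T S)
      (star (ww η lam mu) (RR η lam mu T)
        (gg lam mu T (fun S => (-Complex.I * η) * ind 1 1 S)) S) T := by
  have e : star (ww η lam mu) (RR η lam mu T)
        (gg lam mu T (fun S => (-Complex.I * η) * ind 1 1 S))
      = star (ww η lam mu) (VV η lam mu)
        (gg lam mu T (fun S => mom lam mu S * ZZ η lam mu S)) := by
    rw [← mom_ZZ η lam hlam mu hmu hne, gg_star, ← star_assoc]; rfl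
  rw [e]
  unfold RR star
  refine HasDerivAt.fun_sum fun I _ => ?_
  refine HasDerivAt.const_mul _ ?_
  unfold gg
  have h1 : HasDerivAt (fun T : ℝ => (T : ℂ) * mom lam mu (S \ I)) (1 * mom lam mu (S \ I)) T :=
    (Complex.ofRealCLM.hasDerivAt (x := T)).mul_const _
  have h2 := (h1.cexp).mul_const (ZZ η lam mu (S \ I))
  convert h2 using 1
  ring

theorem RR_onshell (L : ℝ) (hw : ∀ x y, ww η lam mu x y ≠ 0)
    (hz : ∀ x, Complex.exp (L * mom lam mu {x}) * ∏ y, ww η lam mu y x = ∏ y, ww η lam mu x y) :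
    RR η lam mu L univ = DD η lam mu univ := by
  have h1 : ∀ J : Finset (ι ⊕ κ), Complex.exp (L * mom lam mu J) * Wt (ww η lam mu) Jᶜ J
      = Wt (ww η lam mu) J Jᶜ := by
    intro J
    have e1 : Complex.exp (L * mom lam mu J) = ∏ x ∈ J, Complex.exp (L * mom lam mu {x}) := by
      rw [← Complex.exp_sum, ← Finset.mul_sum]
      simp only [mom, Finset.sum_singleton]
    have e2 : (∏ x ∈ J, Complex.exp (L * mom lam mu {x})) * ∏ x ∈ J, ∏ y, ww η lam mu y x
        = ∏ x ∈ J, ∏ y, ww η lam mu x y := by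
      rw [← Finset.prod_mul_distrib]
      exact Finset.prod_congr rfl fun x _ => hz x
    have e3 : ∏ x ∈ J, ∏ y, ww η lam mu y x
        = Wt (ww η lam mu) J J * Wt (ww η lam mu) Jᶜ J := by
      rw [Finset.prod_comm, ← Finset.prod_mul_prod_compl J]; rfl
    have e4 : ∏ x ∈ J, ∏ y, ww η lam mu x y
        = Wt (ww η lam mu) J J * Wt (ww η lam mu) J Jᶜ := by
      unfold Wt; rw [← Finset.prod_mul_distrib]
      exact Finset.prod_congr rfl fun x _ => (Finset.prod_mul_prod_compl J _).symm
    rw [e3, e4] at e2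
    have hW : Wt (ww η lam mu) J J ≠ 0 :=
      Finset.prod_ne_zero_iff.2 fun x _ => Finset.prod_ne_zero_iff.2 fun y _ => hw x y
    apply mul_left_cancel₀ hW
    rw [e1, ← e2]; ring
  have h2 : star (ww η lam mu) (VV η lam mu) (gg lam mu L (ZZ η lam mu)) univ
      = star (ww η lam mu) (ZZ η lam mu) (VV η lam mu) univ := by
    unfold star
    refine Finset.sum_bij' (fun I _ => Iᶜ) (fun I _ => Iᶜ) (by simp) (by simp) (by simp) (by simp) ?_
    intro I _
    rw [← Finset.compl_eq_univ_sdiff, ← Finset.compl_eq_univ_sdiff, compl_compl]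
    have := h1 Iᶜ
    rw [compl_compl] at this
    rw [← this]; unfold gg; ring
  unfold RR
  rw [h2]; unfold VV
  rw [← star_assoc, ← DD_ZZ η lam hlam mu hmu hne, star_assoc, ZZ_Zinv, star_eps]

end

lemma star_ind11 (w) (f : Finset (ι ⊕ κ) → ℂ) (lam : ι → ℂ) (mu : κ → ℂ) (T : ℝ) (c : ℂ)
    (A : Finset ι) (B : Finset κ) :
    star w f (gg lam mu T (fun S => c * ind 1 1 S)) (A.disjSum B)
      = ∑ j ∈ A, ∑ b ∈ B, Wt w ((A.erase j).disjSum (B.erase b)) (({j} : Finset ι).disjSum {b}) *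
          f ((A.erase j).disjSum (B.erase b)) *
          (Complex.exp (T * (Complex.I * lam j - Complex.I * mu b)) * c) := by
  unfold star
  rw [← Finset.sum_product' (f := fun j b => Wt w ((A.erase j).disjSum (B.erase b)) (({j} : Finset ι).disjSum {b}) *
          f ((A.erase j).disjSum (B.erase b)) *
          (Complex.exp (T * (Complex.I * lam j - Complex.I * mu b)) * c))]
  have hsd : ∀ p : ι × κ, p ∈ A ×ˢ B → A.disjSum B \ (A.erase p.1).disjSum (B.erase p.2)
      = ({p.1} : Finset ι).disjSum {p.2} := by
    rintro ⟨j, b⟩ h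
    simp only [mem_product] at h
    ext (x | x)
    · simp only [mem_sdiff, inl_mem_disjSum, mem_erase, mem_singleton]
      constructor
      · rintro ⟨h1, h2⟩; by_contra h3; exact h2 ⟨h3, h1⟩
      · rintro rfl; exact ⟨h.1, fun h => h.1 rfl⟩
    · simp only [mem_sdiff, inr_mem_disjSum, mem_erase, mem_singleton]
      constructor
      · rintro ⟨h1, h2⟩; by_contra h3; exact h2 ⟨h3, h1⟩
      · rintro rfl; exact ⟨h.2, fun h => h.1 rfl⟩
  symm
  refine Finset.sum_of_injOn (fun p => (A.erase p.1).disjSum (B.erase p.2)) ?_ ?_ ?_ ?_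
  · rintro ⟨j, b⟩ h ⟨j', b'⟩ h' e
    have h0 := hsd _ h
    have h0' := hsd _ h'
    beta_reduce at e
    rw [e, h0'] at h0
    have hl := congrArg Finset.toLeft h0
    have hr := congrArg Finset.toRight h0
    simp only [Finset.toLeft_disjSum, Finset.toRight_disjSum, Finset.singleton_inj] at hl hr
    rw [hl, hr]
  · rintro ⟨j, b⟩ _
    simp only [coe_powerset, Set.mem_preimage, Set.mem_powerset_iff, Finset.coe_subset]
    exact Finset.disjSum_mono (Finset.erase_subset _ _) (Finset.erase_subset _ _)
  · intro I hI hn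
    have : ind 1 1 (A.disjSum B \ I) = 0 := by
      unfold ind
      rw [if_neg]
      rintro ⟨h1, h2⟩
      obtain ⟨j, hj⟩ := Finset.card_eq_one.1 h1
      obtain ⟨b, hb⟩ := Finset.card_eq_one.1 h2
      apply hn
      have hI' := mem_powerset.1 hI
      have mj : ∀ x, (Sum.inl x ∈ A.disjSum B \ I) ↔ x = j := by
        intro x; rw [← mem_toLeft, hj, mem_singleton]
      have mb : ∀ x, (Sum.inr x ∈ A.disjSum B \ I) ↔ x = b := by
        intro x; rw [← mem_toRight, hb, mem_singleton]
      simp only [mem_sdiff, inl_mem_disjSum, inr_mem_disjSum] at mj mb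
      refine ⟨(j, b), ?_, ?_⟩
      · simp only [coe_product, Set.mem_prod, mem_coe]
        exact ⟨((mj j).2 rfl).1, ((mb b).2 rfl).1⟩
      · ext (x | x)
        · have := mj x
          have h3 : Sum.inl x ∈ I → x ∈ A := fun h => by simpa using hI' h
          simp only [inl_mem_disjSum, mem_erase]; tauto
        · have := mb x
          have h3 : Sum.inr x ∈ I → x ∈ B := fun h => by simpa using hI' h
          simp only [inr_mem_disjSum, mem_erase]; tauto
    unfold gg; beta_reduce; rw [this]; ring
  · intro p hp
    rw [hsd p hp]
    unfold gg
    have i1 : ind 1 1 (({p.1} : Finset ι).disjSum ({p.2} : Finset κ)) = 1 := by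
      simp [ind, Finset.toLeft_disjSum, Finset.toRight_disjSum]
    have i2 : mom lam mu (({p.1} : Finset ι).disjSum ({p.2} : Finset κ))
        = Complex.I * lam p.1 - Complex.I * mu p.2 := by
      unfold mom; rw [Finset.sum_disjSum]; simp [sub_eq_add_neg]
    beta_reduce; rw [i1, i2]; ring

lemma Wt_ww_disjSum (η : ℂ) (lam : ι → ℂ) (mu : κ → ℂ) (A : Finset ι) (B : Finset κ) (j : ι) (b : κ) :
    Wt (ww η lam mu) (A.disjSum B) (({j} : Finset ι).disjSum {b})
      = (∏ k ∈ A, (1 + η / (lam k - lam j))) * ∏ a ∈ B, (1 - η / (mu a - mu b)) := by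
  unfold Wt
  rw [Finset.prod_disjSum]
  simp only [Finset.prod_disjSum, Finset.prod_singleton, ww, mul_one, one_mul]

end Evo
end Bethe
end Part5

section Part6
open scoped BigOperators
open Finset

set_option linter.unusedSectionVars false

namespace Bethe

section Det

noncomputable def Ep (η : ℂ) (l : List ℂ) (x : ℂ) : ℂ := (l.map fun m => 1 + η / (x - m)).prod
noncomputable def aa {n : ℕ} (η : ℂ) (lam : Fin n → ℂ) (j : Fin n) : ℂ := ∏ i, (1 + η / (lam j - lam i))

noncomputable def NN {n : ℕ} (η : ℂ) (lam : Fin n → ℂ) (l : List ℂ) : Matrix (Fin n) (Fin n) ℂ :=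
  Matrix.of fun j k =>
    (if j = k then Ep η l (lam j) / aa η lam j + Ep (-η) l (lam j) / aa (-η) lam j else 0)
     + η * (1 / (lam j - lam k - η) - 1 / (lam j - lam k + η))

lemma lagrange_pf {n : ℕ} (lam : Fin n → ℂ) (hlam : Function.Injective lam) (P : Polynomial ℂ)
    (hP : P.degree < n) (x : ℂ) (hx : ∀ k, x ≠ lam k) :
    P.eval x = (∏ k, (x - lam k)) *
      ∑ k, P.eval (lam k) / (∏ i ∈ univ.erase k, (lam k - lam i)) / (x - lam k) := by
  have h1 := Lagrange.eq_interpolate (s := (univ : Finset (Fin n))) (v := lam) (f := P)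
    (hlam.injOn) (by simpa using hP)
  conv_lhs => rw [h1]
  rw [Lagrange.eval_interpolate_not_at_node _ (fun i _ => hx i), Lagrange.eval_nodal]
  congr 1
  refine Finset.sum_congr rfl fun k _ => ?_
  unfold Lagrange.nodalWeight
  rw [Finset.prod_inv_distrib]
  ring

lemma list_prod_eq (l : List ℂ) (f : ℂ → ℂ) : (l.map f).prod = ∏ i : Fin l.length, f (l.get i) := by
  rw [← List.prod_ofFn]
  congr 1
  conv_lhs => rw [← List.ofFn_get l]
  rw [List.map_ofFn]; rfl

lemma det_zero {n : ℕ} (hn : 0 < n) (η : ℂ) (h0 : η ≠ 0) (lam : Fin n → ℂ)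
    (hlam : Function.Injective lam)
    (hη : ∀ j k, lam j - lam k ≠ η) (l : List ℂ) (hl : ∀ m ∈ l, ∀ j, m ≠ lam j)
    (hlen : l.length = n) : (NN η lam l).det = 0 := by
  set Q : Polynomial ℂ := Lagrange.nodal univ l.get with hQ
  set W : Polynomial ℂ := Lagrange.nodal univ lam with hW
  have dQ : Q.degree = n := by rw [hQ, Lagrange.degree_nodal]; simp [hlen]
  have dW : W.degree = n := by rw [hW, Lagrange.degree_nodal]; simp
  have hd : (Q - W).degree < n := by
    rw [← dQ]
    refine Polynomial.degree_sub_lt_left (dQ.trans dW.symm) Lagrange.nodal_monic.ne_zero ?_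
    rw [Lagrange.nodal_monic.leadingCoeff, Lagrange.nodal_monic.leadingCoeff]
  have hlt : ∀ j i, lam j - l.get i ≠ 0 := fun j i =>
    sub_ne_zero.2 (hl _ (List.get_mem _ _) j).symm
  set den : Fin n → ℂ := fun k => ∏ i ∈ univ.erase k, (lam k - lam i) with hden
  have hden0 : ∀ k, den k ≠ 0 := fun k => Finset.prod_ne_zero_iff.2 fun i hi =>
    sub_ne_zero.2 (hlam.ne (ne_of_mem_erase hi).symm)
  set v : Fin n → ℂ := fun k => Q.eval (lam k) / den k with hv
  have hWl : ∀ k, W.eval (lam k) = 0 := fun k => by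
    rw [hW, Lagrange.eval_nodal]; exact Finset.prod_eq_zero (mem_univ k) (sub_self _)
  have hη' : ∀ j k, lam j - lam k + η ≠ 0 := fun j k h => hη k j (by linear_combination -h)
  have hη'' : ∀ j k, lam j - lam k - η ≠ 0 := fun j k h => hη j k (by linear_combination h)
  have key : ∀ x, (∀ k, x ≠ lam k) → Q.eval x / W.eval x = 1 + ∑ k, v k / (x - lam k) := by
    intro x hx
    have hWx : W.eval x = ∏ k, (x - lam k) := by rw [hW, Lagrange.eval_nodal]
    have hWx0 : W.eval x ≠ 0 := by
      rw [hWx]; exact Finset.prod_ne_zero_iff.2 fun k _ => sub_ne_zero.2 (hx k)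
    have := lagrange_pf lam hlam (Q - W) hd x hx
    simp only [Polynomial.eval_sub, hWl, sub_zero] at this
    rw [← hWx] at this
    rw [eq_comm, eq_div_iff hWx0]
    linear_combination -this
  -- values of the ratio at shifted points
  have val : ∀ (ε : ℂ), ε ≠ 0 → ∀ j,
      Q.eval (lam j + ε) / W.eval (lam j + ε) = Ep ε l (lam j) * v j / (ε * aa ε lam j) := by
    intro ε hε j
    have e1 : Q.eval (lam j + ε) = Ep ε l (lam j) * Q.eval (lam j) := by
      rw [hQ, Lagrange.eval_nodal, Lagrange.eval_nodal, Ep, list_prod_eq, ← Finset.prod_mul_distrib]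
      refine Finset.prod_congr rfl fun i _ => ?_
      have := hlt j i
      field_simp
      ring
    have e2 : W.eval (lam j + ε) = ε * aa ε lam j * den j := by
      rw [hW, Lagrange.eval_nodal, aa, hden]
      rw [← Finset.mul_prod_erase _ _ (mem_univ j), ← Finset.mul_prod_erase univ (fun i => 1 + ε / (lam j - lam i)) (mem_univ j)]
      rw [sub_self, div_zero, add_zero, one_mul, mul_assoc, ← Finset.prod_mul_distrib]
      congr 1
      · ring
      · refine Finset.prod_congr rfl fun i hi => ?_
        have : lam j - lam i ≠ 0 := sub_ne_zero.2 (hlam.ne (ne_of_mem_erase hi).symm)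
        field_simp
        ring
    rw [e1, e2, hv]
    have := hden0 j
    rw [mul_div_assoc, mul_div_assoc, div_div, mul_comm (den j)]
  refine Matrix.exists_mulVec_eq_zero_iff.1 ⟨v, ?_, ?_⟩
  · intro h
    have h1 : v ⟨0, hn⟩ = 0 := congrFun h _
    simp only [hv, div_eq_zero_iff, hden0, or_false] at h1
    rw [hQ, Lagrange.eval_nodal] at h1
    obtain ⟨i, _, hi⟩ := Finset.prod_eq_zero_iff.1 h1
    exact hlt _ i hi
  · funext j
    have k1 := key (lam j + -η) (fun k h => hη j k (by linear_combination h))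
    have k2 := key (lam j + η) (fun k h => hη k j (by linear_combination -h))
    rw [val (-η) (neg_ne_zero.2 h0)] at k1
    rw [val η h0] at k2
    simp only [Matrix.mulVec, dotProduct, NN, Matrix.of_apply, Pi.zero_apply, add_mul,
      Finset.sum_add_distrib, ite_mul, zero_mul, Finset.sum_ite_eq, mem_univ, if_true]
    have e : ∑ x, η * (1 / (lam j - lam x - η) - 1 / (lam j - lam x + η)) * v x
       = η * (∑ k, v k / (lam j + -η - lam k) - ∑ k, v k / (lam j + η - lam k)) := by
      rw [← Finset.sum_sub_distrib, Finset.mul_sum]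
      refine Finset.sum_congr rfl fun k _ => ?_
      rw [show lam j + -η - lam k = lam j - lam k - η by ring,
        show lam j + η - lam k = lam j - lam k + η by ring]
      ring
    rw [e, show ∑ k, v k / (lam j + -η - lam k) - ∑ k, v k / (lam j + η - lam k)
      = (1 + ∑ k, v k / (lam j + -η - lam k)) - (1 + ∑ k, v k / (lam j + η - lam k)) by ring,
      ← k1, ← k2]
    have c1 : η * (Ep (-η) l (lam j) * v j / (-η * aa (-η) lam j)) = - (Ep (-η) l (lam j) * v j / aa (-η) lam j) := by
      rw [mul_div_assoc', neg_mul, div_neg, mul_div_mul_left _ _ h0]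
    have c2 : η * (Ep η l (lam j) * v j / (η * aa η lam j)) = (Ep η l (lam j) * v j / aa η lam j) := by
      rw [mul_div_assoc', mul_div_mul_left _ _ h0]
    rw [mul_sub, c1, c2]
    ring

lemma univ_erase_image {n : ℕ} (j : Fin (n + 1)) :
    (univ : Finset (Fin (n + 1))).erase j = univ.image j.succAbove := by
  ext x; simp

lemma aa_succAbove {n : ℕ} (ε : ℂ) (lam : Fin (n + 1) → ℂ) (j : Fin (n + 1)) (k : Fin n) :
    aa ε lam (j.succAbove k) = (1 + ε / (lam (j.succAbove k) - lam j)) *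
      aa ε (lam ∘ j.succAbove) k := by
  unfold aa
  rw [Fin.prod_univ_succAbove _ j]; rfl

lemma det_rec {n : ℕ} (η : ℂ) (h0 : η ≠ 0) (lam : Fin (n + 1) → ℂ)
    (hlam : Function.Injective lam)
    (hη : ∀ j k, lam j - lam k ≠ η) (b : ℂ) (hb : ∀ j, b ≠ lam j)
    (l : List ℂ) (hl : ∀ m ∈ l, ∀ j, m ≠ lam j)
    (hlen : l.length = n + 1) :
    (NN η lam (b :: l)).det = ∑ j, (η * (Ep (-η) l (lam j) / aa (-η) lam j - Ep η l (lam j) / aa η lam j))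
      / (b - lam j) * (NN η (lam ∘ j.succAbove) l).det := by
  have hη' : ∀ j k, lam j - lam k + η ≠ 0 := fun j k h => hη k j (by linear_combination -h)
  have hη'' : ∀ j k, lam j - lam k - η ≠ 0 := fun j k h => hη j k (by linear_combination h)
  set r : Fin (n + 1) → ℂ := fun j =>
    η * (Ep (-η) l (lam j) / aa (-η) lam j - Ep η l (lam j) / aa η lam j) with hr
  set B : Matrix (Fin (n + 1)) (Fin (n + 1)) ℂ := Matrix.of fun j k =>
    (-lam j) * NN η lam l j k + if j = k then r j else 0 with hB
  set P : Polynomial ℂ := ((Polynomial.X : Polynomial ℂ) • (NN η lam l).map Polynomial.C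
    + B.map Polynomial.C).det with hP
  have hz := det_zero (Nat.succ_pos n) η h0 lam hlam hη l hl hlen
  have hdeg : P.degree < ((n + 1 : ℕ) : WithBot ℕ) := by
    have h1 := Polynomial.natDegree_det_X_add_C_le (NN η lam l) B
    have h2 := Polynomial.coeff_det_X_add_C_card (NN η lam l) B
    rw [← hP, Fintype.card_fin] at h1 h2
    rw [hz] at h2
    rw [Polynomial.degree_lt_iff_coeff_zero]
    intro m hm
    rcases hm.eq_or_lt with rfl | hm
    · exact h2
    · exact Polynomial.coeff_eq_zero_of_natDegree_lt (h1.trans_lt hm)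
  have hPev : ∀ x, P.eval x = (Matrix.of fun j k => (x - lam j) * NN η lam l j k
      + if j = k then r j else 0).det := by
    intro x
    rw [hP, ← Polynomial.coe_evalRingHom, RingHom.map_det]
    congr 1
    ext j k
    simp only [RingHom.mapMatrix_apply, Matrix.map_apply, Matrix.add_apply, Matrix.smul_apply,
      smul_eq_mul, Polynomial.coe_evalRingHom, Polynomial.eval_add, Polynomial.eval_mul,
      Polynomial.eval_X, Polynomial.eval_C, hB, Matrix.of_apply]
    ring
  have hPb : P.eval b = (∏ j, (b - lam j)) * (NN η lam (b :: l)).det := by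
    rw [hPev, ← Matrix.det_mul_column]
    congr 1
    ext j k
    simp only [Matrix.of_apply, NN, Ep, List.map_cons, List.prod_cons]
    have h1 : b - lam j ≠ 0 := sub_ne_zero.2 (hb j)
    by_cases hjk : j = k
    · simp only [hjk, if_true, hr, Ep]
      rw [hjk] at h1
      rw [show lam k - b = -(b - lam k) by ring]
      field_simp
      ring
    · simp only [hjk, if_false]; ring
  have hPl : ∀ j, P.eval (lam j) = r j * ((∏ k, (lam j - lam (j.succAbove k))) *
      (NN η (lam ∘ j.succAbove) l).det) := by
    intro j
    rw [hPev, Matrix.det_succ_row _ j, Finset.sum_eq_single j]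
    · have hs : (-1 : ℂ) ^ ((j : ℕ) + (j : ℕ)) = 1 := by rw [← two_mul, pow_mul]; simp
      rw [hs, one_mul, ← Matrix.det_mul_column]
      congr 1
      · simp
      congr 1
      ext k k'
      simp only [Matrix.submatrix_apply, Matrix.of_apply, NN, Function.comp_apply,
        Fin.succAbove_right_inj]
      have hd : lam (j.succAbove k) - lam j ≠ 0 := sub_ne_zero.2 (hlam.ne (Fin.succAbove_ne _ _))
      by_cases hkk : k = k'
      · subst hkk
        simp only [if_true, hr, aa_succAbove]
        have g1 : 1 + η / (lam (j.succAbove k) - lam j) ≠ 0 := by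
          intro h; field_simp at h; rw [mul_zero] at h; exact hη' _ _ h
        have g2 : 1 + -η / (lam (j.succAbove k) - lam j) ≠ 0 := by
          intro h; field_simp at h; rw [mul_zero] at h; exact hη'' (j.succAbove k) j (by linear_combination h)
        have f1 : η / (lam (j.succAbove k) - lam j) * (lam (j.succAbove k) - lam j) = η :=
          div_mul_cancel₀ _ hd
        have f2 : -η / (lam (j.succAbove k) - lam j) * (lam (j.succAbove k) - lam j) = -η :=
          div_mul_cancel₀ _ hd
        generalize hG1 : 1 + η / (lam (j.succAbove k) - lam j) = G1 at *
        generalize hG2 : 1 + -η / (lam (j.succAbove k) - lam j) = G2 at *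
        have f3 : η = (G1 - 1) * (lam (j.succAbove k) - lam j) := by rw [← hG1]; linear_combination -f1
        have f4 : -η = (G2 - 1) * (lam (j.succAbove k) - lam j) := by rw [← hG2]; linear_combination -f2
        have u1 : ∀ x, Ep η l (lam (j.succAbove k)) / (G1 * x) * G1 = Ep η l (lam (j.succAbove k)) / x := by
          intro x; rw [mul_comm G1, ← div_div, div_mul_cancel₀ _ g1]
        have u2 : ∀ x, Ep (-η) l (lam (j.succAbove k)) / (G2 * x) * G2 = Ep (-η) l (lam (j.succAbove k)) / x := by
          intro x; rw [mul_comm G2, ← div_div, div_mul_cancel₀ _ g2]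
        have w1 := u1 (aa η (lam ∘ j.succAbove) k)
        have w2 := u2 (aa (-η) (lam ∘ j.succAbove) k)
        linear_combination -(Ep η l (lam (j.succAbove k)) / (G1 * aa η (lam ∘ j.succAbove) k)) * f3
          - (Ep (-η) l (lam (j.succAbove k)) / (G2 * aa (-η) (lam ∘ j.succAbove) k)) * f4
          - (lam (j.succAbove k) - lam j) * w1 - (lam (j.succAbove k) - lam j) * w2
      · simp only [hkk, if_false]; ring
    · intro k _ hk
      simp [Ne.symm hk]
    · simp
  have hL := lagrange_pf lam hlam P (by exact_mod_cast hdeg) b hb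
  have hne : ∏ j, (b - lam j) ≠ 0 := Finset.prod_ne_zero_iff.2 fun j _ => sub_ne_zero.2 (hb j)
  rw [hPb] at hL
  rw [mul_left_cancel₀ hne hL]
  refine Finset.sum_congr rfl fun j _ => ?_
  have hp : ∏ i ∈ univ.erase j, (lam j - lam i) = ∏ k, (lam j - lam (j.succAbove k)) := by
    rw [univ_erase_image, Finset.prod_image (fun a _ b _ h => Fin.succAbove_right_injective h)]
  have hp0 : ∏ k, (lam j - lam (j.succAbove k)) ≠ 0 :=
    Finset.prod_ne_zero_iff.2 fun k _ => sub_ne_zero.2 (hlam.ne (Fin.succAbove_ne _ _).symm)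
  rw [hp, hPl j]
  field_simp
  rw [hr]
  ring

noncomputable def detM {n : ℕ} (η : ℂ) (lam : Fin n → ℂ) (l : List ℂ) : ℂ :=
  (∏ j, aa η lam j) * (NN η lam l).det

lemma aa_ne {n : ℕ} (η : ℂ) (lam : Fin n → ℂ) (hlam : Function.Injective lam)
    (hη : ∀ j k, lam j - lam k ≠ -η) (j : Fin n) : aa η lam j ≠ 0 := by
  refine Finset.prod_ne_zero_iff.2 fun i _ h => ?_
  by_cases hij : i = j
  · simp [hij] at h
  · have hd : lam j - lam i ≠ 0 := sub_ne_zero.2 (hlam.ne (Ne.symm hij))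
    field_simp at h
    exact hη j i (by linear_combination h)

lemma detM_rec {n : ℕ} (η : ℂ) (h0 : η ≠ 0) (lam : Fin (n + 1) → ℂ)
    (hlam : Function.Injective lam)
    (hη : ∀ j k, lam j - lam k ≠ η) (b : ℂ) (hb : ∀ j, b ≠ lam j)
    (l : List ℂ) (hl : ∀ m ∈ l, ∀ j, m ≠ lam j)
    (hlen : l.length = n + 1) :
    detM η lam (b :: l) = ∑ j, (η * (Ep (-η) l (lam j) * aa η lam j - Ep η l (lam j) * aa (-η) lam j))
      / (b - lam j) * detM η (lam ∘ j.succAbove) l := by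
  unfold detM
  rw [det_rec η h0 lam hlam hη b hb l hl hlen, Finset.mul_sum]
  refine Finset.sum_congr rfl fun j _ => ?_
  have e : ∏ i, aa η lam i = aa η lam j * (aa (-η) lam j * ∏ i, aa η (lam ∘ j.succAbove) i) := by
    rw [Fin.prod_univ_succAbove _ j]
    congr 1
    have : aa (-η) lam j = ∏ i : Fin n, (1 + η / (lam (j.succAbove i) - lam j)) := by
      unfold aa
      rw [Fin.prod_univ_succAbove _ j]
      rw [sub_self, div_zero, add_zero, one_mul]
      refine Finset.prod_congr rfl fun i _ => ?_
      rw [← neg_sub (lam (j.succAbove i)), neg_div_neg_eq]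
    rw [this, ← Finset.prod_mul_distrib]
    exact Finset.prod_congr rfl fun i _ => aa_succAbove η lam j i
  rw [e]
  have h1 : aa η lam j ≠ 0 := aa_ne η lam hlam (fun j k h => hη k j (by linear_combination -h)) j
  have h2 : aa (-η) lam j ≠ 0 := aa_ne (-η) lam hlam (fun j k h => hη j k (by linear_combination h)) j
  field_simp

theorem detM_eq_Fl {ι : Type*} [DecidableEq ι] (η : ℂ) (h0 : η ≠ 0) (lam : ι → ℂ)
    (hlam : Function.Injective lam)
    (hη : ∀ j k, lam j - lam k ≠ η) (l : List ℂ) (hl : ∀ m ∈ l, ∀ j, m ≠ lam j) :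
    ∀ (n : ℕ) (_ : l.length = n + 1) (s : Fin n → ι) (_ : Function.Injective s),
    detM η (lam ∘ s) l = Fl η 1 0 1 lam l (univ.image s) := by
  induction l with
  | nil => intro n h; simp at h
  | cons b l ih =>
    intro n hlen s hs
    have hlen' : l.length = n := by simpa using hlen
    cases n with
    | zero =>
      have hl0 : l = [] := List.length_eq_zero_iff.1 hlen'
      subst hl0
      simp [detM, Fl]
    | succ n =>
      have hl' : ∀ m ∈ l, ∀ j, m ≠ lam j := fun m hm => hl m (List.mem_cons_of_mem _ hm)
      rw [detM_rec η h0 (lam ∘ s) (hlam.comp hs) (fun j k => hη _ _) b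
        (fun j => hl b (by simp) _) l (fun m hm j => hl' m hm _) hlen']
      simp only [Fl]
      rw [if_neg (by rintro ⟨h, -⟩; simp [h] at hlen'), zero_add,
        Finset.sum_image (fun a _ b _ h => hs h)]
      refine Finset.sum_congr rfl fun j _ => ?_
      have e1 : (univ.image s).erase (s j) = univ.image (s ∘ j.succAbove) := by
        rw [← Finset.image_image, ← univ_erase_image, Finset.image_erase hs]
      have hs' : Function.Injective (s ∘ j.succAbove) := hs.comp Fin.succAbove_right_injective
      have e2 : ∀ ε : ℂ, aa ε (lam ∘ s) j = ∏ k ∈ univ.image (s ∘ j.succAbove), (1 + ε / (lam (s j) - lam k)) := by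
        intro ε
        rw [Finset.prod_image (fun a _ b _ h => hs' h), aa, Fin.prod_univ_succAbove _ j]
        simp
      rw [e1, ← ih hl' n hlen' _ hs', Function.comp_assoc]
      congr 2
      have e3 : ∏ k ∈ univ.image (s ∘ j.succAbove), (1 + -η / (lam (s j) - lam k))
          = ∏ k ∈ univ.image (s ∘ j.succAbove), (1 - η / (lam (s j) - lam k)) :=
        Finset.prod_congr rfl fun k _ => by ring
      have e4 : Ep (-η) l ((lam ∘ s) j) = (l.map fun m => 1 - η / (lam (s j) - m)).prod := by
        unfold Ep; congr 1; refine List.map_congr_left fun m _ => ?_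
        simp only [Function.comp_apply]; ring
      rw [e2, e2, e3, e4]
      simp only [kap, Ep, Function.comp_apply]
      ring

end Det
end Bethe
end Part6

section Part7
open scoped BigOperators
open Finset
open MeasureTheory

set_option linter.unusedSectionVars false

namespace Bethe

section Analytic

def Dl (n : ℕ) (T : ℝ) : Set (Fin n → ℝ) := {x | Monotone x ∧ ∀ i, x i ∈ Set.Icc 0 T}

lemma mem_Dl_snoc {n : ℕ} (T : ℝ) (y : Fin n → ℝ) (t : ℝ) :
    (Fin.snoc y t : Fin (n + 1) → ℝ) ∈ Dl (n + 1) T ↔ t ∈ Set.Icc 0 T ∧ y ∈ Dl n t := by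
  constructor
  · rintro ⟨h1, h2⟩
    have ht := h2 (Fin.last n)
    rw [Fin.snoc_last] at ht
    refine ⟨ht, ?_, ?_⟩
    · intro a b hab
      have := h1 (show a.castSucc ≤ b.castSucc from hab)
      simpa using this
    · intro i
      have h3 := h2 i.castSucc
      have h4 := h1 (Fin.le_last i.castSucc)
      rw [Fin.snoc_castSucc] at h3 h4
      rw [Fin.snoc_last] at h4
      exact ⟨h3.1, h4⟩
  · rintro ⟨ht, h1, h2⟩
    refine ⟨?_, ?_⟩
    · intro a b hab
      induction b using Fin.lastCases with
      | last =>
        rw [Fin.snoc_last]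
        induction a using Fin.lastCases with
        | last => rw [Fin.snoc_last]
        | cast a => rw [Fin.snoc_castSucc]; exact (h2 a).2
      | cast b =>
        induction a using Fin.lastCases with
        | last => exact absurd hab (by simp)
        | cast a => rw [Fin.snoc_castSucc, Fin.snoc_castSucc]; exact h1 hab
    · intro i
      induction i using Fin.lastCases with
      | last => rw [Fin.snoc_last]; exact ht
      | cast a => rw [Fin.snoc_castSucc]; exact ⟨(h2 a).1, (h2 a).2.trans ht.2⟩

lemma isCompact_Dl (n : ℕ) (T : ℝ) : IsCompact (Dl n T) := by
  have h : Dl n T = {x : Fin n → ℝ | Monotone x} ∩ Set.univ.pi fun _ => Set.Icc (0 : ℝ) T := by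
    ext x; simp only [Dl, Set.mem_inter_iff, Set.mem_univ_pi]; exact Iff.rfl
  rw [h]
  refine IsCompact.inter_left (isCompact_univ_pi fun _ => isCompact_Icc) ?_
  have : {x : Fin n → ℝ | Monotone x} = ⋂ (a : Fin n) (b : Fin n) (_ : a ≤ b), {x | x a ≤ x b} := by
    ext x; simp [Monotone]
  rw [this]
  exact isClosed_iInter fun a => isClosed_iInter fun b => isClosed_iInter fun _ =>
    isClosed_le (continuous_apply a) (continuous_apply b)

lemma integral_Dl_succ {n : ℕ} (T : ℝ) (hT : 0 ≤ T) (F : (Fin (n + 1) → ℝ) → ℂ) (hF : Continuous F) :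
    ∫ x in Dl (n + 1) T, F x = ∫ t in (0 : ℝ)..T, ∫ y in Dl n t, F (Fin.snoc y t) := by
  have hm : ∀ n T, MeasurableSet (Dl n T) := fun n T => (isCompact_Dl n T).isClosed.measurableSet
  have hi : Integrable ((Dl (n + 1) T).indicator F) := by
    rw [integrable_indicator_iff (hm _ _)]
    exact hF.continuousOn.integrableOn_compact (isCompact_Dl _ _)
  have mp := (volume_preserving_piFinSuccAbove (fun _ : Fin (n + 1) => ℝ) (Fin.last n)).symm
  rw [← integral_indicator (hm _ _), ← mp.integral_comp']
  have hi' := (mp.integrable_comp_emb (MeasurableEquiv.measurableEmbedding _)).2 hi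
  rw [Measure.volume_eq_prod] at hi' ⊢
  rw [integral_prod (fun x => (Dl (n + 1) T).indicator F
        ((MeasurableEquiv.piFinSuccAbove (fun _ : Fin (n + 1) => ℝ) (Fin.last n)).symm x)) hi', intervalIntegral.integral_of_le hT, ← integral_Icc_eq_integral_Ioc,
    ← integral_indicator measurableSet_Icc]
  refine integral_congr_ae (Filter.Eventually.of_forall fun t => ?_)
  have hs : ∀ y : Fin n → ℝ, (MeasurableEquiv.piFinSuccAbove (fun _ : Fin (n + 1) => ℝ) (Fin.last n)).symm (t, y)
      = (Fin.snoc y t : Fin (n + 1) → ℝ) := fun y => Fin.insertNth_last' t y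
  by_cases ht : t ∈ Set.Icc 0 T
  · rw [Set.indicator_of_mem ht, ← integral_indicator (hm _ _)]
    refine integral_congr_ae (Filter.Eventually.of_forall fun y => ?_)
    beta_reduce
    rw [show (MeasurableEquiv.piFinSuccAbove (fun _ : Fin (n + 1) => ℝ) (Fin.last n)).symm (t, y) = _ from hs y]
    by_cases hy : y ∈ Dl n t
    · rw [Set.indicator_of_mem hy, Set.indicator_of_mem ((mem_Dl_snoc T y t).2 ⟨ht, hy⟩)]
    · rw [Set.indicator_of_notMem hy, Set.indicator_of_notMem (fun h => hy ((mem_Dl_snoc T y t).1 h).2)]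
  · rw [Set.indicator_of_notMem ht]
    refine integral_eq_zero_of_ae (Filter.Eventually.of_forall fun y => ?_)
    beta_reduce
    rw [show (MeasurableEquiv.piFinSuccAbove (fun _ : Fin (n + 1) => ℝ) (Fin.last n)).symm (t, y) = _ from hs y]
    rw [Set.indicator_of_notMem (fun h => ht ((mem_Dl_snoc T y t).1 h).1)]; rfl

variable {ι κ : Type*} [DecidableEq ι] [DecidableEq κ] [Fintype ι] [Fintype κ]

noncomputable def Phi {ι : Type*} [DecidableEq ι] (w : ι → ι → ℂ) (e : ι → ℝ → ℂ) : (n : ℕ) → (Fin n → ℝ) → Finset ι → ℂ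
  | 0, _, A => if A = ∅ then 1 else 0
  | n + 1, x, A => ∑ j ∈ A, (∏ k ∈ A.erase j, w k j) * e j (x (Fin.last n)) * Phi w e n (Fin.init x) (A.erase j)

lemma Phi_cont (w : ι → ι → ℂ) (e : ι → ℝ → ℂ) (he : ∀ j, Continuous (e j)) (n : ℕ) :
    ∀ A, Continuous fun x : Fin n → ℝ => Phi w e n x A := by
  induction n with
  | zero => intro A; exact continuous_const
  | succ n ih =>
    intro A
    simp only [Phi]
    refine continuous_finsetSum _ fun j _ => ?_
    refine (continuous_const.mul ((he j).comp (continuous_apply _))).mul ((ih _).comp ?_)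
    exact continuous_pi fun i => continuous_apply _

lemma Phi_snoc (w : ι → ι → ℂ) (e : ι → ℝ → ℂ) (n : ℕ) (y : Fin n → ℝ) (t : ℝ) (A : Finset ι) :
    Phi w e (n + 1) (Fin.snoc y t) A =
      ∑ j ∈ A, (∏ k ∈ A.erase j, w k j) * e j t * Phi w e n y (A.erase j) := by
  simp [Phi]

variable (c : ℝ) (lam : ι → ℂ) (hlam : Function.Injective lam) (mu : κ → ℂ)
  (hmu : Function.Injective mu) (hne : ∀ j b, mu b ≠ lam j)

noncomputable def PL {n : ℕ} (x : Fin n → ℝ) (A : Finset ι) : ℂ :=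
  Phi (fun k j => 1 + Complex.I * c / (lam k - lam j)) (fun j t => Complex.exp (t * (Complex.I * lam j))) n x A
noncomputable def PM {n : ℕ} (x : Fin n → ℝ) (B : Finset κ) : ℂ :=
  Phi (fun k j => 1 - Complex.I * c / (mu k - mu j)) (fun j t => Complex.exp (t * (-(Complex.I * mu j)))) n x B

lemma PL_cont (n : ℕ) (A : Finset ι) : Continuous fun x : Fin n → ℝ => PL c lam x A := 
  Phi_cont _ _ (fun j => by fun_prop) n A

lemma PM_cont (n : ℕ) (A : Finset κ) : Continuous fun x : Fin n → ℝ => PM c mu x A := 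
  Phi_cont _ _ (fun j => by fun_prop) n A

include hlam hmu hne in
theorem RR_eq_integral (n : ℕ) : ∀ (T : ℝ), 0 ≤ T → ∀ (A : Finset ι) (B : Finset κ), A.card = n →
    RR (Complex.I * c) lam mu T (A.disjSum B) =
      ∫ x in Dl n T, (c : ℂ) ^ n * PL c lam x A * PM c mu (Fin.cons 0 x : Fin (n + 1) → ℝ) B := by
  have hc : -Complex.I * (Complex.I * c) = c := by
    rw [← mul_assoc, neg_mul, Complex.I_mul_I]; ring
  have hder : ∀ A : Finset ι, ∀ B : Finset κ, ∀ t, HasDerivAt (fun T => RR (Complex.I * c) lam mu T (A.disjSum B))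
      (∑ j ∈ A, ∑ b ∈ B, (∏ k ∈ A.erase j, (1 + Complex.I * c / (lam k - lam j))) *
        (∏ a ∈ B.erase b, (1 - Complex.I * c / (mu a - mu b))) *
          RR (Complex.I * c) lam mu t ((A.erase j).disjSum (B.erase b)) *
          (Complex.exp (t * (Complex.I * lam j - Complex.I * mu b)) * c)) t := by
    intro A B t
    have := RR_deriv (Complex.I * c) lam hlam mu hmu hne t (A.disjSum B)
    rw [star_ind11, hc] at this
    simpa only [Wt_ww_disjSum] using this
  have hcont : ∀ A : Finset ι, ∀ B : Finset κ, Continuous fun T => RR (Complex.I * c) lam mu T (A.disjSum B) :=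
    fun A B => continuous_iff_continuousAt.2 fun t => (hder A B t).continuousAt
  have hFTC : ∀ A : Finset ι, ∀ B : Finset κ, ∀ T, RR (Complex.I * c) lam mu T (A.disjSum B) =
     ind 0 1 (A.disjSum B) + ∫ t in (0:ℝ)..T, (∑ j ∈ A, ∑ b ∈ B, (∏ k ∈ A.erase j, (1 + Complex.I * c / (lam k - lam j))) *
        (∏ a ∈ B.erase b, (1 - Complex.I * c / (mu a - mu b))) *
          RR (Complex.I * c) lam mu t ((A.erase j).disjSum (B.erase b)) *
          (Complex.exp (t * (Complex.I * lam j - Complex.I * mu b)) * c)) := by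
    intro A B T
    rw [intervalIntegral.integral_eq_sub_of_hasDerivAt (fun t _ => hder A B t), RR_zero]
    · ring
    · apply Continuous.intervalIntegrable
      refine continuous_finsetSum _ fun j _ => continuous_finsetSum _ fun b _ => ?_
      exact (continuous_const.mul (hcont _ _)).mul (by fun_prop)
  induction n with
  | zero =>
    intro T hT A B hA
    have hA' : A = ∅ := Finset.card_eq_zero.1 hA
    subst hA'
    rw [hFTC]
    have hD : Dl 0 T = Set.univ := by
      ext x; simp only [Dl, Set.mem_ofPred_eq, Set.mem_univ, iff_true]
      exact ⟨fun a => a.elim0, fun a => a.elim0⟩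
    have hPM : ∀ x : Fin 0 → ℝ, PM c mu (Fin.cons 0 x : Fin 1 → ℝ) B = if B.card = 1 then 1 else 0 := by
      intro x
      simp only [PM, Phi]
      by_cases h : B.card = 1
      · obtain ⟨b, rfl⟩ := Finset.card_eq_one.1 h
        simp [show (Fin.last 0) = 0 from rfl]
      · rw [if_neg h]
        refine Finset.sum_eq_zero fun b hb => ?_
        rw [if_neg, mul_zero]
        intro h'
        apply h
        have := Finset.card_erase_of_mem hb
        rw [h', Finset.card_empty] at this
        have := Finset.card_pos.2 ⟨b, hb⟩
        omega
    simp only [hPM, hD, Measure.restrict_univ]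
    have hv : (volume : Measure (Fin 0 → ℝ)).real Set.univ = 1 := by
      rw [volume_pi, Measure.pi_of_empty]; simp
    simp only [Finset.sum_empty, intervalIntegral.integral_zero, add_zero, ind, PL, Phi, Finset.toLeft_disjSum,
      Finset.toRight_disjSum, Finset.card_empty, true_and, if_true, pow_zero, one_mul, integral_const, hv, one_smul]
  | succ n ih =>
    intro T hT A B hA
    rw [hFTC, integral_Dl_succ T hT]
    · have h0 : ind 0 1 (A.disjSum B) = (0 : ℂ) := by
        simp [ind, hA]
      rw [h0, zero_add]
      refine intervalIntegral.integral_congr fun t ht => ?_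
      rw [Set.uIcc_of_le hT] at ht
      have hInt0 : ∀ A' B', Integrable (fun y : Fin n → ℝ => (c : ℂ) ^ n * PL c lam y A' *
          PM c mu (Fin.cons 0 y : Fin (n + 1) → ℝ) B') (volume.restrict (Dl n t)) := by
        intro A' B'
        refine (Continuous.continuousOn ?_).integrableOn_compact (isCompact_Dl _ _)
        refine (continuous_const.mul (PL_cont c lam n A')).mul ((PM_cont c mu (n + 1) B').comp ?_)
        fun_prop
      have e : ∀ y : Fin n → ℝ, (c : ℂ) ^ (n + 1) * PL c lam (Fin.snoc y t : Fin (n + 1) → ℝ) A *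
          PM c mu (Fin.cons 0 (Fin.snoc y t : Fin (n + 1) → ℝ) : Fin (n + 2) → ℝ) B =
          ∑ j ∈ A, ∑ b ∈ B, (∏ k ∈ A.erase j, (1 + Complex.I * c / (lam k - lam j))) *
        (∏ a ∈ B.erase b, (1 - Complex.I * c / (mu a - mu b))) * (Complex.exp (t * (Complex.I * lam j - Complex.I * mu b)) * c)
         * ((c : ℂ) ^ n * PL c lam y (A.erase j) *
          PM c mu (Fin.cons 0 y : Fin (n + 1) → ℝ) (B.erase b)) := by
        intro y
        rw [Fin.cons_snoc_eq_snoc_cons]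
        unfold PL PM
        rw [Phi_snoc, Phi_snoc, mul_assoc, Finset.sum_mul_sum, Finset.mul_sum]
        refine Finset.sum_congr rfl fun j _ => ?_
        rw [Finset.mul_sum]
        refine Finset.sum_congr rfl fun b _ => ?_
        rw [show (t:ℂ) * (Complex.I * lam j - Complex.I * mu b) = t * (Complex.I * lam j) + t * (-(Complex.I * mu b)) by ring,
          Complex.exp_add]
        ring
      simp only [e]
      rw [integral_finsetSum _ fun j _ => integrable_finsetSum _ fun b _ => (hInt0 _ _).const_mul _]
      refine Finset.sum_congr rfl fun j hj => ?_
      rw [integral_finsetSum _ fun b _ => (hInt0 _ _).const_mul _]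
      refine Finset.sum_congr rfl fun b _ => ?_
      rw [integral_const_mul, ← ih t ht.1 _ _ (by rw [Finset.card_erase_of_mem hj, hA]; rfl)]
      ring
    · refine (continuous_const.mul (PL_cont c lam _ A)).mul ((PM_cont c mu _ B).comp ?_)
      fun_prop

end Analytic
end Bethe
end Part7

section Part8
open scoped BigOperators
open Finset
open MeasureTheory

set_option linter.unusedSectionVars false

namespace Bethe

section Symm

def Do (n : ℕ) (L : ℝ) : Set (Fin n → ℝ) := {x | StrictMono x ∧ ∀ i, x i ∈ Set.Ioc 0 L}

lemma ae_generic (n : ℕ) : ∀ᵐ x : Fin n → ℝ, Function.Injective x ∧ ∀ i, x i ≠ 0 := by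
  have h1 : ∀ i : Fin n, ∀ᵐ x : Fin n → ℝ, x i ≠ 0 := by
    intro i
    have h := Measure.pi_hyperplane (fun _ : Fin n => (volume : Measure ℝ)) i 0
    rw [ae_iff, volume_pi]; simpa only [not_not] using h
  have h2 : ∀ i j : Fin n, i ≠ j → ∀ᵐ x : Fin n → ℝ, x i ≠ x j := by
    intro i j hij
    have hk : LinearMap.ker ((LinearMap.proj i : (Fin n → ℝ) →ₗ[ℝ] ℝ) - (LinearMap.proj j : (Fin n → ℝ) →ₗ[ℝ] ℝ)) ≠ ⊤ := by
      intro h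
      have h' : (Pi.single i 1 : Fin n → ℝ) ∈ (⊤ : Submodule ℝ (Fin n → ℝ)) := trivial
      rw [← h, LinearMap.mem_ker] at h'
      change (Pi.single i 1 : Fin n → ℝ) i - (Pi.single i 1 : Fin n → ℝ) j = 0 at h'
      simp [Pi.single_apply, hij.symm] at h'
    have := Measure.addHaar_submodule (volume : Measure (Fin n → ℝ)) _ hk
    rw [ae_iff]
    convert this using 2
    ext x
    change ¬ (x i ≠ x j) ↔ x i - x j = 0
    rw [sub_eq_zero, not_not]
  have h1' := ae_all_iff.2 h1
  have h2' : ∀ᵐ x : Fin n → ℝ, ∀ i j, i ≠ j → x i ≠ x j := by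
    refine ae_all_iff.2 fun i => ae_all_iff.2 fun j => ?_
    by_cases hij : i = j
    · simp [hij]
    · filter_upwards [h2 i j hij] with x hx _ using hx
  filter_upwards [h1', h2'] with x hx hx'
  exact ⟨fun i j h => by_contra fun hn => hx' i j hn h, hx⟩

lemma measurableSet_Do (n : ℕ) (L : ℝ) : MeasurableSet (Do n L) := by
  have : Do n L = (⋂ (a : Fin n) (b : Fin n) (_ : a < b), {x | x a < x b}) ∩
      Set.univ.pi fun _ => Set.Ioc 0 L := by
    ext x; simp [Do, StrictMono, Set.mem_pi]
  rw [this]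
  refine MeasurableSet.inter ?_ (MeasurableSet.univ_pi fun _ => measurableSet_Ioc)
  exact MeasurableSet.iInter fun a => MeasurableSet.iInter fun b => MeasurableSet.iInter fun _ =>
    measurableSet_lt (measurable_pi_apply a) (measurable_pi_apply b)

lemma Do_ae_Dl (n : ℕ) (L : ℝ) : Do n L =ᵐ[volume] Dl n L := by
  rw [Filter.eventuallyEq_set]
  filter_upwards [ae_generic n] with x hx
  constructor
  · rintro ⟨h1, h2⟩; exact ⟨h1.monotone, fun i => ⟨(h2 i).1.le, (h2 i).2⟩⟩
  · rintro ⟨h1, h2⟩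
    exact ⟨h1.strictMono_of_injective hx.1, fun i => ⟨lt_of_le_of_ne (h2 i).1 (hx.2 i).symm, (h2 i).2⟩⟩

theorem box_symm (n : ℕ) (L : ℝ) (H G : (Fin n → ℝ) → ℂ)
    (hsymm : ∀ (π : Equiv.Perm (Fin n)) (x : Fin n → ℝ), H (x ∘ π) = H x) (hG : Continuous G)
    (hHG : ∀ x, StrictMono x → (∀ i, 0 < x i) → H x = G x) :
    ∫ x in (Set.univ.pi fun _ : Fin n => Set.Icc (0 : ℝ) L), H x =
      (n.factorial : ℂ) * ∫ x in Dl n L, G x := by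
  have hE : Set.EqOn H G (Do n L) := fun x hx => hHG x hx.1 fun i => (hx.2 i).1
  have hI : IntegrableOn H (Do n L) := by
    have : IntegrableOn G (Do n L) := by
      rw [integrableOn_congr_set_ae (Do_ae_Dl n L)]
      exact hG.continuousOn.integrableOn_compact (isCompact_Dl _ _)
    exact this.congr_fun hE.symm (measurableSet_Do n L)
  have mp : ∀ π : Equiv.Perm (Fin n), MeasurePreserving (fun x : Fin n → ℝ => x ∘ π) volume volume ∧
      MeasurableEmbedding (fun x : Fin n → ℝ => x ∘ π) := by
    intro π
    have h := volume_measurePreserving_piCongrLeft (fun _ : Fin n => ℝ) π.symm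
    have h2 := (MeasurableEquiv.piCongrLeft (fun _ : Fin n => ℝ) π.symm).measurableEmbedding
    have e : (MeasurableEquiv.piCongrLeft (fun _ : Fin n => ℝ) π.symm : (Fin n → ℝ) → (Fin n → ℝ)) = fun x => x ∘ π := by
      funext x i
      have := MeasurableEquiv.piCongrLeft_apply_apply (β := fun _ : Fin n => ℝ) π.symm x (π i)
      rw [Equiv.symm_apply_apply] at this
      exact this
    rw [e] at h h2
    exact ⟨h, h2⟩
  have hU : (Set.univ.pi fun _ : Fin n => Set.Icc (0 : ℝ) L) =ᵐ[volume]
      ⋃ π : Equiv.Perm (Fin n), (fun x : Fin n → ℝ => x ∘ π) ⁻¹' Do n L := by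
    rw [Filter.eventuallyEq_set]
    filter_upwards [ae_generic n] with x hx
    rw [Set.mem_univ_pi, Set.mem_iUnion]
    constructor
    · intro h
      refine ⟨Tuple.sort x, ?_⟩
      refine ⟨(Tuple.monotone_sort x).strictMono_of_injective (hx.1.comp (Tuple.sort x).injective), fun i => ?_⟩
      exact ⟨lt_of_le_of_ne (h _).1 (hx.2 _).symm, (h _).2⟩
    · rintro ⟨π, h1, h2⟩ i
      have := h2 (π.symm i)
      simp only [Function.comp_apply, Equiv.apply_symm_apply] at this
      exact ⟨this.1.le, this.2⟩
  rw [setIntegral_congr_set hU, integral_iUnion_fintype]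
  · have : ∀ π : Equiv.Perm (Fin n), ∫ x in (fun x : Fin n → ℝ => x ∘ π) ⁻¹' Do n L, H x = ∫ x in Dl n L, G x := by
      intro π
      have h := (mp π).1.setIntegral_preimage_emb (mp π).2 H (Do n L)
      simp only [hsymm] at h
      rw [h, setIntegral_congr_fun (measurableSet_Do n L) hE, setIntegral_congr_set (Do_ae_Dl n L)]
    simp only [this, Finset.sum_const, Finset.card_univ, Fintype.card_perm, Fintype.card_fin, nsmul_eq_mul]
  · intro π; exact (mp π).1.measurable (measurableSet_Do n L)
  · intro π π' hne
    rw [Function.onFun, Set.disjoint_left]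
    rintro x ⟨h1, -⟩ ⟨h2, -⟩
    apply hne
    have h := Tuple.unique_monotone h1.monotone h2.monotone
    have hx : Function.Injective x := by
      have e : x = (x ∘ π) ∘ π.symm := by funext i; simp
      rw [e]; exact h1.injective.comp π.symm.injective
    exact Equiv.ext fun i => hx (congrFun h i)
  · intro π
    have := ((mp π).1.integrableOn_comp_preimage (mp π).2 (f := H) (s := Do n L)).2 hI
    have e : H ∘ (fun x : Fin n → ℝ => x ∘ π) = H := funext fun x => hsymm π x
    rwa [e] at this

end Symm
end Bethe
end Part8

section Part9
open scoped BigOperators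
open Finset
open MeasureTheory

set_option linter.unusedSectionVars false

namespace Bethe

section Wave

lemma prod_pairs {n : ℕ} (g : Fin n → Fin n → ℂ) :
    ∏ p ∈ (univ : Finset (Fin n × Fin n)).filter (fun p => p.1 < p.2), g p.1 p.2
      = ∏ a, ∏ b, if a < b then g a b else 1 := by
  rw [Finset.prod_filter, Fintype.prod_prod_type]

lemma prod_pairs_succ {n : ℕ} (g : Fin (n + 1) → Fin (n + 1) → ℂ) :
    ∏ p ∈ (univ : Finset (Fin (n + 1) × Fin (n + 1))).filter (fun p => p.1 < p.2), g p.1 p.2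
      = (∏ p ∈ (univ : Finset (Fin n × Fin n)).filter (fun p => p.1 < p.2), g p.1.castSucc p.2.castSucc) *
        ∏ a : Fin n, g a.castSucc (Fin.last n) := by
  rw [prod_pairs, prod_pairs (fun a b : Fin n => g a.castSucc b.castSucc), Fin.prod_univ_castSucc]
  have : ∏ b, (if Fin.last n < b then g (Fin.last n) b else 1) = 1 :=
    Finset.prod_eq_one fun b _ => if_neg (not_lt.2 (Fin.le_last b))
  rw [this, mul_one, ← Finset.prod_mul_distrib]
  refine Finset.prod_congr rfl fun a _ => ?_
  rw [Fin.prod_univ_castSucc, if_pos (Fin.castSucc_lt_last a)]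
  rfl

lemma prod_pairs_perm {n : ℕ} (g : Fin n → Fin n → ℂ) (hg : ∀ a b, g a b = g b a) (π : Equiv.Perm (Fin n)) :
    ∏ p ∈ (univ : Finset (Fin n × Fin n)).filter (fun p => p.1 < p.2), g (π p.1) (π p.2)
     = ∏ p ∈ (univ : Finset (Fin n × Fin n)).filter (fun p => p.1 < p.2), g p.1 p.2 := by
  refine Finset.prod_nbij' (fun p => if π p.1 < π p.2 then (π p.1, π p.2) else (π p.2, π p.1))
    (fun p => if π.symm p.1 < π.symm p.2 then (π.symm p.1, π.symm p.2) else (π.symm p.2, π.symm p.1))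
    ?_ ?_ ?_ ?_ ?_
  · rintro ⟨a, b⟩ h
    have h' : a < b := by simpa using h
    by_cases hc : π a < π b
    · simp [hc]
    · have : π b < π a := lt_of_le_of_ne (not_lt.1 hc) (π.injective.ne h'.ne')
      simp [hc, this]
  · rintro ⟨a, b⟩ h
    have h' : a < b := by simpa using h
    by_cases hc : π.symm a < π.symm b
    · simp [hc]
    · have : π.symm b < π.symm a := lt_of_le_of_ne (not_lt.1 hc) (π.symm.injective.ne h'.ne')
      simp [hc, this]
  · rintro ⟨a, b⟩ h
    have h' : a < b := by simpa using h
    by_cases hc : π a < π b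
    · simp [hc, h']
    · simp [hc, h'.le]
  · rintro ⟨a, b⟩ h
    have h' : a < b := by simpa using h
    by_cases hc : π.symm a < π.symm b
    · simp [hc, h']
    · simp [hc, h'.le]
  · rintro ⟨a, b⟩ h
    by_cases hc : π a < π b
    · simp [hc]
    · simp [hc, hg (π a)]

lemma betheWave_symm (c L : ℝ) (N : ℕ) (x : Fin N → ℝ) (lam : Fin N → ℂ) (π : Equiv.Perm (Fin N)) :
    betheWave c L N (x ∘ π) lam = betheWave c L N x lam := by
  unfold betheWave
  congr 1
  refine Fintype.sum_equiv (Equiv.mulRight π⁻¹) _ _ fun σ => ?_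
  set τ := Equiv.mulRight π⁻¹ σ with hτ
  have e : ∀ a, σ a = τ (π a) := by intro a; simp [hτ]
  simp only [e, Function.comp_apply]
  congr 1
  · refine prod_pairs_perm (fun u v => (lam (τ u) - lam (τ v) - Complex.I * (c : ℂ) * ((Real.sign (x u - x v) : ℝ) : ℂ)) /
          (lam (τ u) - lam (τ v))) ?_ π
    intro a b
    rw [← neg_sub (x a) (x b), Real.sign_neg, ← neg_div_neg_eq]
    push_cast
    congr 1 <;> ring
  · exact Equiv.prod_comp π (fun u => Complex.exp (Complex.I * lam (τ u) * (x u : ℂ)) *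
          Complex.exp (-(Complex.I * lam (τ u) * ((L : ℂ) / 2))))

lemma cons_comp_perm {N : ℕ} (x : Fin N → ℝ) (π : Equiv.Perm (Fin N)) :
    ∃ π' : Equiv.Perm (Fin (N + 1)), (Fin.cons 0 (x ∘ π) : Fin (N + 1) → ℝ) = (Fin.cons 0 x : Fin (N + 1) → ℝ) ∘ π' := by
  refine ⟨Equiv.Perm.decomposeFin.symm (0, π), ?_⟩
  funext i
  refine Fin.cases ?_ (fun i => ?_) i
  · simp
  · simp

variable {ι : Type*} [DecidableEq ι] [Fintype ι]

lemma Phi_eq_sum (w : ι → ι → ℂ) (e : ι → ℝ → ℂ) (n : ℕ) : ∀ (x : Fin n → ℝ) (A : Finset ι),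
    Phi w e n x A = ∑ s : Fin n → ι, if Function.Injective s ∧ univ.image s = A then
      (∏ p ∈ (univ : Finset (Fin n × Fin n)).filter (fun p => p.1 < p.2), w (s p.1) (s p.2)) *
        ∏ a, e (s a) (x a) else 0 := by
  induction n with
  | zero =>
    intro x A
    simp [Phi, Function.injective_of_subsingleton, eq_comm]
  | succ n ih =>
    intro x A
    rw [← (Fin.snocEquiv fun _ : Fin (n + 1) => ι).sum_comp, Fintype.sum_prod_type]
    simp only [Phi, ih]
    rw [← Finset.sum_filter_add_sum_filter_not univ (fun j => j ∈ A)]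
    rw [Finset.sum_eq_zero (s := univ.filter fun j => ¬ j ∈ A), add_zero]
    · rw [Finset.filter_mem_eq_inter, Finset.univ_inter]
      refine Finset.sum_congr rfl fun j hj => ?_
      rw [Finset.mul_sum]
      refine Finset.sum_congr rfl fun s _ => ?_
      change _ = if Function.Injective (Fin.snoc s j : Fin (n + 1) → ι) ∧ univ.image (Fin.snoc s j : Fin (n + 1) → ι) = A then
        (∏ p ∈ (univ : Finset (Fin (n + 1) × Fin (n + 1))).filter (fun p => p.1 < p.2), w ((Fin.snoc s j : Fin (n + 1) → ι) p.1) ((Fin.snoc s j : Fin (n + 1) → ι) p.2)) *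
        ∏ a, e ((Fin.snoc s j : Fin (n + 1) → ι) a) (x a) else 0
      have him : univ.image (Fin.snoc s j : Fin (n + 1) → ι) = insert j (univ.image s) := by
        ext k
        simp only [mem_image, mem_univ, true_and, mem_insert, Fin.exists_fin_succ', Fin.snoc_castSucc, Fin.snoc_last]
        rw [or_comm, eq_comm (a := j)]
      have hiff : (Function.Injective s ∧ univ.image s = A.erase j) ↔
          (Function.Injective (Fin.snoc s j : Fin (n + 1) → ι) ∧ univ.image (Fin.snoc s j : Fin (n + 1) → ι) = A) := by
        rw [Fin.snoc_injective_iff, him]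
        have hr : j ∉ Set.range s ↔ j ∉ univ.image s := by simp
        rw [hr]
        constructor
        · rintro ⟨h1, h2⟩
          rw [h2]
          exact ⟨⟨h1, Finset.notMem_erase _ _⟩, Finset.insert_erase hj⟩
        · rintro ⟨⟨h1, h2⟩, h3⟩
          exact ⟨h1, by rw [← h3, Finset.erase_insert h2]⟩
      by_cases h : Function.Injective s ∧ univ.image s = A.erase j
      · rw [if_pos h, if_pos (hiff.1 h)]
        rw [prod_pairs_succ (fun a b => w ((Fin.snoc s j : Fin (n + 1) → ι) a) ((Fin.snoc s j : Fin (n + 1) → ι) b)),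
          Fin.prod_univ_castSucc]
        simp only [Fin.snoc_castSucc, Fin.snoc_last]
        rw [← h.2, Finset.prod_image (fun a _ b _ h' => h.1 h')]
        simp only [Fin.init]
        ring
      · rw [if_neg h, if_neg (fun h' => h (hiff.2 h')), mul_zero]
    · intro j hj
      refine Finset.sum_eq_zero fun s _ => ?_
      rw [if_neg]
      rintro ⟨-, h⟩
      apply (Finset.mem_filter.1 hj).2
      rw [← h, Finset.mem_image]
      exact ⟨Fin.last n, mem_univ _, by simp [Fin.snocEquiv]⟩

lemma Phi_univ {N : ℕ} (w : Fin N → Fin N → ℂ) (e : Fin N → ℝ → ℂ) (x : Fin N → ℝ) :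
    Phi w e N x univ = ∑ σ : Equiv.Perm (Fin N),
      (∏ p ∈ (univ : Finset (Fin N × Fin N)).filter (fun p => p.1 < p.2), w (σ p.1) (σ p.2)) *
        ∏ a, e (σ a) (x a) := by
  rw [Phi_eq_sum, ← Finset.sum_filter]
  symm
  refine Finset.sum_bij (fun σ _ => (σ : Fin N → Fin N)) ?_ ?_ ?_ ?_
  · intro σ _
    simp [σ.injective, Finset.image_univ_of_surjective σ.surjective]
  · intro σ _ τ _ h; exact DFunLike.coe_injective h
  · intro s hs
    have hs' := (Finset.mem_filter.1 hs).2.1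
    exact ⟨Equiv.ofBijective s (Finite.injective_iff_bijective.1 hs'), mem_univ _, rfl⟩
  · intro σ _; rfl

lemma wave_lam (c L : ℝ) (N : ℕ) (x : Fin N → ℝ) (lam : Fin N → ℂ) (hlam : Function.Injective lam)
    (hx : StrictMono x) :
    betheWave c L N x lam = (-Complex.I * (Real.sqrt c : ℂ)) ^ N *
      ((∏ k, Complex.exp (-(Complex.I * lam k * ((L : ℂ) / 2)))) * PL c lam x univ) := by
  unfold betheWave PL
  rw [Phi_univ]
  congr 1
  rw [Finset.mul_sum]
  refine Finset.sum_congr rfl fun σ _ => ?_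
  rw [Finset.prod_mul_distrib, Equiv.prod_comp σ (fun k => Complex.exp (-(Complex.I * lam k * ((L : ℂ) / 2))))]
  have e1 : ∀ p ∈ (univ : Finset (Fin N × Fin N)).filter (fun p => p.1 < p.2),
     (lam (σ p.1) - lam (σ p.2) - Complex.I * (c : ℂ) * ((Real.sign (x p.1 - x p.2) : ℝ) : ℂ)) /
          (lam (σ p.1) - lam (σ p.2)) = 1 + Complex.I * c / (lam (σ p.1) - lam (σ p.2)) := by
    intro p hp
    have hp' := (Finset.mem_filter.1 hp).2
    rw [Real.sign_of_neg (sub_neg.2 (hx hp'))]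
    have : lam (σ p.1) - lam (σ p.2) ≠ 0 := sub_ne_zero.2 (hlam.ne (σ.injective.ne hp'.ne))
    field_simp
    push_cast
    ring
  rw [Finset.prod_congr rfl e1]
  have e2 : ∀ a, Complex.exp (Complex.I * lam (σ a) * (x a : ℂ)) = Complex.exp ((x a : ℂ) * (Complex.I * lam (σ a))) := by
    intro a; rw [mul_comm]
  simp only [e2]
  ring

lemma wave_mu (c L : ℝ) (N : ℕ) (x : Fin N → ℝ) (mu : Fin N → ℝ) (hmu : Function.Injective mu)
    (hx : StrictMono x) :
    (starRingEnd ℂ) (betheWave c L N x (fun a => (mu a : ℂ))) = (Complex.I * (Real.sqrt c : ℂ)) ^ N *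
      ((∏ k, Complex.exp (Complex.I * mu k * ((L : ℂ) / 2))) * PM c (fun a => (mu a : ℂ)) x univ) := by
  have hmu' : Function.Injective (fun a => (mu a : ℂ)) := Complex.ofReal_injective.comp hmu
  rw [wave_lam c L N x _ hmu' hx]
  unfold PL PM
  rw [Phi_univ, Phi_univ]
  simp only [map_mul, map_pow, map_prod, map_sum, map_neg, map_add, map_sub, map_div₀, map_one, ← Complex.exp_conj,
    Complex.conj_I, Complex.conj_ofReal, map_ofNat, neg_neg, neg_mul, mul_neg, neg_div]
  rfl

end Wave
end Bethe
end Part9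

section Part10
open scoped BigOperators
open Finset
open MeasureTheory

set_option linter.unusedSectionVars false

namespace Bethe

section Final

lemma add_Ic_ne (c : ℝ) (hc : c ≠ 0) (x : ℝ) : (x : ℂ) + Complex.I * c ≠ 0 := by
  intro h
  have := congrArg Complex.im h
  simp at this
  exact hc this

lemma sub_Ic_ne (c : ℝ) (hc : c ≠ 0) (x : ℝ) : (x : ℂ) - Complex.I * c ≠ 0 := by
  intro h
  have := congrArg Complex.im h
  simp at this
  exact hc this

lemma one_add_ne (c : ℝ) (hc : c ≠ 0) (x : ℝ) : 1 + Complex.I * c / (x : ℂ) ≠ 0 := by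
  by_cases hx : x = 0
  · simp [hx]
  · have hx' : (x : ℂ) ≠ 0 := by exact_mod_cast hx
    intro h
    apply add_Ic_ne c hc x
    have : (x : ℂ) + Complex.I * c = x * (1 + Complex.I * c / (x : ℂ)) := by field_simp
    rw [this, h, mul_zero]

lemma one_sub_ne (c : ℝ) (hc : c ≠ 0) (x : ℝ) : 1 - Complex.I * c / (x : ℂ) ≠ 0 := by
  have := one_add_ne c hc (-x)
  intro h; apply this
  rw [← h]; push_cast; rw [div_neg]; ring

lemma exp_arctan (c : ℝ) (hc : 0 < c) (x : ℝ) :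
    Complex.exp (Complex.I * ((2 * Real.arctan (x / c) : ℝ) : ℂ)) * ((x : ℂ) + Complex.I * c)
      = -((x : ℂ) - Complex.I * c) := by
  have h1 : (1 + ((x / c : ℝ) : ℂ) * Complex.I) ≠ 0 := by
    intro h; have := congrArg Complex.re h; simp at this
  have h2 : (1 - ((x / c : ℝ) : ℂ) * Complex.I) ≠ 0 := by
    intro h; have := congrArg Complex.re h; simp at this
  have e : Complex.I * ((2 * Real.arctan (x / c) : ℝ) : ℂ) =
      Complex.log ((1 + ((x / c : ℝ) : ℂ) * Complex.I) / (1 - ((x / c : ℝ) : ℂ) * Complex.I)) := by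
    rw [Complex.ofReal_mul, Complex.ofReal_arctan, Complex.arctan]
    generalize Complex.log ((1 + ((x / c : ℝ) : ℂ) * Complex.I) / (1 - ((x / c : ℝ) : ℂ) * Complex.I)) = z
    push_cast
    linear_combination (-z) * Complex.I_mul_I
  rw [e, Complex.exp_log (div_ne_zero h1 h2), div_mul_eq_mul_div, div_eq_iff h2]
  have hc' : (c : ℂ) ≠ 0 := by exact_mod_cast hc.ne'
  push_cast
  have hxc : (x : ℂ) / c * c = x := div_mul_cancel₀ _ hc'
  generalize (x : ℂ) / c = y at *
  rw [← hxc]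
  linear_combination (2 * y * (c : ℂ)) * Complex.I_mul_I

lemma bethe_exp (c L : ℝ) (hc : 0 < c) {m : ℕ} (v : Fin m → ℝ) (hv : Function.Injective v) (j : Fin m) (n : ℤ)
    (h : L * v j + ∑ p, 2 * Real.arctan ((v j - v p) / c) = 2 * Real.pi * ((n : ℝ) - ((m : ℝ) + 1) / 2)) :
    Complex.exp (L * (Complex.I * v j)) * ∏ p, (1 - Complex.I * c / ((v j : ℂ) - v p))
      = ∏ p, (1 + Complex.I * c / ((v j : ℂ) - v p)) := by
  have h1 : Complex.exp (L * (Complex.I * v j)) * ∏ p, Complex.exp (Complex.I * ((2 * Real.arctan ((v j - v p) / c) : ℝ) : ℂ))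
      = (-1) ^ (m + 1) := by
    rw [← Complex.exp_sum, ← Complex.exp_add, ← Finset.mul_sum]
    have e : (L : ℂ) * (Complex.I * v j) + Complex.I * ∑ p, ((2 * Real.arctan ((v j - v p) / c) : ℝ) : ℂ)
        = Complex.I * ((L * v j + ∑ p, 2 * Real.arctan ((v j - v p) / c) : ℝ) : ℂ) := by
      push_cast; ring
    rw [e, h]
    have e2 : Complex.I * ((2 * Real.pi * ((n : ℝ) - ((m : ℝ) + 1) / 2) : ℝ) : ℂ)
        = -(((m + 1 : ℕ) : ℂ) * (Real.pi * Complex.I)) + (n : ℂ) * (2 * Real.pi * Complex.I) := by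
      push_cast; ring
    rw [e2, Complex.exp_add, Complex.exp_int_mul_two_pi_mul_I, mul_one, Complex.exp_neg, Complex.exp_nat_mul,
      Complex.exp_pi_mul_I, ← inv_pow]
    norm_num
  have h2 : (∏ p, Complex.exp (Complex.I * ((2 * Real.arctan ((v j - v p) / c) : ℝ) : ℂ))) *
      ∏ p, (((v j - v p : ℝ) : ℂ) + Complex.I * c) = (-1) ^ m * ∏ p, (((v j - v p : ℝ) : ℂ) - Complex.I * c) := by
    rw [← Finset.prod_mul_distrib, Finset.prod_congr rfl fun p _ => exp_arctan c hc (v j - v p)]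
    rw [Finset.prod_neg, Finset.card_univ, Fintype.card_fin]
  have hc' : (c : ℂ) ≠ 0 := by exact_mod_cast hc.ne'
  have hv0 : ∀ p ∈ univ.erase j, (v j : ℂ) - v p ≠ 0 := fun p hp =>
    sub_ne_zero.2 fun h' => (Finset.ne_of_mem_erase hp) (hv (Complex.ofReal_injective h'.symm))
  set D := ∏ p ∈ univ.erase j, ((v j : ℂ) - v p) with hD
  have hD0 : D ≠ 0 := Finset.prod_ne_zero_iff.2 hv0
  have f1 : ∏ p, (((v j - v p : ℝ) : ℂ) + Complex.I * c) = (Complex.I * c) * D * ∏ p, (1 + Complex.I * c / ((v j : ℂ) - v p)) := by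
    rw [← Finset.mul_prod_erase univ _ (mem_univ j), ← Finset.mul_prod_erase univ (fun p => 1 + Complex.I * c / ((v j : ℂ) - v p)) (mem_univ j)]
    rw [sub_self, sub_self, div_zero, add_zero, one_mul, Complex.ofReal_zero, zero_add, mul_assoc (Complex.I * (c : ℂ)) D, hD, ← Finset.prod_mul_distrib]
    congr 1
    refine Finset.prod_congr rfl fun p hp => ?_
    have := hv0 p hp
    push_cast
    field_simp
  have f2 : ∏ p, (((v j - v p : ℝ) : ℂ) - Complex.I * c) = -(Complex.I * c) * D * ∏ p, (1 - Complex.I * c / ((v j : ℂ) - v p)) := by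
    rw [← Finset.mul_prod_erase univ _ (mem_univ j), ← Finset.mul_prod_erase univ (fun p => 1 - Complex.I * c / ((v j : ℂ) - v p)) (mem_univ j)]
    rw [sub_self, sub_self, div_zero, sub_zero, one_mul, Complex.ofReal_zero, zero_sub, mul_assoc (-(Complex.I * (c : ℂ))) D, hD, ← Finset.prod_mul_distrib]
    congr 1
    refine Finset.prod_congr rfl fun p hp => ?_
    have := hv0 p hp
    push_cast
    field_simp
  rw [f1, f2] at h2
  have hk : (Complex.I * c) * D ≠ 0 := mul_ne_zero (mul_ne_zero Complex.I_ne_zero hc') hD0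
  have hm : ((-1 : ℂ) ^ m) ≠ 0 := pow_ne_zero _ (by norm_num)
  refine mul_left_cancel₀ hk (mul_left_cancel₀ hm ?_)
  generalize ∏ p, Complex.exp (Complex.I * ((2 * Real.arctan ((v j - v p) / c) : ℝ) : ℂ)) = X at *
  rw [pow_succ] at h1
  linear_combination (Complex.exp (L * (Complex.I * v j))) * h2 - (Complex.I * c) * D * (∏ p, (1 + Complex.I * c / ((v j : ℂ) - v p))) * h1

lemma bethe_inj (c L : ℝ) {m : ℕ} (v : Fin m → ℝ) (r : Fin m → ℤ) (hr : StrictMono r) (K : ℝ)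
    (h : ∀ j, L * v j + ∑ p, 2 * Real.arctan ((v j - v p) / c) = 2 * Real.pi * ((r j : ℝ) - K)) :
    Function.Injective v := by
  intro a b hab
  have ha := h a
  rw [hab, h b] at ha
  have h2 : (r b : ℝ) = r a := by
    have := mul_left_cancel₀ (by positivity) ha
    linarith
  exact (hr.injective (by exact_mod_cast h2)).symm

lemma Ep_univ {κ : Type*} [Fintype κ] (η : ℂ) (mu : κ → ℂ) (x : ℂ) :
    Ep η ((univ : Finset κ).toList.map mu) x = ∏ a, (1 + η / (x - mu a)) := by
  unfold Ep
  rw [List.map_map, Finset.prod_map_toList]; rfl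

theorem RHS_eq (c : ℝ) (hc : 0 < c) (N : ℕ) (mu : Fin (N + 1) → ℝ) (lam : Fin N → ℝ)
    (hlam : Function.Injective lam)
    (hne : ∀ (b : Fin (N + 1)) (k : Fin N), mu b ≠ lam k)
    (hS : ∀ j : Fin N,
      shiftS c N (fun a => (mu a : ℂ)) (fun a => (lam a : ℂ)) ((lam j : ℂ)) ≠ 1) :
     (∏ k : Fin N,
              (1 - shiftS c N (fun a => (mu a : ℂ)) (fun a => (lam a : ℂ)) ((lam k : ℂ))) *
              ∏ b : Fin (N + 1),
                ((mu b : ℂ) - (lam k : ℂ) - Complex.I * (c : ℂ)) /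
                  ((mu b : ℂ) - (lam k : ℂ))) *
          Matrix.det
            ((1 : Matrix (Fin N) (Fin N) ℂ) +
              Matrix.of (fun j k : Fin N =>
                -Complex.I *
                    (∏ a : Fin (N + 1),
                      ((lam j : ℂ) - (mu a : ℂ)) /
                        ((lam j : ℂ) - (mu a : ℂ) + Complex.I * (c : ℂ))) *
                    ((∏ a : Fin N,
                        ((lam j : ℂ) - (lam a : ℂ) + Complex.I * (c : ℂ))) /
                      (∏ a ∈ Finset.univ.erase j, ((lam j : ℂ) - (lam a : ℂ)))) *
                    (((2 * c / (c ^ 2 + (lam j - lam k) ^ 2) : ℝ) : ℂ) /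
                      (shiftS c N (fun a => (mu a : ℂ)) (fun a => (lam a : ℂ))
                          ((lam j : ℂ)) - 1)))) =
      detM (Complex.I * c) (fun a => (lam a : ℂ)) ((univ : Finset (Fin (N + 1))).toList.map fun a => (mu a : ℂ)) := by
  have hc' : (c : ℂ) ≠ 0 := by exact_mod_cast hc.ne'
  have hI : (Complex.I * c) ≠ 0 := mul_ne_zero Complex.I_ne_zero (by exact_mod_cast hc.ne')
  have hml : ∀ j a, (lam j : ℂ) - mu a ≠ 0 := fun j a =>
    sub_ne_zero.2 fun h => hne a j (Complex.ofReal_injective h.symm)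
  have hcp : ∀ x y : ℝ, (x : ℂ) - y + Complex.I * c ≠ 0 := fun x y => by
    have := add_Ic_ne c hc.ne' (x - y); push_cast at this; exact this
  have hcm : ∀ x y : ℝ, (x : ℂ) - y - Complex.I * c ≠ 0 := fun x y => by
    have := sub_Ic_ne c hc.ne' (x - y); push_cast at this; exact this
  have hll : ∀ j, ∀ p ∈ univ.erase j, (lam j : ℂ) - lam p ≠ 0 := fun j p hp =>
    sub_ne_zero.2 fun h' => (Finset.ne_of_mem_erase hp) (hlam (Complex.ofReal_injective h'.symm))
  unfold detM
  rw [← Matrix.det_mul_column, ← Matrix.det_mul_column]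
  congr 1
  ext j k
  simp only [Matrix.of_apply, NN, Matrix.add_apply, Ep_univ]
  set S := shiftS c N (fun a => (mu a : ℂ)) (fun a => (lam a : ℂ)) ((lam j : ℂ)) with hSd
  set E := ∏ a, (1 + Complex.I * c / ((lam j : ℂ) - mu a)) with hE
  set E' := ∏ a, (1 + -(Complex.I * c) / ((lam j : ℂ) - mu a)) with hE'
  set a₁ := aa (Complex.I * c) (fun a => (lam a : ℂ)) j with ha1
  set a₂ := aa (-(Complex.I * c)) (fun a => (lam a : ℂ)) j with ha2
  have hE0 : E ≠ 0 := Finset.prod_ne_zero_iff.2 fun a _ => by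
    have := one_add_ne c hc.ne' (lam j - mu a); push_cast at this; exact this
  have ha10 : a₁ ≠ 0 := Finset.prod_ne_zero_iff.2 fun a _ => by
    have := one_add_ne c hc.ne' (lam j - lam a); push_cast at this; exact this
  have ha20 : a₂ ≠ 0 := Finset.prod_ne_zero_iff.2 fun a _ => by
    have := one_sub_ne c hc.ne' (lam j - lam a); push_cast at this; rw [neg_div, ← sub_eq_add_neg]; exact this
  have b1 : ∏ b : Fin (N + 1), ((mu b : ℂ) - (lam j : ℂ) - Complex.I * (c : ℂ)) / ((mu b : ℂ) - (lam j : ℂ)) = E := by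
    refine Finset.prod_congr rfl fun a _ => ?_
    have := hml j a
    rw [← neg_div_neg_eq, show -((mu a : ℂ) - lam j) = lam j - mu a by ring]
    field_simp
    ring
  have b2 : ∏ a : Fin (N + 1), ((lam j : ℂ) - (mu a : ℂ)) / ((lam j : ℂ) - (mu a : ℂ) + Complex.I * (c : ℂ)) = E⁻¹ := by
    rw [hE, ← Finset.prod_inv_distrib]
    refine Finset.prod_congr rfl fun a _ => ?_
    have := hml j a
    have := hcp (lam j) (mu a)
    have h3 : 1 + Complex.I * c / ((lam j : ℂ) - mu a) = ((lam j : ℂ) - (mu a : ℂ) + Complex.I * (c : ℂ)) / ((lam j : ℂ) - mu a) := by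
      field_simp
    rw [h3, inv_div]
  set D := ∏ a ∈ univ.erase j, ((lam j : ℂ) - (lam a : ℂ)) with hD
  have hD0 : D ≠ 0 := Finset.prod_ne_zero_iff.2 (hll j)
  have b3 : ∏ a : Fin N, ((lam j : ℂ) - (lam a : ℂ) + Complex.I * (c : ℂ)) = Complex.I * c * (D * a₁) := by
    rw [ha1, aa, ← Finset.mul_prod_erase univ _ (mem_univ j),
      ← Finset.mul_prod_erase univ (fun p => 1 + Complex.I * c / ((lam j : ℂ) - lam p)) (mem_univ j)]
    rw [sub_self, div_zero, add_zero, one_mul, zero_add, hD, ← Finset.prod_mul_distrib]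
    congr 1
    refine Finset.prod_congr rfl fun p hp => ?_
    have := hll j p hp
    field_simp
  have b4 : ∏ a : Fin N, ((lam j : ℂ) - (lam a : ℂ) - Complex.I * (c : ℂ)) = -(Complex.I * c) * (D * a₂) := by
    rw [ha2, aa, ← Finset.mul_prod_erase univ _ (mem_univ j),
      ← Finset.mul_prod_erase univ (fun p => 1 + -(Complex.I * c) / ((lam j : ℂ) - lam p)) (mem_univ j)]
    rw [sub_self, div_zero, add_zero, one_mul, zero_sub, hD, ← Finset.prod_mul_distrib]
    congr 1
    refine Finset.prod_congr rfl fun p hp => ?_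
    have := hll j p hp
    field_simp
    ring
  have bS : S = E' / E * -(a₁ / a₂) := by
    rw [hSd]
    unfold shiftS
    congr 1
    · rw [hE, hE', ← Finset.prod_div_distrib]
      refine Finset.prod_congr rfl fun a _ => ?_
      have h1 := hml j a
      have h2 := hcp (lam j) (mu a)
      rw [← neg_div_neg_eq]
      have h3 : 1 + Complex.I * c / ((lam j : ℂ) - mu a) = -((mu a : ℂ) - lam j - Complex.I * c) / ((lam j : ℂ) - mu a) := by
        field_simp; ring
      have h4 : 1 + -(Complex.I * c) / ((lam j : ℂ) - mu a) = -((mu a : ℂ) - lam j + Complex.I * c) / ((lam j : ℂ) - mu a) := by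
        field_simp; ring
      rw [h3, h4, div_div_div_cancel_right₀ h1]
    · have : ∏ a : Fin N, ((lam a : ℂ) - lam j - Complex.I * c) / ((lam a : ℂ) - lam j + Complex.I * c)
          = (∏ a : Fin N, ((lam j : ℂ) - (lam a : ℂ) + Complex.I * (c : ℂ))) / ∏ a : Fin N, ((lam j : ℂ) - (lam a : ℂ) - Complex.I * (c : ℂ)) := by
        rw [← Finset.prod_div_distrib]
        refine Finset.prod_congr rfl fun a _ => ?_
        rw [← neg_div_neg_eq]
        congr 1 <;> ring
      rw [this, b3, b4]
      field_simp
  have hK : ((2 * c / (c ^ 2 + (lam j - lam k) ^ 2) : ℝ) : ℂ) * Complex.I =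
      1 / ((lam j : ℂ) - lam k - Complex.I * c) - 1 / ((lam j : ℂ) - lam k + Complex.I * c) := by
    have h1 := hcp (lam j) (lam k)
    have h2 := hcm (lam j) (lam k)
    have h3 : ((lam j : ℂ) - lam k - Complex.I * c) * ((lam j : ℂ) - lam k + Complex.I * c) = (c : ℂ) ^ 2 + (lam j - lam k) ^ 2 := by
      linear_combination (-(c : ℂ) ^ 2) * Complex.I_mul_I
    push_cast
    rw [div_sub_div _ _ h2 h1, h3]
    ring
  have hS1 : S - 1 ≠ 0 := sub_ne_zero.2 (hS j)
  rw [b1, b2, b3, ← hK]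
  have hdiag : (1 - S) * E = a₁ * (E / a₁ + E' / a₂) := by
    rw [bS]; field_simp; ring
  have hoff : (1 - S) * E * (-Complex.I * E⁻¹ * (Complex.I * c * (D * a₁) / D) *
      (((2 * c / (c ^ 2 + (lam j - lam k) ^ 2) : ℝ) : ℂ) / (S - 1))) = a₁ * ((Complex.I * c) * (((2 * c / (c ^ 2 + (lam j - lam k) ^ 2) : ℝ) : ℂ) * Complex.I)) := by
    generalize ((2 * c / (c ^ 2 + (lam j - lam k) ^ 2) : ℝ) : ℂ) = K
    rw [← sub_eq_zero]
    field_simp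
    ring
  rw [mul_add, hoff, mul_add, Matrix.one_apply]
  congr 1
  by_cases hjk : j = k
  · simp only [hjk, if_true, mul_one] at *
    exact hdiag
  · simp only [hjk, if_false, mul_zero]

end Final
end Bethe
end Part10

section Part11
open scoped BigOperators
open Finset
open MeasureTheory

set_option linter.unusedSectionVars false

namespace Bethe

section Final2

theorem RR_value (c L : ℝ) (hc : 0 < c) (N : ℕ)
    (mu : Fin (N + 1) → ℝ) (ℓ : Fin (N + 1) → ℤ) (hmu : Function.Injective mu)
    (hmuBethe : ∀ r : Fin (N + 1),
      L * mu r + ∑ p : Fin (N + 1), 2 * Real.arctan ((mu r - mu p) / c)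
        = 2 * Real.pi * ((ℓ r : ℝ) - ((N : ℝ) + 2) / 2))
    (lam : Fin N → ℝ) (r : Fin N → ℤ) (hlam : Function.Injective lam)
    (hlamBethe : ∀ j : Fin N,
      L * lam j + ∑ p : Fin N, 2 * Real.arctan ((lam j - lam p) / c)
        = 2 * Real.pi * ((r j : ℝ) - ((N : ℝ) + 1) / 2))
    (hne : ∀ (b : Fin (N + 1)) (k : Fin N), mu b ≠ lam k) :
    RR (Complex.I * c) (fun a => (lam a : ℂ)) (fun a => (mu a : ℂ)) L univ =
      detM (Complex.I * c) (fun a => (lam a : ℂ)) ((univ : Finset (Fin (N + 1))).toList.map fun a => (mu a : ℂ)) := by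
  have hlam' : Function.Injective (fun a => (lam a : ℂ)) := Complex.ofReal_injective.comp hlam
  have hmu' : Function.Injective (fun a => (mu a : ℂ)) := Complex.ofReal_injective.comp hmu
  have hne' : ∀ (j : Fin N) (b : Fin (N + 1)), (mu b : ℂ) ≠ lam j := fun j b h => hne b j (Complex.ofReal_injective h)
  have hI : (Complex.I * c) ≠ 0 := mul_ne_zero Complex.I_ne_zero (by exact_mod_cast hc.ne')
  rw [RR_onshell (Complex.I * c) _ hlam' _ hmu' hne' L]
  · have hη : ∀ j k, (lam j : ℂ) - lam k ≠ Complex.I * c := fun j k h => by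
      have := sub_Ic_ne c hc.ne' (lam j - lam k)
      push_cast at this
      exact this (sub_eq_zero.2 h)
    have h := detM_eq_Fl (Complex.I * c) hI _ hlam' hη
      ((univ : Finset (Fin (N + 1))).toList.map fun a => (mu a : ℂ)) (by
        intro m hm j
        obtain ⟨a, -, rfl⟩ := List.mem_map.1 hm
        exact hne' j a) N (by simp) id Function.injective_id
    rw [Finset.image_id] at h
    rw [Function.comp_id] at h
    rw [h]
    unfold DD FF
    have e1 : (univ : Finset (Fin N ⊕ Fin (N + 1))).toLeft = univ := by ext; simp
    have e2 : (univ : Finset (Fin N ⊕ Fin (N + 1))).toRight = univ := by ext; simp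
    rw [e1, e2]
  · rintro (j | a) (k | b)
    · have := one_add_ne c hc.ne' (lam j - lam k); push_cast at this; exact this
    · exact one_ne_zero
    · exact one_ne_zero
    · have := one_sub_ne c hc.ne' (mu a - mu b); push_cast at this; exact this
  · rintro (j | b)
    · have := bethe_exp c L hc lam hlam j (r j) (hlamBethe j)
      simp only [mom, Finset.sum_singleton, Sum.elim_inl, Fintype.prod_sum_type, ww, Finset.prod_const_one, mul_one]
      rw [← this]
      congr 1
      refine Finset.prod_congr rfl fun k _ => ?_
      rw [show (lam k : ℂ) - lam j = -((lam j : ℂ) - lam k) by ring, div_neg, ← sub_eq_add_neg]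
    · have := bethe_exp c L hc mu hmu b (ℓ b) (by rw [hmuBethe b]; push_cast; ring)
      simp only [mom, Finset.sum_singleton, Sum.elim_inr, Fintype.prod_sum_type, ww, Finset.prod_const_one, one_mul]
      have e : ∏ x, (1 - Complex.I * c / ((mu x : ℂ) - mu b)) = ∏ x, (1 + Complex.I * c / ((mu b : ℂ) - mu x)) := by
        refine Finset.prod_congr rfl fun k _ => ?_
        rw [show (mu k : ℂ) - mu b = -((mu b : ℂ) - mu k) by ring, div_neg, sub_neg_eq_add]
      rw [e, ← this, ← mul_assoc, ← Complex.exp_add]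
      rw [show (L : ℂ) * -(Complex.I * mu b) + L * (Complex.I * mu b) = 0 by ring, Complex.exp_zero, one_mul]

theorem LHS_eq (c L : ℝ) (hc : 0 < c) (hL : 0 < L) (N : ℕ)
    (mu : Fin (N + 1) → ℝ) (hmu : Function.Injective mu)
    (lam : Fin N → ℝ) (hlam : Function.Injective lam)
    (hne : ∀ (b : Fin (N + 1)) (k : Fin N), mu b ≠ lam k) :
    (1 / (N.factorial : ℂ)) *
        ∫ x in (Set.univ.pi fun _ : Fin N => Set.Icc (0 : ℝ) L),
          (starRingEnd ℂ)
              (betheWave c L (N + 1) (Fin.cons 0 x) (fun a => (mu a : ℂ))) *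
            betheWave c L N x (fun a => (lam a : ℂ))
      = Complex.I * (Real.sqrt c : ℂ) *
          (∏ a : Fin (N + 1), Complex.exp (Complex.I * mu a * ((L : ℂ) / 2))) *
          (∏ k : Fin N, Complex.exp (-(Complex.I * lam k * ((L : ℂ) / 2)))) *
        RR (Complex.I * c) (fun a => (lam a : ℂ)) (fun a => (mu a : ℂ)) L univ := by
  have hlam' : Function.Injective (fun a => (lam a : ℂ)) := Complex.ofReal_injective.comp hlam
  have hmu' : Function.Injective (fun a => (mu a : ℂ)) := Complex.ofReal_injective.comp hmu
  have hne' : ∀ (j : Fin N) (b : Fin (N + 1)), (mu b : ℂ) ≠ lam j := fun j b h => hne b j (Complex.ofReal_injective h)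
  set A := ∏ a : Fin (N + 1), Complex.exp (Complex.I * mu a * ((L : ℂ) / 2)) with hA
  set B := ∏ k : Fin N, Complex.exp (-(Complex.I * lam k * ((L : ℂ) / 2))) with hB
  have hcc : (Real.sqrt c : ℂ) * (Real.sqrt c : ℂ) = c := by
    rw [← Complex.ofReal_mul, Real.mul_self_sqrt hc.le]
  have hpow : (Complex.I * (Real.sqrt c : ℂ)) ^ (N + 1) * (-Complex.I * (Real.sqrt c : ℂ)) ^ N
      = Complex.I * (Real.sqrt c : ℂ) * (c : ℂ) ^ N := by
    rw [pow_succ, mul_right_comm, ← mul_pow, mul_comm]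
    congr 2
    linear_combination hcc - (Real.sqrt c : ℂ) ^ 2 * Complex.I_mul_I
  have hfac : (N.factorial : ℂ) ≠ 0 := by exact_mod_cast N.factorial_ne_zero
  rw [box_symm N L (fun x => (starRingEnd ℂ)
              (betheWave c L (N + 1) (Fin.cons 0 x) (fun a => (mu a : ℂ))) *
            betheWave c L N x (fun a => (lam a : ℂ)))
      (fun x => (Complex.I * (Real.sqrt c : ℂ) * A * B) * ((c : ℂ) ^ N * PL c (fun a => (lam a : ℂ)) x univ *
        PM c (fun a => (mu a : ℂ)) (Fin.cons 0 x : Fin (N + 1) → ℝ) univ))]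
  · rw [← mul_assoc, one_div, inv_mul_cancel₀ hfac, one_mul, MeasureTheory.integral_const_mul,
      ← RR_eq_integral c _ hlam' _ hmu' hne' N L hL.le univ univ (by simp), Finset.univ_disjSum_univ]
  · intro π x
    obtain ⟨π', hπ'⟩ := cons_comp_perm x π
    rw [hπ', betheWave_symm, betheWave_symm]
  · refine continuous_const.mul ((continuous_const.mul (PL_cont c _ N univ)).mul ((PM_cont c _ (N + 1) univ).comp ?_))
    fun_prop
  · intro x hx hx0
    have hcons : StrictMono (Fin.cons 0 x : Fin (N + 1) → ℝ) := by
      intro i j hij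
      induction i using Fin.cases with
      | zero =>
        induction j using Fin.cases with
        | zero => exact absurd hij (lt_irrefl _)
        | succ j => simpa using hx0 j
      | succ i =>
        induction j using Fin.cases with
        | zero => exact absurd hij (by simp)
        | succ j => simpa using hx (by simpa using hij)
    rw [wave_mu c L (N + 1) _ mu hmu hcons, wave_lam c L N x _ hlam' hx, ← hA, ← hB]
    linear_combination (A * B * PL c (fun a => (lam a : ℂ)) x univ *
        PM c (fun a => (mu a : ℂ)) (Fin.cons 0 x : Fin (N + 1) → ℝ) univ) * hpow

end Final2
end Bethe
end Part11

/-- determinant representation for the form factor of the conjugated field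
operator between the on-shell states μ (N+1 particles) and λ (N particles) in the
continuous non-linear Schrödinger model. -/
theorem conjugated_field_form_factor_determinant
    (c L : ℝ) (hc : 0 < c) (hL : 0 < L) (N : ℕ) (hN : 1 ≤ N)
    (mu : Fin (N + 1) → ℝ) (ℓ : Fin (N + 1) → ℤ) (hℓ : StrictMono ℓ)
    (hmuBethe : ∀ r : Fin (N + 1),
      L * mu r + ∑ p : Fin (N + 1), 2 * Real.arctan ((mu r - mu p) / c)
        = 2 * Real.pi * ((ℓ r : ℝ) - ((N : ℝ) + 2) / 2))
    (lam : Fin N → ℝ) (r : Fin N → ℤ) (hr : StrictMono r)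
    (hlamBethe : ∀ j : Fin N,
      L * lam j + ∑ p : Fin N, 2 * Real.arctan ((lam j - lam p) / c)
        = 2 * Real.pi * ((r j : ℝ) - ((N : ℝ) + 1) / 2))
    (hne : ∀ (b : Fin (N + 1)) (k : Fin N), mu b ≠ lam k)
    (hS : ∀ j : Fin N,
      shiftS c N (fun a => (mu a : ℂ)) (fun a => (lam a : ℂ)) ((lam j : ℂ)) ≠ 1) :
    (1 / (N.factorial : ℂ)) *
        ∫ x in (Set.univ.pi fun _ : Fin N => Set.Icc (0 : ℝ) L),
          (starRingEnd ℂ)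
              (betheWave c L (N + 1) (Fin.cons 0 x) (fun a => (mu a : ℂ))) *
            betheWave c L N x (fun a => (lam a : ℂ))
      = Complex.I * (Real.sqrt c : ℂ) *
          (∏ a : Fin (N + 1), Complex.exp (Complex.I * (L : ℂ) * (mu a : ℂ) / 2)) *
          (∏ k : Fin N,
            Complex.exp (-(Complex.I * (L : ℂ) * (lam k : ℂ) / 2)) *
              (1 - shiftS c N (fun a => (mu a : ℂ)) (fun a => (lam a : ℂ)) ((lam k : ℂ))) *
              ∏ b : Fin (N + 1),
                ((mu b : ℂ) - (lam k : ℂ) - Complex.I * (c : ℂ)) /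
                  ((mu b : ℂ) - (lam k : ℂ))) *
          Matrix.det
            ((1 : Matrix (Fin N) (Fin N) ℂ) +
              Matrix.of (fun j k : Fin N =>
                -Complex.I *
                    (∏ a : Fin (N + 1),
                      ((lam j : ℂ) - (mu a : ℂ)) /
                        ((lam j : ℂ) - (mu a : ℂ) + Complex.I * (c : ℂ))) *
                    ((∏ a : Fin N,
                        ((lam j : ℂ) - (lam a : ℂ) + Complex.I * (c : ℂ))) /
                      (∏ a ∈ Finset.univ.erase j, ((lam j : ℂ) - (lam a : ℂ)))) *
                    (((2 * c / (c ^ 2 + (lam j - lam k) ^ 2) : ℝ) : ℂ) /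
                      (shiftS c N (fun a => (mu a : ℂ)) (fun a => (lam a : ℂ))
                          ((lam j : ℂ)) - 1)))) := by
  have hlam : Function.Injective lam := Bethe.bethe_inj c L lam r hr _ hlamBethe
  have hmu : Function.Injective mu := Bethe.bethe_inj c L mu ℓ hℓ _ hmuBethe
  rw [Bethe.LHS_eq c L hc hL N mu hmu lam hlam hne,
    Bethe.RR_value c L hc N mu ℓ hmu hmuBethe lam r hlam hlamBethe hne,
    ← Bethe.RHS_eq c hc N mu lam hlam hne hS]
  simp only [mul_assoc (Complex.exp _), Finset.prod_mul_distrib (s := (Finset.univ : Finset (Fin N)))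
    (f := fun k : Fin N => Complex.exp (-(Complex.I * (L : ℂ) * (lam k : ℂ) / 2)))]
  have e1 : ∀ a, Complex.I * (L : ℂ) * (mu a : ℂ) / 2 = Complex.I * mu a * ((L : ℂ) / 2) := fun a => by ring
  have e2 : ∀ a, Complex.I * (L : ℂ) * (lam a : ℂ) / 2 = Complex.I * lam a * ((L : ℂ) / 2) := fun a => by ring
  simp only [e1, e2]
  simp only [mul_assoc]
end
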